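/- Let G be a connected affine algebraic group over ℂ, G_red a Levi subgroup, X = G/G_red the associated homogeneous affine variety, and 𝔞 a finite-dimensional algebraic G-module. For any p ≥ 0, the locally finite algebraic group cohomology of G with coefficients in the G-module Ω^p(X, 𝔞) of algebraic de Rham p-forms on X with values in 𝔞 satisfies: H^0_alg(G, Ω^p(X, 𝔞)) = Ω^p(X, 𝔞)^G (the G-invariant forms), and H^q_alg(G, Ω^p(X, 𝔞)) = 0 for all q > 0. -/

import Mathlib

noncomputable section

open MvPolynomial

/-- Points of affine `n`-space over `ℂ`. -/
abbrev Pt (n : ℕ) : Type := Fin n → ℂ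

/-- A subset of `ℂ^n` is an (affine) algebraic set if it is the common zero
locus of a set of polynomials. -/
def IsAlgebraicSet {n : ℕ} (V : Set (Pt n)) : Prop :=
  ∃ S : Set (MvPolynomial (Fin n) ℂ), V = {x : Pt n | ∀ p ∈ S, eval x p = 0}

/-- A map `ℂ^n → ℂ^m` is regular (polynomial) on a subset `V ⊆ ℂ^n`. -/
def IsRegularOn {n m : ℕ} (V : Set (Pt n)) (f : Pt n → Pt m) : Prop :=
  ∃ P : Fin m → MvPolynomial (Fin n) ℂ, ∀ x ∈ V, ∀ i, f x i = eval x (P i)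

def Pt.left {n m : ℕ} (z : Pt (n + m)) : Pt n := fun i => z (Fin.castAdd m i)
def Pt.right {n m : ℕ} (z : Pt (n + m)) : Pt m := fun i => z (Fin.natAdd n i)

/-- An affine algebraic group over `ℂ`, realized as an algebraic subset of some
`ℂ^n`, with polynomial multiplication and inversion. -/
structure AffAlgGroup : Type where
  n : ℕ
  carrier : Set (Pt n)
  isAlgebraic : IsAlgebraicSet carrier
  one : Pt n
  one_mem : one ∈ carrier
  mul : Pt n → Pt n → Pt n
  inv : Pt n → Pt n
  mul_mem : ∀ {x y : Pt n}, x ∈ carrier → y ∈ carrier → mul x y ∈ carrier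
  inv_mem : ∀ {x : Pt n}, x ∈ carrier → inv x ∈ carrier
  mul_assoc' : ∀ {x y z : Pt n}, x ∈ carrier → y ∈ carrier → z ∈ carrier →
    mul (mul x y) z = mul x (mul y z)
  one_mul' : ∀ {x : Pt n}, x ∈ carrier → mul one x = x
  mul_one' : ∀ {x : Pt n}, x ∈ carrier → mul x one = x
  inv_mul' : ∀ {x : Pt n}, x ∈ carrier → mul (inv x) x = one
  mul_regular : IsRegularOn
    {z : Pt (n + n) | Pt.left z ∈ carrier ∧ Pt.right z ∈ carrier}
    (fun z => mul (Pt.left z) (Pt.right z))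
  inv_regular : IsRegularOn carrier inv

namespace AffAlgGroup

/-- The group of `ℂ`-points of `G`, as a bundled group. -/
def Gp (G : AffAlgGroup) : Type := {x : Pt G.n // x ∈ G.carrier}

instance (G : AffAlgGroup) : Group G.Gp where
  mul x y := ⟨G.mul x.1 y.1, G.mul_mem x.2 y.2⟩
  one := ⟨G.one, G.one_mem⟩
  inv x := ⟨G.inv x.1, G.inv_mem x.2⟩
  mul_assoc a b c := Subtype.ext (G.mul_assoc' a.2 b.2 c.2)
  one_mul a := Subtype.ext (G.one_mul' a.2)
  mul_one a := Subtype.ext (G.mul_one' a.2)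
  inv_mul_cancel a := Subtype.ext (G.inv_mul' a.2)

/-- The Euclidean (classical) topology on the points of `G`. -/
instance (G : AffAlgGroup) : TopologicalSpace G.Gp :=
  instTopologicalSpaceSubtype

/-- Connectedness of an affine algebraic group: the carrier cannot be divided
into two disjoint relatively (Zariski-)closed pieces. -/
def IsConnected (G : AffAlgGroup) : Prop :=
  ∀ V W : Set (Pt G.n), IsAlgebraicSet V → IsAlgebraicSet W →
    G.carrier ⊆ V ∪ W → G.carrier ∩ (V ∩ W) = ∅ →
    G.carrier ⊆ V ∨ G.carrier ⊆ W

def IsAbelianGrp (G : AffAlgGroup) : Prop :=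
  ∀ x ∈ G.carrier, ∀ y ∈ G.carrier, G.mul x y = G.mul y x

/-- `G` is a torus: it is isomorphic, as an algebraic group, to `(ℂ*)^k`;
the isomorphism and its inverse are required to be given by (Laurent)
polynomials. -/
def IsTorus (G : AffAlgGroup) : Prop :=
  ∃ (k : ℕ) (φ : (Fin k → ℂˣ) → Pt G.n),
    (∀ u, φ u ∈ G.carrier) ∧
    Function.Injective φ ∧
    (∀ x ∈ G.carrier, ∃ u, φ u = x) ∧
    φ (fun _ => 1) = G.one ∧
    (∀ u v, φ (u * v) = G.mul (φ u) (φ v)) ∧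
    (∀ i : Fin G.n, ∃ P : MvPolynomial (Fin k ⊕ Fin k) ℂ,
      ∀ u, φ u i = eval (Sum.elim (fun j => (u j : ℂ)) (fun j => ((u j)⁻¹ : ℂˣ))) P) ∧
    (∀ j : Fin k, ∃ Q : MvPolynomial (Fin G.n) ℂ, ∀ u, (u j : ℂ) = eval (φ u) Q)

end AffAlgGroup

/-- matrix entry access for a point of `ℂ^{m·m}` viewed as an `m × m` matrix -/
def matEntry {m : ℕ} (x : Pt (m * m)) (i j : Fin m) : ℂ := x (finProdFinEquiv (i, j))

/-- matrix multiplication on points of `ℂ^{m·m}` -/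
def matMulPt (m : ℕ) (x y : Pt (m * m)) : Pt (m * m) :=
  fun idx => ∑ k : Fin m,
    matEntry x (finProdFinEquiv.symm idx).1 k * matEntry y k (finProdFinEquiv.symm idx).2

/-- the identity matrix as a point of `ℂ^{m·m}` -/
def idMatPt (m : ℕ) : Pt (m * m) :=
  fun idx => if (finProdFinEquiv.symm idx).1 = (finProdFinEquiv.symm idx).2 then 1 else 0

/-- an upper triangular matrix with `1`'s on the diagonal -/
def IsUnitriangular (m : ℕ) (x : Pt (m * m)) : Prop :=
  (∀ i : Fin m, matEntry x i i = 1) ∧ (∀ i j : Fin m, j < i → matEntry x i j = 0)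

/-- `G` is unipotent: it admits a faithful polynomial representation by
upper triangular unipotent matrices. -/
def AffAlgGroup.IsUnipotent (G : AffAlgGroup) : Prop :=
  ∃ (m : ℕ) (φ : Pt G.n → Pt (m * m)),
    IsRegularOn G.carrier φ ∧
    Set.InjOn φ G.carrier ∧
    (∀ x ∈ G.carrier, IsUnitriangular m (φ x)) ∧
    (∀ x ∈ G.carrier, ∀ y ∈ G.carrier, φ (G.mul x y) = matMulPt m (φ x) (φ y))

/-- A homomorphism of affine algebraic groups: a polynomial map which is
multiplicative on points. -/
structure AlgGroupHom (G H : AffAlgGroup) : Type where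
  toFun : Pt G.n → Pt H.n
  maps_to : ∀ {x : Pt G.n}, x ∈ G.carrier → toFun x ∈ H.carrier
  map_mul : ∀ {x y : Pt G.n}, x ∈ G.carrier → y ∈ G.carrier →
    toFun (G.mul x y) = H.mul (toFun x) (toFun y)
  regular : IsRegularOn G.carrier toFun

/-- An algebraic action of `G` on `A` by group automorphisms. -/
structure AlgAction (G A : AffAlgGroup) : Type where
  act : Pt G.n → Pt A.n → Pt A.n
  maps_to : ∀ {g : Pt G.n} {a : Pt A.n}, g ∈ G.carrier → a ∈ A.carrier →
    act g a ∈ A.carrier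
  act_one : ∀ {a : Pt A.n}, a ∈ A.carrier → act G.one a = a
  act_mul : ∀ {g h : Pt G.n} {a : Pt A.n}, g ∈ G.carrier → h ∈ G.carrier →
    a ∈ A.carrier → act (G.mul g h) a = act g (act h a)
  act_map_mul : ∀ {g : Pt G.n} {a b : Pt A.n}, g ∈ G.carrier → a ∈ A.carrier →
    b ∈ A.carrier → act g (A.mul a b) = A.mul (act g a) (act g b)
  act_bij : ∀ {g : Pt G.n}, g ∈ G.carrier → ∀ a ∈ A.carrier, ∃ b ∈ A.carrier, act g b = a
  regular : IsRegularOn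
    {z : Pt (G.n + A.n) | Pt.left z ∈ G.carrier ∧ Pt.right z ∈ A.carrier}
    (fun z => act (Pt.left z) (Pt.right z))

/-- the trivial action of `G` on `A` -/
def AlgAction.IsTrivial {G A : AffAlgGroup} (ρ : AlgAction G A) : Prop :=
  ∀ g ∈ G.carrier, ∀ a ∈ A.carrier, ρ.act g a = a

/-- An extension `1 → A → E → G → 1` of affine algebraic groups inducing
(via conjugation in `E`) the action `ρ` of `G` on `A`. -/
structure AlgExtension (G A : AffAlgGroup) (ρ : AlgAction G A) : Type where
  E : AffAlgGroup
  i : AlgGroupHom A E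
  q : AlgGroupHom E G
  i_inj : Set.InjOn i.toFun A.carrier
  q_surj : ∀ g ∈ G.carrier, ∃ x ∈ E.carrier, q.toFun x = g
  exact : ∀ x ∈ E.carrier, (q.toFun x = G.one ↔ ∃ a ∈ A.carrier, i.toFun a = x)
  conj_compat : ∀ x ∈ E.carrier, ∀ a ∈ A.carrier,
    E.mul x (E.mul (i.toFun a) (E.inv x)) = i.toFun (ρ.act (q.toFun x) a)

namespace AlgExtension

variable {G A : AffAlgGroup} {ρ : AlgAction G A}

/-- An extension splits if the quotient map admits an algebraic group
theoretic section. -/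
def Splits (e : AlgExtension G A ρ) : Prop :=
  ∃ σ : AlgGroupHom G e.E, ∀ g ∈ G.carrier, e.q.toFun (σ.toFun g) = g

/-- Equivalence of extensions (via a morphism over `G` and under `A`;
such a morphism is automatically an isomorphism). -/
def Equiv (e₁ e₂ : AlgExtension G A ρ) : Prop :=
  ∃ f : AlgGroupHom e₁.E e₂.E,
    (∀ a ∈ A.carrier, f.toFun (e₁.i.toFun a) = e₂.i.toFun a) ∧
    (∀ x ∈ e₁.E.carrier, e₂.q.toFun (f.toFun x) = e₁.q.toFun x)

/-- `e₃` is a Baer sum of `e₁` and `e₂`: there is a regular map from the fiber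
product `E₁ ×_G E₂` to `E₃` which is multiplicative, lies over `G` and
restricts to the multiplication `A × A → A` on the kernels.  (This
characterizes the Baer sum up to equivalence.) -/
def IsBaerSum (e₁ e₂ e₃ : AlgExtension G A ρ) : Prop :=
  ∃ h : Pt (e₁.E.n + e₂.E.n) → Pt e₃.E.n,
    IsRegularOn {z : Pt (e₁.E.n + e₂.E.n) | Pt.left z ∈ e₁.E.carrier ∧
      Pt.right z ∈ e₂.E.carrier ∧ e₁.q.toFun (Pt.left z) = e₂.q.toFun (Pt.right z)} h ∧
    (∀ x ∈ e₁.E.carrier, ∀ y ∈ e₂.E.carrier, e₁.q.toFun x = e₂.q.toFun y →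
      h (Fin.append x y) ∈ e₃.E.carrier) ∧
    (∀ x x' y y', x ∈ e₁.E.carrier → x' ∈ e₁.E.carrier → y ∈ e₂.E.carrier →
      y' ∈ e₂.E.carrier → e₁.q.toFun x = e₂.q.toFun y → e₁.q.toFun x' = e₂.q.toFun y' →
      h (Fin.append (e₁.E.mul x x') (e₂.E.mul y y')) =
        e₃.E.mul (h (Fin.append x y)) (h (Fin.append x' y'))) ∧
    (∀ x ∈ e₁.E.carrier, ∀ y ∈ e₂.E.carrier, e₁.q.toFun x = e₂.q.toFun y →
      e₃.q.toFun (h (Fin.append x y)) = e₁.q.toFun x) ∧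
    (∀ a ∈ A.carrier, ∀ b ∈ A.carrier,
      h (Fin.append (e₁.i.toFun a) (e₂.i.toFun b)) = e₃.i.toFun (A.mul a b))

end AlgExtension

/-- A realization of the abelian group `Ext_alg(G, A)` of equivalence classes
of extensions of `G` by `A` (inducing the action `ρ`), with addition given by
the Baer sum, and zero element the class of split extensions. -/
structure IsExtGroup (G A : AffAlgGroup) (ρ : AlgAction G A)
    (Ext : Type) [AddCommGroup Ext] : Prop where
  exists_cls : ∃ cls : AlgExtension G A ρ → Ext,
    Function.Surjective cls ∧
    (∀ e₁ e₂, cls e₁ = cls e₂ ↔ Relation.EqvGen AlgExtension.Equiv e₁ e₂) ∧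
    (∀ e, cls e = 0 ↔ e.Splits) ∧
    (∀ e₁ e₂ e₃, AlgExtension.IsBaerSum e₁ e₂ e₃ → cls e₁ + cls e₂ = cls e₃)

/-- The class map itself, when we need to name it. -/
structure ExtClassMap (G A : AffAlgGroup) (ρ : AlgAction G A)
    (Ext : Type) [AddCommGroup Ext] : Type where
  cls : AlgExtension G A ρ → Ext
  surj : Function.Surjective cls
  cls_eq_iff : ∀ e₁ e₂, cls e₁ = cls e₂ ↔ Relation.EqvGen AlgExtension.Equiv e₁ e₂
  cls_eq_zero_iff : ∀ e, cls e = 0 ↔ e.Splits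
  cls_baer : ∀ e₁ e₂ e₃, AlgExtension.IsBaerSum e₁ e₂ e₃ → cls e₁ + cls e₂ = cls e₃

/-- An algebraic subgroup of `G`. -/
structure AlgSubgroup (G : AffAlgGroup) : Type where
  carrier : Set (Pt G.n)
  subset : carrier ⊆ G.carrier
  isAlgebraic : IsAlgebraicSet carrier
  one_mem : G.one ∈ carrier
  mul_mem : ∀ {x y : Pt G.n}, x ∈ carrier → y ∈ carrier → G.mul x y ∈ carrier
  inv_mem : ∀ {x : Pt G.n}, x ∈ carrier → G.inv x ∈ carrier

namespace AlgSubgroup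

variable {G : AffAlgGroup}

/-- An algebraic subgroup is itself an affine algebraic group. -/
def toGrp (H : AlgSubgroup G) : AffAlgGroup where
  n := G.n
  carrier := H.carrier
  isAlgebraic := H.isAlgebraic
  one := G.one
  one_mem := H.one_mem
  mul := G.mul
  inv := G.inv
  mul_mem := H.mul_mem
  inv_mem := H.inv_mem
  mul_assoc' hx hy hz := G.mul_assoc' (H.subset hx) (H.subset hy) (H.subset hz)
  one_mul' hx := G.one_mul' (H.subset hx)
  mul_one' hx := G.mul_one' (H.subset hx)
  inv_mul' hx := G.inv_mul' (H.subset hx)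
  mul_regular := by
    obtain ⟨P, hP⟩ := G.mul_regular
    exact ⟨P, fun z hz => hP z ⟨H.subset hz.1, H.subset hz.2⟩⟩
  inv_regular := by
    obtain ⟨P, hP⟩ := G.inv_regular
    exact ⟨P, fun x hx => hP x (H.subset hx)⟩

def IsNormal (H : AlgSubgroup G) : Prop :=
  ∀ g ∈ G.carrier, ∀ x ∈ H.carrier, G.mul g (G.mul x (G.inv g)) ∈ H.carrier

/-- `H` is the unipotent radical of `G`: the largest connected normal
unipotent algebraic subgroup. -/
def IsUnipotentRadical (H : AlgSubgroup G) : Prop :=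
  H.IsNormal ∧ H.toGrp.IsConnected ∧ H.toGrp.IsUnipotent ∧
    ∀ K : AlgSubgroup G, K.IsNormal → K.toGrp.IsConnected → K.toGrp.IsUnipotent →
      K.carrier ⊆ H.carrier

/-- `G` is reductive: its unipotent radical is trivial. -/
def _root_.AffAlgGroup.IsReductive (G : AffAlgGroup) : Prop :=
  ∀ K : AlgSubgroup G, K.IsNormal → K.toGrp.IsConnected → K.toGrp.IsUnipotent →
    K.carrier = {G.one}

end AlgSubgroup

/-- A Levi decomposition `G = G_u ⋊ G_red` of `G`:  `Gu` is the unipotent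
radical and `L` is a connected reductive algebraic subgroup with
`Gu ∩ L = 1` and `Gu · L = G`. -/
structure LeviDecomposition (G : AffAlgGroup) : Type where
  Gu : AlgSubgroup G
  L : AlgSubgroup G
  Gu_radical : Gu.IsUnipotentRadical
  L_connected : L.toGrp.IsConnected
  L_reductive : L.toGrp.IsReductive
  inter : Gu.carrier ∩ L.carrier = {G.one}
  decomp : ∀ x ∈ G.carrier, ∃ u ∈ Gu.carrier, ∃ l ∈ L.carrier, x = G.mul u l

/-- The group homomorphism on point groups induced by a morphism of algebraic
groups. -/
def AlgGroupHom.toGpHom {G H : AffAlgGroup} (f : AlgGroupHom G H) : G.Gp →* H.Gp :=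
  MonoidHom.mk' (fun x => ⟨f.toFun x.1, f.maps_to x.2⟩)
    (fun a b => Subtype.ext (f.map_mul a.2 b.2))

/-- The subgroup of the point group underlying an algebraic subgroup. -/
def AlgSubgroup.toSubgroup {G : AffAlgGroup} (H : AlgSubgroup G) : Subgroup G.Gp where
  carrier := {x : G.Gp | x.1 ∈ H.carrier}
  one_mem' := H.one_mem
  mul_mem' := fun ha hb => H.mul_mem ha hb
  inv_mem' := fun ha => H.inv_mem ha

/-- Iterated product (powers) in an algebraic group. -/
def AffAlgGroup.pow (G : AffAlgGroup) (x : Pt G.n) : ℕ → Pt G.n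
  | 0 => G.one
  | k + 1 => G.mul x (G.pow x k)

/-- The inclusion homomorphism of an algebraic subgroup. -/
def AlgSubgroup.incl {A : AffAlgGroup} (H : AlgSubgroup A) : H.toGrp.Gp →* A.Gp :=
  MonoidHom.mk' (fun x => ⟨x.1, H.subset x.2⟩) (fun _ _ => rfl)
/-! ### Tangent spaces and Lie algebras -/

/-- The (Zariski) tangent space at `x₀` of a subset `V ⊆ ℂ^n`: the directions
annihilated by the differentials at `x₀` of all polynomials vanishing on `V`. -/
def tangentAt {n : ℕ} (V : Set (Pt n)) (x₀ : Pt n) : Submodule ℂ (Pt n) where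
  carrier := {v | ∀ p : MvPolynomial (Fin n) ℂ, (∀ x ∈ V, eval x p = 0) →
    ∑ j, v j * eval x₀ (pderiv j p) = 0}
  zero_mem' := by intro p hp; simp
  add_mem' := by
    intro a b ha hb p hp
    simp only [Pi.add_apply, add_mul, Finset.sum_add_distrib, ha p hp, hb p hp, add_zero]
  smul_mem' := by
    intro t a ha p hp
    simp only [Pi.smul_apply, smul_eq_mul, mul_assoc, ← Finset.mul_sum, ha p hp, mul_zero]

/-- A family of polynomials representing the commutator map
`(x, y) ↦ x y x⁻¹ y⁻¹` of `G` on `G × G`. -/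
def IsCommutatorRep (G : AffAlgGroup) (F : Fin G.n → MvPolynomial (Fin (G.n + G.n)) ℂ) : Prop :=
  ∀ x ∈ G.carrier, ∀ y ∈ G.carrier, ∀ i,
    G.mul (G.mul x y) (G.mul (G.inv x) (G.inv y)) i = eval (Fin.append x y) (F i)

/-- `𝔤` (an abstract complex Lie algebra) is the Lie algebra of `G`, via the
linear identification `e` of `𝔤` with the tangent space of `G` at the
identity; the Lie bracket corresponds to the mixed second-order term at the
identity of the commutator map of `G`. -/
structure IsLieAlgebraOf (G : AffAlgGroup) (𝔤 : Type) [LieRing 𝔤] [LieAlgebra ℂ 𝔤]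
    (e : 𝔤 →ₗ[ℂ] Pt G.n) : Prop where
  inj : Function.Injective e
  range_eq : ∀ v : Pt G.n, (∃ u : 𝔤, e u = v) ↔ v ∈ tangentAt G.carrier G.one
  bracket_eq : ∀ F, IsCommutatorRep G F → ∀ u v : 𝔤, ∀ i : Fin G.n,
    e ⁅u, v⁆ i = ∑ j, ∑ k, e u j * e v k *
      eval (Fin.append G.one G.one)
        (pderiv (Fin.castAdd G.n j) (pderiv (Fin.natAdd G.n k) (F i)))

/-- The Lie subalgebra `𝔥 ⊆ 𝔤` corresponds to the algebraic subgroup `H ⊆ G`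
(under the identification `e` of `𝔤` with the tangent space of `G` at `1`). -/
def IsLieSubalgebraOf {G : AffAlgGroup} (H : AlgSubgroup G) {𝔤 : Type} [LieRing 𝔤]
    [LieAlgebra ℂ 𝔤] (e : 𝔤 →ₗ[ℂ] Pt G.n) (𝔥 : LieSubalgebra ℂ 𝔤) : Prop :=
  ∀ u : 𝔤, u ∈ 𝔥 ↔ e u ∈ tangentAt H.carrier G.one

/-! ### The relative Chevalley–Eilenberg complex of a pair `(𝔤, 𝔥)` -/

section CE
set_option linter.unusedSectionVars false

variable {𝔤 : Type} [LieRing 𝔤] [LieAlgebra ℂ 𝔤]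
variable {M : Type} [AddCommGroup M] [Module ℂ M] [LieRingModule 𝔤 M]

/-- `c` is an alternating `p`-multilinear map `𝔤^p → M`. -/
def IsMultilinearAlt (p : ℕ) (c : (Fin p → 𝔤) → M) : Prop :=
  (∀ (v : Fin p → 𝔤) (i : Fin p) (x y : 𝔤),
    c (Function.update v i (x + y)) = c (Function.update v i x) + c (Function.update v i y)) ∧
  (∀ (v : Fin p → 𝔤) (i : Fin p) (t : ℂ) (x : 𝔤),
    c (Function.update v i (t • x)) = t • c (Function.update v i x)) ∧
  (∀ (v : Fin p → 𝔤) (i j : Fin p), i ≠ j → v i = v j → c v = 0)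

/-- The Chevalley–Eilenberg differential (in the form valid on alternating
cochains). -/
def ceD (p : ℕ) (c : (Fin p → 𝔤) → M) : (Fin (p + 1) → 𝔤) → M := fun v =>
  (∑ i : Fin (p + 1), ((-1 : ℤ) ^ (i : ℕ)) • ⁅v i, c (fun k => v (i.succAbove k))⁆) +
  ∑ i : Fin (p + 1), ∑ j : Fin (p + 1),
    if h : i < j then
      ((-1 : ℤ) ^ ((i : ℕ) + 1)) •
        c (Function.update (fun k => v (i.succAbove k))
            (j.pred (Fin.pos_iff_ne_zero.mp (lt_of_le_of_lt (Fin.zero_le i) h)))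
            ⁅v i, v j⁆)
    else 0

lemma ceD_zero (p : ℕ) : ceD (M := M) (𝔤 := 𝔤) p 0 = 0 := by
  funext v
  simp [ceD]

lemma ceD_add (p : ℕ) (c c' : (Fin p → 𝔤) → M) :
    ceD p (c + c') = ceD p c + ceD p c' := by
  funext v
  simp only [ceD, Pi.add_apply]
  have e1 : (∑ i : Fin (p + 1), ((-1 : ℤ) ^ (i : ℕ)) •
      ⁅v i, c (fun k => v (i.succAbove k)) + c' (fun k => v (i.succAbove k))⁆)
      = (∑ i : Fin (p + 1), ((-1 : ℤ) ^ (i : ℕ)) • ⁅v i, c (fun k => v (i.succAbove k))⁆)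
      + ∑ i : Fin (p + 1), ((-1 : ℤ) ^ (i : ℕ)) • ⁅v i, c' (fun k => v (i.succAbove k))⁆ := by
    rw [← Finset.sum_add_distrib]
    exact Finset.sum_congr rfl fun i _ => by rw [lie_add, smul_add]
  rw [e1]
  have e2 : ∀ i j : Fin (p + 1),
      (if h : i < j then ((-1 : ℤ) ^ ((i : ℕ) + 1)) •
        ((c (Function.update (fun k => v (i.succAbove k))
            (j.pred (Fin.pos_iff_ne_zero.mp (lt_of_le_of_lt (Fin.zero_le i) h))) ⁅v i, v j⁆))
         + (c' (Function.update (fun k => v (i.succAbove k))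
            (j.pred (Fin.pos_iff_ne_zero.mp (lt_of_le_of_lt (Fin.zero_le i) h))) ⁅v i, v j⁆)))
       else 0)
      = (if h : i < j then ((-1 : ℤ) ^ ((i : ℕ) + 1)) •
          (c (Function.update (fun k => v (i.succAbove k))
            (j.pred (Fin.pos_iff_ne_zero.mp (lt_of_le_of_lt (Fin.zero_le i) h))) ⁅v i, v j⁆))
         else 0)
      + (if h : i < j then ((-1 : ℤ) ^ ((i : ℕ) + 1)) •
          (c' (Function.update (fun k => v (i.succAbove k))
            (j.pred (Fin.pos_iff_ne_zero.mp (lt_of_le_of_lt (Fin.zero_le i) h))) ⁅v i, v j⁆))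
         else 0) := by
    intro i j
    by_cases h : i < j <;> simp [h, smul_add]
  simp only [e2, Finset.sum_add_distrib]
  try abel

lemma ceD_neg (p : ℕ) (c : (Fin p → 𝔤) → M) : ceD p (-c) = -(ceD p c) := by
  have h := ceD_add p c (-c)
  simp only [add_neg_cancel, ceD_zero] at h
  rw [eq_comm, neg_eq_iff_add_eq_zero, eq_comm, ← h]
  try rfl

/-- `c` is a relative `p`-cochain for the pair `(𝔤, 𝔥)`: alternating
multilinear, vanishing when one argument lies in `𝔥`, and `𝔥`-equivariant. -/
def IsRelCochain (𝔥 : LieSubalgebra ℂ 𝔤) (p : ℕ) (c : (Fin p → 𝔤) → M) : Prop :=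
  IsMultilinearAlt p c ∧
  (∀ v : Fin p → 𝔤, (∃ i, v i ∈ 𝔥) → c v = 0) ∧
  (∀ x : 𝔤, x ∈ 𝔥 → ∀ v : Fin p → 𝔤,
    ⁅x, c v⁆ = ∑ i, c (Function.update v i ⁅x, v i⁆))

lemma isRelCochain_zero (𝔥 : LieSubalgebra ℂ 𝔤) (p : ℕ) :
    IsRelCochain (M := M) 𝔥 p 0 := by
  refine ⟨⟨?_, ?_, ?_⟩, ?_, ?_⟩ <;> intros <;> simp

lemma isRelCochain_add (𝔥 : LieSubalgebra ℂ 𝔤) (p : ℕ) {c c' : (Fin p → 𝔤) → M}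
    (h : IsRelCochain 𝔥 p c) (h' : IsRelCochain 𝔥 p c') :
    IsRelCochain 𝔥 p (c + c') := by
  obtain ⟨⟨hm, hs, ha⟩, hv, he⟩ := h
  obtain ⟨⟨hm', hs', ha'⟩, hv', he'⟩ := h'
  refine ⟨⟨?_, ?_, ?_⟩, ?_, ?_⟩
  · intro v i x y
    simp only [Pi.add_apply, hm, hm']
    abel
  · intro v i t x
    simp only [Pi.add_apply, hs, hs', smul_add]
  · intro v i j hij hvv
    simp only [Pi.add_apply, ha v i j hij hvv, ha' v i j hij hvv, add_zero]
  · intro v hv₀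
    simp only [Pi.add_apply, hv v hv₀, hv' v hv₀, add_zero]
  · intro x hx v
    simp only [Pi.add_apply, lie_add, he x hx v, he' x hx v, Finset.sum_add_distrib]

lemma isRelCochain_neg (𝔥 : LieSubalgebra ℂ 𝔤) (p : ℕ) {c : (Fin p → 𝔤) → M}
    (h : IsRelCochain 𝔥 p c) : IsRelCochain 𝔥 p (-c) := by
  obtain ⟨⟨hm, hs, ha⟩, hv, he⟩ := h
  refine ⟨⟨?_, ?_, ?_⟩, ?_, ?_⟩
  · intro v i x y
    simp only [Pi.neg_apply, hm]
    abel
  · intro v i t x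
    simp only [Pi.neg_apply, hs, smul_neg]
  · intro v i j hij hvv
    simp only [Pi.neg_apply, ha v i j hij hvv, neg_zero]
  · intro v hv₀
    simp only [Pi.neg_apply, hv v hv₀, neg_zero]
  · intro x hx v
    simp only [Pi.neg_apply, lie_neg, he x hx v, Finset.sum_neg_distrib]

/-- The group of relative `p`-cocycles of the pair `(𝔤, 𝔥)` with values in `M`. -/
def relZ (𝔥 : LieSubalgebra ℂ 𝔤) (M : Type) [AddCommGroup M] [Module ℂ M]
    [LieRingModule 𝔤 M] (p : ℕ) : AddSubgroup ((Fin p → 𝔤) → M) where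
  carrier := {c | IsRelCochain 𝔥 p c ∧ ∀ v, ceD p c v = 0}
  zero_mem' := ⟨isRelCochain_zero 𝔥 p, fun v => by rw [ceD_zero]; rfl⟩
  add_mem' := by
    rintro c c' ⟨hc, hcz⟩ ⟨hc', hcz'⟩
    refine ⟨isRelCochain_add 𝔥 p hc hc', fun v => ?_⟩
    rw [ceD_add]
    simp [hcz v, hcz' v]
  neg_mem' := by
    rintro c ⟨hc, hcz⟩
    refine ⟨isRelCochain_neg 𝔥 p hc, fun v => ?_⟩
    rw [ceD_neg]
    simp [hcz v]

/-- The group of relative `(p+1)`-coboundaries of the pair `(𝔤, 𝔥)`. -/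
def relB (𝔥 : LieSubalgebra ℂ 𝔤) (M : Type) [AddCommGroup M] [Module ℂ M]
    [LieRingModule 𝔤 M] (p : ℕ) : AddSubgroup ((Fin (p + 1) → 𝔤) → M) where
  carrier := {c | ∃ f : (Fin p → 𝔤) → M, IsRelCochain 𝔥 p f ∧ c = ceD p f}
  zero_mem' := ⟨0, isRelCochain_zero 𝔥 p, (ceD_zero p).symm⟩
  add_mem' := by
    rintro c c' ⟨f, hf, rfl⟩ ⟨f', hf', rfl⟩
    exact ⟨f + f', isRelCochain_add 𝔥 p hf hf', (ceD_add p f f').symm⟩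
  neg_mem' := by
    rintro c ⟨f, hf, rfl⟩
    exact ⟨-f, isRelCochain_neg 𝔥 p hf, (ceD_neg p f).symm⟩

/-- The relative Lie algebra cohomology `H^p(𝔤, 𝔥, M)` of the pair `(𝔤, 𝔥)`
with coefficients in the `𝔤`-module `M`. -/
def relH (𝔥 : LieSubalgebra ℂ 𝔤) (M : Type) [AddCommGroup M] [Module ℂ M]
    [LieRingModule 𝔤 M] : ℕ → Type
  | 0 => ↥(relZ 𝔥 M 0)
  | (p + 1) => ↥(relZ 𝔥 M (p + 1)) ⧸ ((relB 𝔥 M p).addSubgroupOf (relZ 𝔥 M (p + 1)))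

instance relH.instAddCommGroup (𝔥 : LieSubalgebra ℂ 𝔤) (M : Type) [AddCommGroup M]
    [Module ℂ M] [LieRingModule 𝔤 M] (p : ℕ) : AddCommGroup (relH 𝔥 M p) :=
  match p with
  | 0 => inferInstanceAs (AddCommGroup ↥(relZ 𝔥 M 0))
  | (p + 1) => inferInstanceAs
      (AddCommGroup (↥(relZ 𝔥 M (p + 1)) ⧸ ((relB 𝔥 M p).addSubgroupOf (relZ 𝔥 M (p + 1)))))

/-- The class in `H^{p+1}(𝔤, 𝔥, M)` of a relative cocycle. -/
def relHClass (𝔥 : LieSubalgebra ℂ 𝔤) (M : Type) [AddCommGroup M] [Module ℂ M]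
    [LieRingModule 𝔤 M] (p : ℕ) (c : ↥(relZ 𝔥 M (p + 1))) : relH 𝔥 M (p + 1) :=
  QuotientAddGroup.mk c

end CE

/-- matrix-vector action on points -/
def matVec (m : ℕ) (a : Pt (m * m)) (w : Pt m) : Pt m :=
  fun i => ∑ k : Fin m, matEntry a i k * w k

/-- A finite-dimensional algebraic representation of `G` on `ℂ^m`, given by a
regular matrix-valued multiplicative map. -/
structure AlgRep (G : AffAlgGroup) (m : ℕ) : Type where
  ρ : Pt G.n → Pt (m * m)
  regular : IsRegularOn G.carrier ρ
  map_one : ρ G.one = idMatPt m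
  map_mul : ∀ {x y : Pt G.n}, x ∈ G.carrier → y ∈ G.carrier →
    ρ (G.mul x y) = matMulPt m (ρ x) (ρ y)

/-- The (abstract) `𝔤`-module structure on `ℂ^m` is the derived action of the
algebraic representation `r` of `G` (under the identification `e : 𝔤 ≅ L(G)`),
i.e. it is given by differentiating `r` at the identity. -/
def IsDerivedAction {G : AffAlgGroup} {m : ℕ} (r : AlgRep G m) {𝔤 : Type} [LieRing 𝔤]
    [LieAlgebra ℂ 𝔤] (e : 𝔤 →ₗ[ℂ] Pt G.n) [LieRingModule 𝔤 (Pt m)] : Prop :=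
  ∀ R : Fin (m * m) → MvPolynomial (Fin G.n) ℂ,
    (∀ x ∈ G.carrier, ∀ idx, r.ρ x idx = eval x (R idx)) →
    ∀ (u : 𝔤) (w : Pt m) (i : Fin m),
      ⁅u, w⁆ i = ∑ k : Fin m,
        (∑ j, e u j * eval G.one (pderiv j (R (finProdFinEquiv (i, k))))) * w k

/-- The `𝔤`-module structure on `M` (identified via `eA` with the Lie algebra
of `A`) is the derived action of the algebraic action `ρ` of `G` on `A`: the
bracket is the mixed second-order term of `ρ.act` at `(1, 1)`. -/
def IsDerivedActionOnLie {G A : AffAlgGroup} (ρ : AlgAction G A) {𝔤 M : Type}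
    [LieRing 𝔤] [LieAlgebra ℂ 𝔤] [AddCommGroup M] [Module ℂ M] [LieRingModule 𝔤 M]
    (e : 𝔤 →ₗ[ℂ] Pt G.n) (eA : M →ₗ[ℂ] Pt A.n) : Prop :=
  ∀ S : Fin A.n → MvPolynomial (Fin (G.n + A.n)) ℂ,
    (∀ g ∈ G.carrier, ∀ a ∈ A.carrier, ∀ i, ρ.act g a i = eval (Fin.append g a) (S i)) →
    ∀ (u : 𝔤) (w : M) (i : Fin A.n),
      eA ⁅u, w⁆ i = ∑ j, ∑ k, e u j * eA w k *
        eval (Fin.append G.one A.one)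
          (pderiv (Fin.castAdd A.n j) (pderiv (Fin.natAdd G.n k) (S i)))

/-! ### Algebraic group cohomology with coefficients in an algebraic module -/

section AlgCoh

variable {G : AffAlgGroup} {m : ℕ}

/-- `c : G^p → ℂ^m` is an algebraic cochain: on the carrier it is given by
polynomials. -/
def IsAlgCochain (G : AffAlgGroup) (m p : ℕ) (c : (Fin p → Pt G.n) → Pt m) : Prop :=
  ∃ P : Fin m → MvPolynomial (Fin p × Fin G.n) ℂ,
    ∀ g : Fin p → Pt G.n, (∀ a, g a ∈ G.carrier) →
      ∀ i, c g i = eval (fun s : Fin p × Fin G.n => g s.1 s.2) (P i)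

lemma isAlgCochain_zero (G : AffAlgGroup) (m p : ℕ) :
    IsAlgCochain G m p 0 :=
  ⟨fun _ => 0, fun g _ i => by simp⟩

lemma isAlgCochain_add {G : AffAlgGroup} {m p : ℕ} {c c' : (Fin p → Pt G.n) → Pt m}
    (h : IsAlgCochain G m p c) (h' : IsAlgCochain G m p c') :
    IsAlgCochain G m p (c + c') := by
  obtain ⟨P, hP⟩ := h
  obtain ⟨Q, hQ⟩ := h'
  exact ⟨fun i => P i + Q i, fun g hg i => by
    simp [hP g hg i, hQ g hg i]⟩

lemma isAlgCochain_neg {G : AffAlgGroup} {m p : ℕ} {c : (Fin p → Pt G.n) → Pt m}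
    (h : IsAlgCochain G m p c) : IsAlgCochain G m p (-c) := by
  obtain ⟨P, hP⟩ := h
  exact ⟨fun i => -(P i), fun g hg i => by simp [hP g hg i]⟩

/-- the `a`-th "multiply adjacent entries" tuple occurring in the group
cohomology differential -/
def mulInsert (G : AffAlgGroup) {p : ℕ} (g : Fin (p + 1) → Pt G.n) (a : Fin p) :
    Fin p → Pt G.n := fun k =>
  if (k : ℕ) < (a : ℕ) then g k.castSucc
  else if (k : ℕ) = (a : ℕ) then G.mul (g k.castSucc) (g k.succ)
  else g k.succ

lemma mulInsert_mem {p : ℕ} {g : Fin (p + 1) → Pt G.n} (hg : ∀ a, g a ∈ G.carrier)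
    (a : Fin p) : ∀ k, mulInsert G g a k ∈ G.carrier := by
  intro k
  unfold mulInsert
  split
  · exact hg _
  · split
    · exact G.mul_mem (hg _) (hg _)
    · exact hg _

/-- The inhomogeneous group cohomology differential
`(δf)(g₀,…,g_p) = g₀·f(g₁,…,g_p) + (−1)^{p+1} f(g₀,…,g_{p−1})
  + Σ_{a} (−1)^{a+1} f(g₀,…,g_a g_{a+1},…,g_p)`
for algebraic cochains with coefficients in the representation `r`. -/
def algD (r : AlgRep G m) (p : ℕ) (c : (Fin p → Pt G.n) → Pt m) :
    (Fin (p + 1) → Pt G.n) → Pt m := fun g =>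
  matVec m (r.ρ (g 0)) (c (fun a => g a.succ))
  + ((-1 : ℤ) ^ (p + 1)) • c (fun a => g a.castSucc)
  + ∑ a : Fin p, ((-1 : ℤ) ^ ((a : ℕ) + 1)) • c (mulInsert G g a)

lemma matVec_add {k : ℕ} (a : Pt (k * k)) (w w' : Pt k) :
    matVec k a (w + w') = matVec k a w + matVec k a w' := by
  funext i
  simp [matVec, mul_add, Finset.sum_add_distrib]

lemma matVec_zero {k : ℕ} (a : Pt (k * k)) : matVec k a 0 = 0 := by
  funext i
  simp [matVec]

lemma algD_zero (r : AlgRep G m) (p : ℕ) : algD r p 0 = 0 := by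
  funext g
  simp [algD, matVec_zero]

lemma algD_add (r : AlgRep G m) (p : ℕ) (c c' : (Fin p → Pt G.n) → Pt m) :
    algD r p (c + c') = algD r p c + algD r p c' := by
  funext g
  simp only [algD, Pi.add_apply, matVec_add, smul_add, Finset.sum_add_distrib]
  abel

lemma algD_neg (r : AlgRep G m) (p : ℕ) (c : (Fin p → Pt G.n) → Pt m) :
    algD r p (-c) = -(algD r p c) := by
  have h := algD_add r p c (-c)
  simp only [add_neg_cancel, algD_zero] at h
  rw [eq_comm, neg_eq_iff_add_eq_zero, eq_comm, ← h]
  try rfl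

/-- The group of algebraic `p`-cocycles of `G` with coefficients in `r`. -/
def algZ (r : AlgRep G m) (p : ℕ) : AddSubgroup ((Fin p → Pt G.n) → Pt m) where
  carrier := {c | IsAlgCochain G m p c ∧
    ∀ g : Fin (p + 1) → Pt G.n, (∀ a, g a ∈ G.carrier) → algD r p c g = 0}
  zero_mem' := ⟨isAlgCochain_zero G m p, fun g _ => by rw [algD_zero]; rfl⟩
  add_mem' := by
    rintro c c' ⟨hc, hcz⟩ ⟨hc', hcz'⟩
    refine ⟨isAlgCochain_add hc hc', fun g hg => ?_⟩
    rw [algD_add]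
    simp [hcz g hg, hcz' g hg]
  neg_mem' := by
    rintro c ⟨hc, hcz⟩
    refine ⟨isAlgCochain_neg hc, fun g hg => ?_⟩
    rw [algD_neg]
    simp [hcz g hg]

/-- The group of algebraic `(p+1)`-coboundaries of `G` with coefficients in
`r`. -/
def algB (r : AlgRep G m) (p : ℕ) : AddSubgroup ((Fin (p + 1) → Pt G.n) → Pt m) where
  carrier := {c | ∃ f : (Fin p → Pt G.n) → Pt m, IsAlgCochain G m p f ∧
    ∀ g : Fin (p + 1) → Pt G.n, (∀ a, g a ∈ G.carrier) → c g = algD r p f g}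
  zero_mem' := ⟨0, isAlgCochain_zero G m p, fun g _ => by rw [algD_zero]⟩
  add_mem' := by
    rintro c c' ⟨f, hf, hcf⟩ ⟨f', hf', hcf'⟩
    refine ⟨f + f', isAlgCochain_add hf hf', fun g hg => ?_⟩
    rw [algD_add]
    simp [hcf g hg, hcf' g hg]
  neg_mem' := by
    rintro c ⟨f, hf, hcf⟩
    refine ⟨-f, isAlgCochain_neg hf, fun g hg => ?_⟩
    rw [algD_neg]
    simp [hcf g hg]

/-- The algebraic group cohomology `H^p_alg(G, 𝔞)` of `G` with coefficients in
the finite-dimensional algebraic `G`-module given by `r`. -/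
def algH (r : AlgRep G m) : ℕ → Type
  | 0 => ↥(algZ r 0)
  | (p + 1) => ↥(algZ r (p + 1)) ⧸ ((algB r p).addSubgroupOf (algZ r (p + 1)))

instance algH.instAddCommGroup (r : AlgRep G m) (p : ℕ) : AddCommGroup (algH r p) :=
  match p with
  | 0 => inferInstanceAs (AddCommGroup ↥(algZ r 0))
  | (p + 1) => inferInstanceAs
      (AddCommGroup (↥(algZ r (p + 1)) ⧸ ((algB r p).addSubgroupOf (algZ r (p + 1)))))

end AlgCoh

/-! ### Affine `G`-varieties and algebraic differential forms -/

/-- An affine variety with an algebraic action of `G`. -/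
structure AlgGVariety (G : AffAlgGroup) : Type where
  N : ℕ
  carrier : Set (Pt N)
  isAlgebraic : IsAlgebraicSet carrier
  act : Pt G.n → Pt N → Pt N
  maps_to : ∀ {g : Pt G.n} {x : Pt N}, g ∈ G.carrier → x ∈ carrier → act g x ∈ carrier
  act_one : ∀ {x : Pt N}, x ∈ carrier → act G.one x = x
  act_mul : ∀ {g h : Pt G.n} {x : Pt N}, g ∈ G.carrier → h ∈ G.carrier → x ∈ carrier →
    act (G.mul g h) x = act g (act h x)
  regular : IsRegularOn
    {z : Pt (G.n + N) | Pt.left z ∈ G.carrier ∧ Pt.right z ∈ carrier}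
    (fun z => act (Pt.left z) (Pt.right z))

/-- `X` is the homogeneous space `G/H`, with base point `x₀` whose stabilizer
is `H`. -/
def AlgGVariety.IsQuotientBy {G : AffAlgGroup} (X : AlgGVariety G) (H : AlgSubgroup G)
    (x₀ : Pt X.N) : Prop :=
  x₀ ∈ X.carrier ∧ (∀ x ∈ X.carrier, ∃ g ∈ G.carrier, X.act g x₀ = x) ∧
  (∀ g ∈ G.carrier, (X.act g x₀ = x₀ ↔ g ∈ H.carrier))

section Forms

variable {G : AffAlgGroup}

/-- The functions underlying (ambient representatives of) `𝔞`-valued `p`-forms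
on `X`; only values at points of `X` on tangent vectors of `X` are relevant. -/
abbrev FormFun (X : AlgGVariety G) (p m : ℕ) : Type :=
  Pt X.N → (Fin p → Pt X.N) → Pt m

/-- `P` is a family of polynomials (with linear dependence on the tangent
blocks) representing the form `ω` on `X`. -/
def IsFormRep (X : AlgGVariety G) {p m : ℕ} (ω : FormFun X p m)
    (P : Fin m → MvPolynomial (Fin X.N ⊕ (Fin p × Fin X.N)) ℂ) : Prop :=
  ∀ x ∈ X.carrier, ∀ v : Fin p → Pt X.N, (∀ k, v k ∈ tangentAt X.carrier x) →
    ∀ i, ω x v i = eval (Sum.elim x fun s : Fin p × Fin X.N => v s.1 s.2) (P i)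

/-- `ω` is an algebraic `𝔞`-valued `p`-form on `X`: it has a polynomial
representative and is alternating multilinear on tangent vectors. -/
def IsAlgForm (X : AlgGVariety G) (p m : ℕ) (ω : FormFun X p m) : Prop :=
  (∃ P, IsFormRep X ω P) ∧
  ∀ x ∈ X.carrier,
    (∀ (v : Fin p → Pt X.N) (k : Fin p) (a b : Pt X.N),
      (∀ l, v l ∈ tangentAt X.carrier x) → a ∈ tangentAt X.carrier x →
      b ∈ tangentAt X.carrier x →
      ω x (Function.update v k (a + b)) =
        ω x (Function.update v k a) + ω x (Function.update v k b)) ∧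
    (∀ (v : Fin p → Pt X.N) (k : Fin p) (t : ℂ) (a : Pt X.N),
      (∀ l, v l ∈ tangentAt X.carrier x) → a ∈ tangentAt X.carrier x →
      ω x (Function.update v k (t • a)) = t • ω x (Function.update v k a)) ∧
    (∀ (v : Fin p → Pt X.N) (k l : Fin p),
      (∀ l', v l' ∈ tangentAt X.carrier x) → k ≠ l → v k = v l → ω x v = 0)

/-- `ω'` is the translate `g · ω` of the form `ω`, with coefficients twisted by
the representation `r`:  `(g·ω)(x)(v) = ρ(g) · ω(g⁻¹·x)(d(g⁻¹)ₓ v)`. -/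
def IsFormTranslate (X : AlgGVariety G) {p m : ℕ} (r : AlgRep G m) (g : Pt G.n)
    (ω ω' : FormFun X p m) : Prop :=
  ∀ x ∈ X.carrier, ∀ v : Fin p → Pt X.N, (∀ k, v k ∈ tangentAt X.carrier x) →
    ∀ Q : Fin X.N → MvPolynomial (Fin X.N) ℂ,
      (∀ y ∈ X.carrier, ∀ i, X.act (G.inv g) y i = eval y (Q i)) →
      ω' x v = matVec m (r.ρ g)
        (ω (X.act (G.inv g) x) (fun k i => ∑ j, v k j * eval x (pderiv j (Q i))))

/-- `ω` is a `G`-invariant form. -/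
def IsInvariantForm (X : AlgGVariety G) {p m : ℕ} (r : AlgRep G m)
    (ω : FormFun X p m) : Prop :=
  ∀ g ∈ G.carrier, IsFormTranslate X r g ω ω

/-- The formal exterior derivative of the polynomial family `P`, evaluated at
`x` on the tangent vectors `v`. -/
def extDerivFormula (X : AlgGVariety G) {p m : ℕ}
    (P : Fin m → MvPolynomial (Fin X.N ⊕ (Fin p × Fin X.N)) ℂ)
    (x : Pt X.N) (v : Fin (p + 1) → Pt X.N) : Pt m := fun i =>
  ∑ k : Fin (p + 1), ((-1 : ℤ) ^ (k : ℕ) : ℂ) *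
    ∑ j : Fin X.N, v k j *
      eval (Sum.elim x fun s : Fin p × Fin X.N => v (k.succAbove s.1) s.2)
        (pderiv (Sum.inl j) (P i))

variable {m : ℕ}

lemma matVec_zero' (k : ℕ) (a : Pt (k * k)) : matVec k a 0 = 0 := by
  funext i; simp [matVec]

lemma matVec_add' (k : ℕ) (a : Pt (k * k)) (w w' : Pt k) :
    matVec k a (w + w') = matVec k a w + matVec k a w' := by
  funext i; simp [matVec, mul_add, Finset.sum_add_distrib]

lemma matVec_neg' (k : ℕ) (a : Pt (k * k)) (w : Pt k) :
    matVec k a (-w) = -(matVec k a w) := by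
  funext i; simp [matVec, mul_neg, Finset.sum_neg_distrib]

lemma extDerivFormula_zero (X : AlgGVariety G) (p : ℕ)
    (x : Pt X.N) (v : Fin (p + 1) → Pt X.N) :
    extDerivFormula X (0 : Fin m → MvPolynomial (Fin X.N ⊕ (Fin p × Fin X.N)) ℂ) x v
      = 0 := by
  funext i; simp [extDerivFormula]

lemma extDerivFormula_add (X : AlgGVariety G) {p : ℕ}
    (P Q : Fin m → MvPolynomial (Fin X.N ⊕ (Fin p × Fin X.N)) ℂ)
    (x : Pt X.N) (v : Fin (p + 1) → Pt X.N) :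
    extDerivFormula X (fun i => P i + Q i) x v
      = extDerivFormula X P x v + extDerivFormula X Q x v := by
  funext i
  simp only [extDerivFormula, Pi.add_apply, map_add, mul_add, Finset.sum_add_distrib]

lemma extDerivFormula_neg (X : AlgGVariety G) {p : ℕ}
    (P : Fin m → MvPolynomial (Fin X.N ⊕ (Fin p × Fin X.N)) ℂ)
    (x : Pt X.N) (v : Fin (p + 1) → Pt X.N) :
    extDerivFormula X (fun i => -(P i)) x v = -(extDerivFormula X P x v) := by
  funext i
  simp only [extDerivFormula, Pi.neg_apply, map_neg, mul_neg, neg_neg,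
    Finset.sum_neg_distrib]

lemma isFormRep_zero (X : AlgGVariety G) (p : ℕ) :
    IsFormRep X (0 : FormFun X p m) 0 := by
  intro x _ v _ i; simp

lemma isFormRep_add (X : AlgGVariety G) {p : ℕ} {ω ω' : FormFun X p m} {P Q}
    (h : IsFormRep X ω P) (h' : IsFormRep X ω' Q) :
    IsFormRep X (ω + ω') (fun i => P i + Q i) := by
  intro x hx v hv i
  simp [h x hx v hv i, h' x hx v hv i]

lemma isFormRep_neg (X : AlgGVariety G) {p : ℕ} {ω : FormFun X p m} {P}
    (h : IsFormRep X ω P) : IsFormRep X (-ω) (fun i => -(P i)) := by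
  intro x hx v hv i
  simp [h x hx v hv i]

lemma isAlgForm_zero (X : AlgGVariety G) (p : ℕ) :
    IsAlgForm X p m 0 := by
  refine ⟨⟨0, isFormRep_zero X p⟩, fun x _ => ⟨?_, ?_, ?_⟩⟩ <;> intros <;> simp

lemma isAlgForm_add (X : AlgGVariety G) {p : ℕ} {ω ω' : FormFun X p m}
    (h : IsAlgForm X p m ω) (h' : IsAlgForm X p m ω') :
    IsAlgForm X p m (ω + ω') := by
  obtain ⟨⟨P, hP⟩, hml⟩ := h
  obtain ⟨⟨Q, hQ⟩, hml'⟩ := h'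
  refine ⟨⟨fun i => P i + Q i, isFormRep_add X hP hQ⟩, fun x hx => ⟨?_, ?_, ?_⟩⟩
  · intro v k a b hv ha hb
    simp only [Pi.add_apply, (hml x hx).1 v k a b hv ha hb,
      (hml' x hx).1 v k a b hv ha hb]
    abel
  · intro v k t a hv ha
    simp only [Pi.add_apply, (hml x hx).2.1 v k t a hv ha,
      (hml' x hx).2.1 v k t a hv ha, smul_add]
  · intro v k l hv hkl hvv
    simp only [Pi.add_apply, (hml x hx).2.2 v k l hv hkl hvv,
      (hml' x hx).2.2 v k l hv hkl hvv, add_zero]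

lemma isAlgForm_neg (X : AlgGVariety G) {p : ℕ} {ω : FormFun X p m}
    (h : IsAlgForm X p m ω) : IsAlgForm X p m (-ω) := by
  obtain ⟨⟨P, hP⟩, hml⟩ := h
  refine ⟨⟨fun i => -(P i), isFormRep_neg X hP⟩, fun x hx => ⟨?_, ?_, ?_⟩⟩
  · intro v k a b hv ha hb
    simp only [Pi.neg_apply, (hml x hx).1 v k a b hv ha hb]
    abel
  · intro v k t a hv ha
    simp only [Pi.neg_apply, (hml x hx).2.1 v k t a hv ha, smul_neg]
  · intro v k l hv hkl hvv
    simp only [Pi.neg_apply, (hml x hx).2.2 v k l hv hkl hvv, neg_zero]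

lemma isInvariantForm_zero (X : AlgGVariety G) (p : ℕ) (r : AlgRep G m) :
    IsInvariantForm X r (0 : FormFun X p m) := by
  intro g _ x _ v _ Q _
  simp [matVec_zero']

lemma isInvariantForm_add (X : AlgGVariety G) {p : ℕ} {r : AlgRep G m}
    {ω ω' : FormFun X p m} (h : IsInvariantForm X r ω)
    (h' : IsInvariantForm X r ω') : IsInvariantForm X r (ω + ω') := by
  intro g hg x hx v hv Q hQ
  simp only [Pi.add_apply, h g hg x hx v hv Q hQ, h' g hg x hx v hv Q hQ,
    matVec_add']

lemma isInvariantForm_neg (X : AlgGVariety G) {p : ℕ} {r : AlgRep G m}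
    {ω : FormFun X p m} (h : IsInvariantForm X r ω) : IsInvariantForm X r (-ω) := by
  intro g hg x hx v hv Q hQ
  simp only [Pi.neg_apply, h g hg x hx v hv Q hQ, matVec_neg']

/-- The group of closed `G`-invariant algebraic `p`-forms on `X` with values
in the `G`-module `ℂ^m`. -/
def invFormZ (X : AlgGVariety G) (r : AlgRep G m) (p : ℕ) :
    AddSubgroup (FormFun X p m) where
  carrier := {ω | IsAlgForm X p m ω ∧ IsInvariantForm X r ω ∧
    ∃ P, IsFormRep X ω P ∧ ∀ x ∈ X.carrier, ∀ v : Fin (p + 1) → Pt X.N,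
      (∀ k, v k ∈ tangentAt X.carrier x) → extDerivFormula X P x v = 0}
  zero_mem' := ⟨isAlgForm_zero X p, isInvariantForm_zero X p r,
    ⟨0, isFormRep_zero X p, fun x _ v _ => extDerivFormula_zero X p x v⟩⟩
  add_mem' := by
    rintro ω ω' ⟨hf, hi, P, hP, hPd⟩ ⟨hf', hi', Q, hQ, hQd⟩
    refine ⟨isAlgForm_add X hf hf', isInvariantForm_add X hi hi',
      ⟨fun i => P i + Q i, isFormRep_add X hP hQ, fun x hx v hv => ?_⟩⟩
    rw [extDerivFormula_add, hPd x hx v hv, hQd x hx v hv, add_zero]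
  neg_mem' := by
    rintro ω ⟨hf, hi, P, hP, hPd⟩
    refine ⟨isAlgForm_neg X hf, isInvariantForm_neg X hi,
      ⟨fun i => -(P i), isFormRep_neg X hP, fun x hx v hv => ?_⟩⟩
    rw [extDerivFormula_neg, hPd x hx v hv, neg_zero]

/-- The group of exact `G`-invariant algebraic `(p+1)`-forms on `X` (relative
to the subcomplex of invariant forms). -/
def invFormB (X : AlgGVariety G) (r : AlgRep G m) (p : ℕ) :
    AddSubgroup (FormFun X (p + 1) m) where
  carrier := {η | ∃ ω P, IsAlgForm X p m ω ∧ IsInvariantForm X r ω ∧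
    IsFormRep X ω P ∧ ∀ x ∈ X.carrier, ∀ v : Fin (p + 1) → Pt X.N,
      (∀ k, v k ∈ tangentAt X.carrier x) → η x v = extDerivFormula X P x v}
  zero_mem' := ⟨0, 0, isAlgForm_zero X p, isInvariantForm_zero X p r,
    isFormRep_zero X p, fun x _ v _ => by
      rw [extDerivFormula_zero]; rfl⟩
  add_mem' := by
    rintro η η' ⟨ω, P, hf, hi, hP, hPd⟩ ⟨ω', Q, hf', hi', hQ, hQd⟩
    refine ⟨ω + ω', fun i => P i + Q i, isAlgForm_add X hf hf',
      isInvariantForm_add X hi hi', isFormRep_add X hP hQ, fun x hx v hv => ?_⟩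
    rw [extDerivFormula_add, ← hPd x hx v hv, ← hQd x hx v hv]
    rfl
  neg_mem' := by
    rintro η ⟨ω, P, hf, hi, hP, hPd⟩
    refine ⟨-ω, fun i => -(P i), isAlgForm_neg X hf, isInvariantForm_neg X hi,
      isFormRep_neg X hP, fun x hx v hv => ?_⟩
    rw [extDerivFormula_neg, ← hPd x hx v hv]
    rfl

/-- The cohomology `H^p(Ω(X, 𝔞)^G)` of the complex of `G`-invariant algebraic
`𝔞`-valued forms on `X`. -/
def invFormH (X : AlgGVariety G) (r : AlgRep G m) : ℕ → Type
  | 0 => ↥(invFormZ X r 0)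
  | (p + 1) => ↥(invFormZ X r (p + 1)) ⧸
      ((invFormB X r p).addSubgroupOf (invFormZ X r (p + 1)))

instance invFormH.instAddCommGroup (X : AlgGVariety G) (r : AlgRep G m) (p : ℕ) :
    AddCommGroup (invFormH X r p) :=
  match p with
  | 0 => inferInstanceAs (AddCommGroup ↥(invFormZ X r 0))
  | (p + 1) => inferInstanceAs (AddCommGroup (↥(invFormZ X r (p + 1)) ⧸
      ((invFormB X r p).addSubgroupOf (invFormZ X r (p + 1)))))

/-- `dπ` is the differential at the identity of the orbit map `g ↦ g · x₀`,
under the identification `e𝔤` of `𝔤` with the Lie algebra of `G`. -/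
def IsOrbitDeriv (X : AlgGVariety G) (x₀ : Pt X.N) {𝔤 : Type} [LieRing 𝔤]
    [LieAlgebra ℂ 𝔤] (e𝔤 : 𝔤 →ₗ[ℂ] Pt G.n) (dπ : 𝔤 →ₗ[ℂ] Pt X.N) : Prop :=
  ∀ Q : Fin X.N → MvPolynomial (Fin G.n) ℂ,
    (∀ g ∈ G.carrier, ∀ i, X.act g x₀ i = eval g (Q i)) →
    ∀ (u : 𝔤) (i : Fin X.N), dπ u i = ∑ j, e𝔤 u j * eval G.one (pderiv j (Q i))

end Forms

/-- `f : G^q → Ω^p(X, 𝔞)` is a locally finite algebraic cochain: its values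
are algebraic forms, lying in the span of finitely many forms spanning a
`G`-stable subspace, with regular (polynomial) coefficient functions. -/
def IsLocFinAlgFormCochain {G : AffAlgGroup} (X : AlgGVariety G) {m : ℕ}
    (r : AlgRep G m) (p q : ℕ) (f : (Fin q → Pt G.n) → FormFun X p m) : Prop :=
  (∀ g : Fin q → Pt G.n, (∀ a, g a ∈ G.carrier) → IsAlgForm X p m (f g)) ∧
  ∃ (d : ℕ) (bas : Fin d → FormFun X p m) (coef : Fin d → (Fin q → Pt G.n) → ℂ),
    (∀ j, IsAlgForm X p m (bas j)) ∧
    -- the span of the basic forms is a `G`-stable subspace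
    (∀ g ∈ G.carrier, ∀ j, ∃ a : Fin d → ℂ,
      ∀ T, IsFormTranslate X r g (bas j) T →
        ∀ x ∈ X.carrier, ∀ v : Fin p → Pt X.N, (∀ k, v k ∈ tangentAt X.carrier x) →
          T x v = ∑ l, a l • bas l x v) ∧
    -- the coefficient functions are regular
    (∀ j, ∃ R : MvPolynomial (Fin q × Fin G.n) ℂ, ∀ g : Fin q → Pt G.n,
      (∀ a, g a ∈ G.carrier) →
        coef j g = eval (fun s : Fin q × Fin G.n => g s.1 s.2) R) ∧
    -- `f = Σ_j coef_j · bas_j`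
    (∀ g : Fin q → Pt G.n, (∀ a, g a ∈ G.carrier) → ∀ x ∈ X.carrier,
      ∀ v : Fin p → Pt X.N, (∀ k, v k ∈ tangentAt X.carrier x) →
        f g x v = ∑ j, coef j g • bas j x v)

section

open Module

attribute [local instance] LieRing.ofAssociativeRing

/-- On a finite-dimensional complex vector space, a linear map `X` is nilpotent as soon as
`trace (X * Y) = 0` for all its rational replicas `Y`. -/
theorem isNilpotent_of_trace_mul_replica {E : Type*} [AddCommGroup E] [Module ℂ E]
    [FiniteDimensional ℂ E] (X : End ℂ E)
    (h : ∀ f : ℂ →ₗ[ℚ] ℚ, ∃ Y : End ℂ E,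
      (∀ μ, ∀ e ∈ X.maxGenEigenspace μ, Y e = (f μ : ℂ) • e) ∧
        LinearMap.trace ℂ E (X * Y) = 0) : IsNilpotent X := by
  classical
  have hind := X.independent_maxGenEigenspace
  have hinternal : DirectSum.IsInternal X.maxGenEigenspace :=
    (DirectSum.isInternal_submodule_iff_iSupIndep_and_iSup_eq_top _).2
      ⟨hind, X.iSup_maxGenEigenspace_eq_top⟩
  have hfin : {i | X.maxGenEigenspace i ≠ ⊥}.Finite :=
    WellFoundedGT.finite_ne_bot_of_iSupIndep hind
  have hX : ∀ μ, Set.MapsTo X (X.maxGenEigenspace μ) (X.maxGenEigenspace μ) :=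
    fun μ => End.mapsTo_maxGenEigenspace_of_comm (Commute.refl X) μ
  have htr : ∀ μ, LinearMap.trace ℂ _ (X.restrict (hX μ)) =
      μ * (finrank ℂ (X.maxGenEigenspace μ) : ℂ) := by
    intro μ
    have hn := End.isNilpotent_restrict_maxGenEigenspace_sub_algebraMap X μ
    have := (LinearMap.isNilpotent_trace_of_isNilpotent hn).eq_zero
    have e : (X - algebraMap ℂ (End ℂ E) μ).restrict
        (End.mapsTo_maxGenEigenspace_of_comm (Algebra.mul_sub_algebraMap_commutes X μ) μ) =
        X.restrict (hX μ) - μ • LinearMap.id := by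
      refine LinearMap.ext fun v => Subtype.ext ?_
      change (X - algebraMap ℂ (End ℂ E) μ) v = X v - μ • (v : E)
      simp
    rw [e, map_sub, map_smul, LinearMap.trace_id, sub_eq_zero, smul_eq_mul] at this
    exact this
  have hzero : ∀ μ, X.maxGenEigenspace μ ≠ ⊥ → μ = 0 := by
    intro μ hμ
    by_contra hne
    obtain ⟨f, hf⟩ : ∃ f : ℂ →ₗ[ℚ] ℚ, f μ ≠ 0 := by
      by_contra! hc
      exact hne ((Module.forall_dual_apply_eq_zero_iff ℚ μ).1 hc)
    obtain ⟨Y, hY, hXY⟩ := h f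
    have hmaps : ∀ μ, Set.MapsTo (X * Y : End ℂ E) (X.maxGenEigenspace μ)
        (X.maxGenEigenspace μ) := fun μ e he => by
      rw [End.mul_apply, hY μ e he, map_smul]
      exact Submodule.smul_mem _ _ (hX μ he)
    rw [LinearMap.trace_eq_sum_trace_restrict' hinternal hfin hmaps] at hXY
    have hterm : ∀ μ, LinearMap.trace ℂ _ ((X * Y : End ℂ E).restrict (hmaps μ)) =
        ((f μ * finrank ℂ (X.maxGenEigenspace μ) : ℚ) : ℂ) * μ := by
      intro μ
      have : (X * Y : End ℂ E).restrict (hmaps μ) = (f μ : ℂ) • X.restrict (hX μ) := by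
        refine LinearMap.ext fun v => Subtype.ext ?_
        change X (Y v) = (f μ : ℂ) • X v
        rw [hY μ v v.2, map_smul]
      rw [this, map_smul, htr, smul_eq_mul]
      push_cast
      ring
    simp_rw [hterm] at hXY
    have h2 := congrArg f hXY
    rw [map_sum, map_zero] at h2
    have hsm : ∀ (q : ℚ) (z : ℂ), f ((q : ℂ) * z) = q * f z := fun q z => by
      have := f.map_smul q z
      rwa [Rat.smul_def, smul_eq_mul] at this
    simp_rw [hsm] at h2
    rw [Finset.sum_eq_zero_iff_of_nonneg] at h2
    · have h3 := h2 μ (by simpa using hμ)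
      have : (finrank ℂ (X.maxGenEigenspace μ) : ℚ) ≠ 0 := by
        have := Submodule.one_le_finrank_iff.2 hμ
        positivity
      simp [hf, this] at h3
    · intro i _
      rw [mul_right_comm]
      exact mul_nonneg (mul_self_nonneg _) (Nat.cast_nonneg _)
  have htop : X.maxGenEigenspace 0 = ⊤ := by
    rw [eq_top_iff, ← X.iSup_maxGenEigenspace_eq_top]
    refine iSup_le fun μ => ?_
    by_cases hμ : X.maxGenEigenspace μ = ⊥
    · simp [hμ]
    · rw [hzero μ hμ]
  rw [End.maxGenEigenspace_eq_genEigenspace_finrank] at htop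
  refine ⟨finrank ℂ E, LinearMap.ext fun v => ?_⟩
  have := htop ▸ (Submodule.mem_top : v ∈ (⊤ : Submodule ℂ E))
  simpa [End.mem_genEigenspace_nat] using this

/-- Engel's theorem relative to an invariant subspace. -/
theorem exists_notMem_forall_apply_mem_of_isNilpotent {𝔤 E : Type*} [LieRing 𝔤] [LieAlgebra ℂ 𝔤]
    [AddCommGroup E] [Module ℂ E] [FiniteDimensional ℂ E]
    (φ : 𝔤 →ₗ⁅ℂ⁆ End ℂ E) (hφ : ∀ x, IsNilpotent (φ x)) (N : Submodule ℂ E) (hN : N ≠ ⊤) :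
    ∃ v ∉ N, ∀ x, φ x v ∈ N := by
  let _ : LieRingModule 𝔤 E := LieRingModule.compLieHom E φ
  have _ : LieModule ℂ 𝔤 E := LieModule.compLieHom E φ
  have hnil : LieModule.IsNilpotent 𝔤 E := (LieModule.isNilpotent_iff_forall' (R := ℂ)).2 hφ
  obtain ⟨k, hk⟩ := (LieModule.isNilpotent_iff ℂ 𝔤 E).1 hnil
  have hex : ∃ k, (LieModule.lowerCentralSeries ℂ 𝔤 E k).toSubmodule ≤ N :=
    ⟨k, by rw [hk]; exact bot_le⟩
  classical
  have h0 : Nat.find hex ≠ 0 := by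
    intro h
    have := Nat.find_spec hex
    rw [h] at this
    exact hN (top_le_iff.1 this)
  obtain ⟨j, hj⟩ := Nat.exists_eq_succ_of_ne_zero h0
  have hlt := Nat.find_min hex (m := j) (by omega)
  obtain ⟨v, hv, hvN⟩ := SetLike.not_le_iff_exists.1 hlt
  refine ⟨v, hvN, fun x => Nat.find_spec hex ?_⟩
  rw [hj]
  simp only [Nat.succ_eq_add_one, LieModule.lowerCentralSeries_succ]
  exact LieSubmodule.lie_mem_lie (LieSubmodule.mem_top x) hv

/-- `Y` is the replica of `X` along `f`: it acts on the generalised eigenspace of `X` with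
eigenvalue `μ` as the scalar `f μ`. -/
def IsReplica {E : Type*} [AddCommGroup E] [Module ℂ E] (f : ℂ →ₗ[ℚ] ℚ) (X Y : End ℂ E) : Prop :=
  ∀ μ, ∀ e ∈ X.maxGenEigenspace μ, Y e = (f μ : ℂ) • e

theorem IsReplica.eq_zero {E : Type*} [AddCommGroup E] [Module ℂ E] {f : ℂ →ₗ[ℚ] ℚ}
    {X Y : End ℂ E} (h : IsReplica f X Y) (hX : IsNilpotent X) : Y = 0 := by
  obtain ⟨k, hk⟩ := hX
  refine LinearMap.ext fun e => ?_
  have := h 0 e ((End.mem_maxGenEigenspace X 0 e).2 ⟨k, by simp [hk]⟩)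
  simpa using this

section TraceForm

variable {𝔤 V : Type*} [LieRing 𝔤] [LieAlgebra ℂ 𝔤] [AddCommGroup V] [Module ℂ V]

/-- The trace form of a representation. -/
noncomputable def repTraceForm (φ : 𝔤 →ₗ⁅ℂ⁆ End ℂ V) : LinearMap.BilinForm ℂ 𝔤 :=
  ((LinearMap.mul ℂ (End ℂ V)).compr₂ (LinearMap.trace ℂ V)).compl₁₂
    (φ : 𝔤 →ₗ[ℂ] End ℂ V) (φ : 𝔤 →ₗ[ℂ] End ℂ V)

theorem repTraceForm_apply (φ : 𝔤 →ₗ⁅ℂ⁆ End ℂ V) (x y : 𝔤) :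
    repTraceForm φ x y = LinearMap.trace ℂ V (φ x * φ y) := rfl

theorem repTraceForm_comm (φ : 𝔤 →ₗ⁅ℂ⁆ End ℂ V) (x y : 𝔤) :
    repTraceForm φ x y = repTraceForm φ y x := by
  rw [repTraceForm_apply, repTraceForm_apply, LinearMap.trace_mul_comm]

theorem repTraceForm_lie (φ : 𝔤 →ₗ⁅ℂ⁆ End ℂ V) (x y z : 𝔤) :
    repTraceForm φ ⁅x, y⁆ z = repTraceForm φ x ⁅y, z⁆ := by
  simp only [repTraceForm_apply, LieHom.map_lie, Ring.lie_def, sub_mul, mul_sub, map_sub,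
    mul_assoc]
  rw [LinearMap.trace_mul_comm ℂ (φ y) (φ x * φ z), mul_assoc]

theorem repTraceForm_lie_orthogonal (φ : 𝔤 →ₗ⁅ℂ⁆ End ℂ V) {𝔨 : Submodule ℂ 𝔤}
    (h𝔨 : ∀ x : 𝔤, ∀ y ∈ 𝔨, ⁅x, y⁆ ∈ 𝔨) (x y : 𝔤)
    (hy : y ∈ (repTraceForm φ).orthogonal 𝔨) : ⁅x, y⁆ ∈ (repTraceForm φ).orthogonal 𝔨 := by
  rw [LinearMap.BilinForm.mem_orthogonal_iff] at hy ⊢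
  intro k hk
  change repTraceForm φ k ⁅x, y⁆ = 0
  rw [← repTraceForm_lie, ← lie_skew, map_neg, LinearMap.neg_apply,
    neg_eq_zero]
  exact hy _ (h𝔨 x k hk)

/-- The Casimir operator of an ideal on which the trace form is nondegenerate. -/
theorem exists_casimir [FiniteDimensional ℂ 𝔤] (φ : 𝔤 →ₗ⁅ℂ⁆ End ℂ V)
    (𝔭 : Submodule ℂ 𝔤) (h𝔭 : ∀ x : 𝔤, ∀ y ∈ 𝔭, ⁅x, y⁆ ∈ 𝔭)
    (hnd : ∀ x ∈ 𝔭, (∀ y ∈ 𝔭, repTraceForm φ x y = 0) → x = 0) :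
    ∃ C : End ℂ V, (∀ x, C * φ x = φ x * C) ∧ LinearMap.trace ℂ V C = finrank ℂ 𝔭 ∧
      ∀ w, (∀ x, φ x w = 0) → C w = 0 := by
  let B : LinearMap.BilinForm ℂ 𝔭 := (repTraceForm φ).restrict 𝔭
  have hBs : B.IsSymm := ⟨fun x y => repTraceForm_comm φ x y⟩
  have hB : B.Nondegenerate := by
    have : B.IsRefl := hBs.isRefl
    refine this.nondegenerate_iff_separatingLeft.2 fun x hx => Subtype.ext ?_
    exact hnd x x.2 fun y hy => hx ⟨y, hy⟩
  let b := Module.finBasis ℂ 𝔭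
  let b' := B.dualBasis hB b
  let ad : 𝔤 → 𝔭 → 𝔭 := fun x y => ⟨⁅x, (y : 𝔤)⁆, h𝔭 x y y.2⟩
  have hinv : ∀ x y z, B (ad x y) z = - B y (ad x z) := by
    intro x y z
    change repTraceForm φ ⁅x, (y : 𝔤)⁆ z = - repTraceForm φ y ⁅x, (z : 𝔤)⁆
    rw [← repTraceForm_lie, ← lie_skew, map_neg, LinearMap.neg_apply]
  have e1 : ∀ y : 𝔭, y = ∑ j, B y (b' j) • b j := by
    intro y
    have := (b.sum_repr y).symm
    refine this.trans (Finset.sum_congr rfl fun j _ => ?_)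
    congr 1
    conv_rhs => rw [← b.sum_repr y]
    rw [map_sum, LinearMap.sum_apply, Finset.sum_eq_single j]
    · rw [map_smul, LinearMap.smul_apply, LinearMap.BilinForm.apply_dualBasis_right hB hBs,
        if_pos rfl, smul_eq_mul, mul_one]
    · intro i _ hij
      rw [map_smul, LinearMap.smul_apply, LinearMap.BilinForm.apply_dualBasis_right hB hBs,
        if_neg hij, smul_zero]
    · simp
  have e2 : ∀ y : 𝔭, y = ∑ j, B y (b j) • b' j := by
    intro y
    conv_lhs => rw [← b'.sum_repr y]
    simp [b', LinearMap.BilinForm.dualBasis_repr_apply]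
  refine ⟨∑ i, φ (b i) * φ (b' i), fun x => ?_, ?_, fun w hw => ?_⟩
  · have h1 : ∀ i, φ ⁅x, (b i : 𝔤)⁆ = ∑ j, B (ad x (b i)) (b' j) • φ (b j) := by
      intro i
      have := congrArg (fun y : 𝔭 => φ (y : 𝔤)) (e1 (ad x (b i)))
      simp only [AddSubmonoidClass.coe_finsetSum, Submodule.coe_smul, map_sum, map_smul] at this
      exact this
    have h2 : ∀ i, φ ⁅x, (b' i : 𝔤)⁆ = ∑ j, B (ad x (b' i)) (b j) • φ (b' j) := by
      intro i
      have := congrArg (fun y : 𝔭 => φ (y : 𝔤)) (e2 (ad x (b' i)))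
      simp only [AddSubmonoidClass.coe_finsetSum, Submodule.coe_smul, map_sum, map_smul] at this
      exact this
    have key : ∑ i, (φ ⁅x, (b i : 𝔤)⁆ * φ (b' i) + φ (b i) * φ ⁅x, (b' i : 𝔤)⁆) = 0 := by
      simp_rw [h1, h2, Finset.sum_mul, Finset.mul_sum, Finset.sum_add_distrib]
      rw [Finset.sum_comm, ← Finset.sum_add_distrib]
      refine Finset.sum_eq_zero fun i _ => ?_
      rw [← Finset.sum_add_distrib]
      refine Finset.sum_eq_zero fun j _ => ?_
      rw [hinv x (b j), smul_mul_assoc, mul_smul_comm, ← add_smul]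
      rw [hBs.eq (b j) (ad x (b' i))]
      simp
    rw [Finset.sum_mul, Finset.mul_sum, eq_comm, ← sub_eq_zero, ← Finset.sum_sub_distrib, ← key]
    refine Finset.sum_congr rfl fun i _ => ?_
    simp only [LieHom.map_lie, Ring.lie_def]
    noncomm_ring
  · rw [map_sum]
    have : ∀ i, LinearMap.trace ℂ V (φ (b i) * φ (b' i)) = 1 := by
      intro i
      have := LinearMap.BilinForm.apply_dualBasis_right hB hBs b i i
      rw [if_pos rfl] at this
      exact this
    simp [this]
  · simp [hw]

end TraceForm

/-- An ideal closed under replicas splits off, provided the representation on `V` has no nonzero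
ideal acting nilpotently. -/
theorem isCompl_orthogonal_of_replica_closed {𝔤 V : Type*} [LieRing 𝔤] [LieAlgebra ℂ 𝔤]
    [FiniteDimensional ℂ 𝔤] [AddCommGroup V] [Module ℂ V] [FiniteDimensional ℂ V]
    (φ : 𝔤 →ₗ⁅ℂ⁆ End ℂ V)
    (hnil : ∀ 𝔠 : Submodule ℂ 𝔤, (∀ x : 𝔤, ∀ y ∈ 𝔠, ⁅x, y⁆ ∈ 𝔠) → (∀ x ∈ 𝔠, IsNilpotent (φ x)) →
      𝔠 = ⊥)
    (𝔨 : Submodule ℂ 𝔤) (h𝔨 : ∀ x : 𝔤, ∀ y ∈ 𝔨, ⁅x, y⁆ ∈ 𝔨)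
    (hrep : ∀ x ∈ 𝔨, ∀ f, ∃ y ∈ 𝔨, IsReplica f (φ x) (φ y)) :
    IsCompl 𝔨 ((repTraceForm φ).orthogonal 𝔨) := by
  have hbot : 𝔨 ⊓ (repTraceForm φ).orthogonal 𝔨 = ⊥ := by
    refine hnil _ (fun x y hy => ⟨h𝔨 x y hy.1, repTraceForm_lie_orthogonal φ h𝔨 x y hy.2⟩) ?_
    rintro x ⟨hx, hx'⟩
    refine isNilpotent_of_trace_mul_replica _ fun f => ?_
    obtain ⟨y, hy, hxy⟩ := hrep x hx f
    refine ⟨φ y, hxy, ?_⟩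
    rw [← repTraceForm_apply, repTraceForm_comm]
    exact hx' y hy
  have hrefl : (repTraceForm φ).IsRefl := fun x y h => by rw [repTraceForm_comm]; exact h
  refine LinearMap.BilinForm.isCompl_orthogonal_of_restrict_nondegenerate hrefl ?_
  have hr : ((repTraceForm φ).restrict 𝔨).IsRefl := fun x y h => hrefl _ _ h
  refine hr.nondegenerate_iff_separatingLeft.2 fun x hx => Subtype.ext ?_
  have : (x : 𝔤) ∈ 𝔨 ⊓ (repTraceForm φ).orthogonal 𝔨 := by
    refine ⟨x.2, fun y hy => ?_⟩
    change repTraceForm φ y x = 0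
    rw [repTraceForm_comm]
    exact hx ⟨y, hy⟩
  rw [hbot] at this
  exact (Submodule.mem_bot ℂ).1 this

/-- A Lie algebra closed under replicas and without nonzero nilpotently acting ideals acts
trivially on every module which is an essential extension of a trivial line. -/
theorem apply_eq_zero_of_essential {𝔤 V E : Type*} [LieRing 𝔤] [LieAlgebra ℂ 𝔤]
    [FiniteDimensional ℂ 𝔤] [AddCommGroup V] [Module ℂ V] [FiniteDimensional ℂ V]
    [AddCommGroup E] [Module ℂ E] [FiniteDimensional ℂ E]
    (φ : 𝔤 →ₗ⁅ℂ⁆ End ℂ V) (ψ : 𝔤 →ₗ⁅ℂ⁆ End ℂ E)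
    (hnil : ∀ 𝔠 : Submodule ℂ 𝔤, (∀ x : 𝔤, ∀ y ∈ 𝔠, ⁅x, y⁆ ∈ 𝔠) → (∀ x ∈ 𝔠, IsNilpotent (φ x)) →
      𝔠 = ⊥)
    (hrep : ∀ x f, ∃ y, IsReplica f (φ x) (φ y) ∧ IsReplica f (ψ x) (ψ y))
    (w : E) (hw0 : w ≠ 0) (hw : ∀ x, ψ x w = 0)
    (hess : ∀ N : Submodule ℂ E, (∀ x, ∀ e ∈ N, ψ x e ∈ N) → N ≠ ⊥ → w ∈ N) :
    ∀ x e, ψ x e = 0 := by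
  let 𝔫 : Submodule ℂ 𝔤 := LinearMap.ker (repTraceForm ψ)
  have mem𝔫 : ∀ x, x ∈ 𝔫 ↔ ∀ y, repTraceForm ψ x y = 0 := fun x => by
    simp [𝔫, LinearMap.ext_iff]
  have h𝔫 : ∀ x : 𝔤, ∀ y ∈ 𝔫, ⁅x, y⁆ ∈ 𝔫 := by
    intro x y hy
    rw [mem𝔫] at hy ⊢
    intro z
    rw [← lie_skew, map_neg, LinearMap.neg_apply, repTraceForm_lie, hy, neg_zero]
  have nil𝔫 : ∀ x ∈ 𝔫, IsNilpotent (ψ x) := by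
    intro x hx
    refine isNilpotent_of_trace_mul_replica _ fun f => ?_
    obtain ⟨y, -, hy⟩ := hrep x f
    exact ⟨ψ y, hy, (mem𝔫 x).1 hx y⟩
  have hc := isCompl_orthogonal_of_replica_closed φ hnil 𝔫 h𝔫 (fun x hx f => by
    obtain ⟨y, hy, hy'⟩ := hrep x f
    refine ⟨y, (mem𝔫 y).2 fun z => ?_, hy⟩
    rw [repTraceForm_apply, hy'.eq_zero (nil𝔫 x hx), zero_mul, map_zero])
  obtain ⟨C, hC, hCtr, hCw⟩ := exists_casimir ψ ((repTraceForm φ).orthogonal 𝔫)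
    (fun x y hy => repTraceForm_lie_orthogonal φ h𝔫 x y hy) (fun x hx h => by
      refine (Submodule.disjoint_def.1 hc.disjoint) x ((mem𝔫 x).2 fun y => ?_) hx
      obtain ⟨a, ha, c, hcc, rfl⟩ := Submodule.mem_sup.1
        (hc.sup_eq_top ▸ Submodule.mem_top : y ∈ 𝔫 ⊔ (repTraceForm φ).orthogonal 𝔫)
      rw [map_add, h c hcc, repTraceForm_comm, (mem𝔫 a).1 ha, add_zero])
  have hCnil : IsNilpotent C := by
    obtain ⟨k, hk⟩ := Filter.eventually_atTop.1 C.eventually_isCompl_ker_pow_range_pow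
    have hk := hk (k + 1) (by omega)
    refine ⟨k + 1, ?_⟩
    by_contra hne
    have hCk : ∀ x, C ^ (k + 1) * ψ x = ψ x * C ^ (k + 1) := fun x =>
      ((show Commute C (ψ x) from hC x).pow_left _).eq
    have hwr : w ∈ LinearMap.range (C ^ (k + 1)) := by
      refine hess _ ?_ (fun h => hne (LinearMap.range_eq_bot.1 h))
      rintro x _ ⟨e, rfl⟩
      exact ⟨ψ x e, LinearMap.congr_fun (hCk x) e⟩
    refine hw0 (Submodule.disjoint_def.1 hk.disjoint w ?_ hwr)
    rw [LinearMap.mem_ker, pow_succ, End.mul_apply, hCw w hw, map_zero]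
  have h𝔭 : (repTraceForm φ).orthogonal 𝔫 = ⊥ := by
    rw [(LinearMap.isNilpotent_trace_of_isNilpotent hCnil).eq_zero] at hCtr
    exact Submodule.finrank_eq_zero.1 (by exact_mod_cast hCtr.symm)
  have htop : 𝔫 = ⊤ := by
    have := hc.sup_eq_top
    rwa [h𝔭, sup_bot_eq] at this
  have nil : ∀ x, IsNilpotent (ψ x) := fun x => nil𝔫 x (htop ▸ Submodule.mem_top)
  suffices hE : Submodule.span ℂ {w} = ⊤ by
    intro x e
    obtain ⟨c, rfl⟩ := Submodule.mem_span_singleton.1 (hE ▸ Submodule.mem_top : e ∈ _)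
    rw [map_smul, hw, smul_zero]
  by_contra hE
  obtain ⟨v, hv, hvx⟩ := exists_notMem_forall_apply_mem_of_isNilpotent ψ nil _ hE
  let 𝔨 : Submodule ℂ 𝔤 := LinearMap.ker ((LinearMap.applyₗ v).comp (ψ : 𝔤 →ₗ[ℂ] End ℂ E))
  have mem𝔨 : ∀ x, x ∈ 𝔨 ↔ ψ x v = 0 := fun x => Iff.rfl
  have h𝔨 : ∀ x : 𝔤, ∀ y ∈ 𝔨, ⁅x, y⁆ ∈ 𝔨 := by
    intro x y hy
    rw [mem𝔨] at hy ⊢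
    obtain ⟨c, hc⟩ := Submodule.mem_span_singleton.1 (hvx x)
    rw [LieHom.map_lie, Ring.lie_def, LinearMap.sub_apply, End.mul_apply, End.mul_apply, hy,
      ← hc, map_smul, hw]
    simp
  have hrep𝔨 : ∀ x f, ∃ y ∈ 𝔨, IsReplica f (φ x) (φ y) := fun x f => by
    obtain ⟨y, hy, hy'⟩ := hrep x f
    refine ⟨y, ?_, hy⟩
    rw [mem𝔨, hy'.eq_zero (nil x), LinearMap.zero_apply]
  have hc' := isCompl_orthogonal_of_replica_closed φ hnil 𝔨 h𝔨 (fun x _ => hrep𝔨 x)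
  have hbot : (repTraceForm φ).orthogonal 𝔨 = ⊥ := by
    refine hnil _ (fun x y hy => repTraceForm_lie_orthogonal φ h𝔨 x y hy) fun x hx => ?_
    refine isNilpotent_of_trace_mul_replica _ fun f => ?_
    obtain ⟨y, hy, hxy⟩ := hrep𝔨 x f
    refine ⟨φ y, hxy, ?_⟩
    rw [← repTraceForm_apply, repTraceForm_comm]
    exact hx y hy
  have h𝔨top : 𝔨 = ⊤ := by
    have := hc'.sup_eq_top
    rwa [hbot, sup_bot_eq] at this
  have hvk : ∀ x, ψ x v = 0 := fun x => (mem𝔨 x).1 (h𝔨top ▸ Submodule.mem_top)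
  have hv0 : v ≠ 0 := fun h => hv (h ▸ Submodule.zero_mem _)
  have hwv : w ∈ Submodule.span ℂ {v} := by
    refine hess _ (fun x e he => ?_) (by simpa using hv0)
    obtain ⟨c, rfl⟩ := Submodule.mem_span_singleton.1 he
    rw [map_smul, hvk, smul_zero]
    exact Submodule.zero_mem _
  obtain ⟨c, hc⟩ := Submodule.mem_span_singleton.1 hwv
  have hc0 : c ≠ 0 := fun h => hw0 (by rw [← hc, h, zero_smul])
  exact hv (Submodule.mem_span_singleton.2 ⟨c⁻¹, by rw [← hc, smul_smul, inv_mul_cancel₀ hc0,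
    one_smul]⟩)

/-- `e` exhibits `B` as an algebra of functions on a group `Γ` which behaves like the coordinate
algebra of an affine algebraic group with group of points `Γ`. -/
structure IsGroupAlgebra {Γ B : Type*} [Group Γ] [CommRing B] [Algebra ℂ B]
    (e : Γ → B →ₐ[ℂ] ℂ) : Prop where
  finiteType : Algebra.FiniteType ℂ B
  ext : ∀ {a b : B}, (∀ g, e g a = e g b) → a = b
  exists_eval : ∀ χ : B →ₐ[ℂ] ℂ, ∃ g, e g = χ
  comul : ∀ f : B, ∃ (k : ℕ) (a b : Fin k → B), ∀ g h, e (g * h) f = ∑ i, e g (a i) * e h (b i)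
  antipode : ∀ f : B, ∃ f' : B, ∀ g, e g f' = e g⁻¹ f
  injective : Function.Injective e

/-- The common zeros of a set of functions. -/
def zeroSet {Γ B : Type*} [CommRing B] [Algebra ℂ B] (e : Γ → B →ₐ[ℂ] ℂ) (S : Set B) : Set Γ :=
  {g | ∀ s ∈ S, e g s = 0}

/-- A subset of `Γ` is connected for the Zariski topology defined by an algebra of functions. -/
def IsZariskiConnected {Γ B : Type*} [CommRing B] [Algebra ℂ B] (e : Γ → B →ₐ[ℂ] ℂ)
    (K : Set Γ) : Prop :=
  ∀ S T : Set B, K ⊆ zeroSet e S ∪ zeroSet e T → K ∩ (zeroSet e S ∩ zeroSet e T) = ∅ →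
    K ⊆ zeroSet e S ∨ K ⊆ zeroSet e T

namespace IsGroupAlgebra

variable {Γ B : Type*} [Group Γ] [CommRing B] [Algebra ℂ B] {e : Γ → B →ₐ[ℂ] ℂ}

theorem exists_left (hA : IsGroupAlgebra e) (g : Γ) (f : B) :
    ∃ f' : B, ∀ x, e x f' = e (g * x) f := by
  obtain ⟨k, a, b, h⟩ := hA.comul f
  exact ⟨∑ i, e g (a i) • b i, fun x => by simp [h]⟩

theorem exists_right (hA : IsGroupAlgebra e) (g : Γ) (f : B) :
    ∃ f' : B, ∀ x, e x f' = e (x * g) f := by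
  obtain ⟨k, a, b, h⟩ := hA.comul f
  exact ⟨∑ i, e g (b i) • a i, fun x => by simp [h, mul_comm]⟩

/-- Left translation of functions. -/
noncomputable def lTr (hA : IsGroupAlgebra e) (g : Γ) : B →ₐ[ℂ] B where
  toFun f := (hA.exists_left g f).choose
  map_one' := hA.ext fun x => by rw [(hA.exists_left g _).choose_spec]; simp
  map_mul' a b := hA.ext fun x => by
    rw [(hA.exists_left g (a * b)).choose_spec, map_mul, map_mul, (hA.exists_left g a).choose_spec,
      (hA.exists_left g b).choose_spec]
  map_zero' := hA.ext fun x => by rw [(hA.exists_left g _).choose_spec]; simp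
  map_add' a b := hA.ext fun x => by
    rw [(hA.exists_left g (a + b)).choose_spec, map_add, map_add, (hA.exists_left g a).choose_spec,
      (hA.exists_left g b).choose_spec]
  commutes' c := hA.ext fun x => by rw [(hA.exists_left g _).choose_spec]; simp

/-- Right translation of functions. -/
noncomputable def rTr (hA : IsGroupAlgebra e) (g : Γ) : B →ₐ[ℂ] B where
  toFun f := (hA.exists_right g f).choose
  map_one' := hA.ext fun x => by rw [(hA.exists_right g _).choose_spec]; simp
  map_mul' a b := hA.ext fun x => by
    rw [(hA.exists_right g (a * b)).choose_spec, map_mul, map_mul,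
      (hA.exists_right g a).choose_spec,
      (hA.exists_right g b).choose_spec]
  map_zero' := hA.ext fun x => by rw [(hA.exists_right g _).choose_spec]; simp
  map_add' a b := hA.ext fun x => by
    rw [(hA.exists_right g (a + b)).choose_spec, map_add, map_add,
      (hA.exists_right g a).choose_spec,
      (hA.exists_right g b).choose_spec]
  commutes' c := hA.ext fun x => by rw [(hA.exists_right g _).choose_spec]; simp

@[simp] theorem lTr_apply (hA : IsGroupAlgebra e) (g x : Γ) (f : B) :
    e x (hA.lTr g f) = e (g * x) f := (hA.exists_left g f).choose_spec x

@[simp] theorem rTr_apply (hA : IsGroupAlgebra e) (g x : Γ) (f : B) :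
    e x (hA.rTr g f) = e (x * g) f := (hA.exists_right g f).choose_spec x

theorem lTr_lTr (hA : IsGroupAlgebra e) (g h : Γ) (f : B) :
    hA.lTr g (hA.lTr h f) = hA.lTr (h * g) f := hA.ext fun x => by simp [mul_assoc]

theorem rTr_rTr (hA : IsGroupAlgebra e) (g h : Γ) (f : B) :
    hA.rTr g (hA.rTr h f) = hA.rTr (g * h) f := hA.ext fun x => by simp [mul_assoc]

theorem lTr_one (hA : IsGroupAlgebra e) (f : B) : hA.lTr 1 f = f := hA.ext fun x => by simp

theorem rTr_one (hA : IsGroupAlgebra e) (f : B) : hA.rTr 1 f = f := hA.ext fun x => by simp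

/-- The Lie algebra of derivations commuting with left translations. -/
def lie (hA : IsGroupAlgebra e) : LieSubalgebra ℂ (Derivation ℂ B B) where
  carrier := {D | ∀ g f, D (hA.lTr g f) = hA.lTr g (D f)}
  zero_mem' := fun g f => by simp
  add_mem' := fun {D D'} h h' g f => by simp [h g f, h' g f]
  smul_mem' := fun c D h g f => by simp [h g f]
  lie_mem' := fun {D D'} h h' g f => by
    simp only [Derivation.commutator_apply, map_sub]
    rw [h' g f, h g, h g f, h' g]

theorem mem_lie (hA : IsGroupAlgebra e) {D : Derivation ℂ B B} :
    D ∈ hA.lie ↔ ∀ g f, D (hA.lTr g f) = hA.lTr g (D f) := Iff.rfl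

theorem lie_lTr (hA : IsGroupAlgebra e) (D : hA.lie) (g : Γ) (f : B) :
    D.1 (hA.lTr g f) = hA.lTr g (D.1 f) := D.2 g f

theorem lie_apply_apply (hA : IsGroupAlgebra e) (D : hA.lie) (f : B) (x : Γ) :
    e x (D.1 f) = e 1 (D.1 (hA.lTr x f)) := by
  rw [lie_lTr]
  simp

theorem exists_translates (hA : IsGroupAlgebra e) (f : B) : ∃ (k : ℕ) (a b : Fin k → B),
    (∀ x, hA.lTr x f = ∑ i, e x (a i) • b i) ∧ (∀ x, hA.rTr x f = ∑ i, e x (b i) • a i) ∧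
    ∀ D : hA.lie, D.1 f = ∑ i, e 1 (D.1 (b i)) • a i := by
  obtain ⟨k, a, b, h⟩ := hA.comul f
  have hl : ∀ x, hA.lTr x f = ∑ i, e x (a i) • b i := fun x => hA.ext fun y => by simp [h]
  refine ⟨k, a, b, hl, fun x => hA.ext fun y => by simp [h, mul_comm], fun D => ?_⟩
  refine hA.ext fun y => ?_
  rw [lie_apply_apply, hl, map_sum]
  simp [mul_comm]

/-- Subspaces stable under right translations are stable under the Lie algebra. -/
theorem lie_apply_mem (hA : IsGroupAlgebra e) {W : Submodule ℂ B}
    (hW : ∀ g, ∀ f ∈ W, hA.rTr g f ∈ W) (D : hA.lie) {f : B} (hf : f ∈ W) : D.1 f ∈ W := by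
  by_contra hn
  obtain ⟨φ, hφ, hφW⟩ := Submodule.exists_le_ker_of_notMem hn
  obtain ⟨k, a, b, -, hr, hD⟩ := hA.exists_translates f
  have h0 : ∑ i, φ (a i) • b i = 0 := by
    refine hA.ext fun g => ?_
    have : φ (hA.rTr g f) = 0 := hφW (hW g f hf)
    rw [hr, map_sum] at this
    simpa [mul_comm] using this
  refine hφ ?_
  have h1 := congrArg (fun F => e 1 (D.1 F)) h0
  rw [hD, map_sum]
  simpa [mul_comm] using h1

theorem exists_finiteDimensional_rTr_stable (hA : IsGroupAlgebra e) (s : Finset B) :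
    ∃ W : Submodule ℂ B, FiniteDimensional ℂ W ∧ (↑s : Set B) ⊆ W ∧
      ∀ g, ∀ f ∈ W, hA.rTr g f ∈ W := by
  classical
  let W : Submodule ℂ B := Submodule.span ℂ {F | ∃ f ∈ s, ∃ g, F = hA.rTr g f}
  refine ⟨W, ?_, fun f hf => Submodule.subset_span ⟨f, hf, 1, (hA.rTr_one f).symm⟩, ?_⟩
  · choose k a b hl hr hD using hA.exists_translates
    let U : Submodule ℂ B := Submodule.span ℂ (⋃ f ∈ s, Set.range (a f))
    have : FiniteDimensional ℂ U :=
      FiniteDimensional.span_of_finite ℂ (s.finite_toSet.biUnion fun f _ => Set.finite_range _)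
    refine Submodule.finiteDimensional_of_le (S₂ := U) (Submodule.span_le.2 ?_)
    rintro _ ⟨f, hf, g, rfl⟩
    rw [hr]
    exact U.sum_mem fun i _ => U.smul_mem _
      (Submodule.subset_span (Set.mem_biUnion hf ⟨i, rfl⟩))
  · intro g F hF
    induction hF using Submodule.span_induction with
    | mem F h =>
      obtain ⟨f, hf, h, rfl⟩ := h
      exact Submodule.subset_span ⟨f, hf, g * h, hA.rTr_rTr g h f⟩
    | zero => simp
    | add x y _ _ hx hy => rw [map_add]; exact W.add_mem hx hy
    | smul c x _ hx => rw [map_smul]; exact W.smul_mem _ hx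

theorem exists_generating_rTr_stable (hA : IsGroupAlgebra e) :
    ∃ W : Submodule ℂ B, FiniteDimensional ℂ W ∧ Algebra.adjoin ℂ (W : Set B) = ⊤ ∧
      ∀ g, ∀ f ∈ W, hA.rTr g f ∈ W := by
  obtain ⟨s, hs⟩ := hA.finiteType.1
  obtain ⟨W, h1, h2, h3⟩ := hA.exists_finiteDimensional_rTr_stable s
  exact ⟨W, h1, top_le_iff.1 (hs ▸ Algebra.adjoin_mono h2), h3⟩

/-- The action of the Lie algebra on a stable subspace. -/
def lieRep (hA : IsGroupAlgebra e) (W : Submodule ℂ B)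
    (hW : ∀ D : hA.lie, ∀ f ∈ W, D.1 f ∈ W) : hA.lie →ₗ⁅ℂ⁆ End ℂ W where
  toFun D := LinearMap.restrict (D.1 : B →ₗ[ℂ] B) (hW D)
  map_add' _ _ := rfl
  map_smul' _ _ := rfl
  map_lie' := rfl

theorem lieRep_apply (hA : IsGroupAlgebra e) (W : Submodule ℂ B)
    (hW : ∀ D : hA.lie, ∀ f ∈ W, D.1 f ∈ W) (D : hA.lie) (f : W) :
    (hA.lieRep W hW D f : B) = D.1 f := rfl

theorem lie_eq_zero (hA : IsGroupAlgebra e) {W : Submodule ℂ B}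
    (hW : Algebra.adjoin ℂ (W : Set B) = ⊤) (D : hA.lie)
    (hD : ∀ f ∈ W, D.1 f = 0) : D = 0 := by
  refine Subtype.ext (Derivation.ext fun f => ?_)
  have : f ∈ Algebra.adjoin ℂ (W : Set B) := hW ▸ Algebra.mem_top
  exact Derivation.eqOn_adjoin (D1 := D.1) (D2 := 0) (fun x hx => hD x hx) this

theorem finiteDimensional_lie (hA : IsGroupAlgebra e) : FiniteDimensional ℂ hA.lie := by
  obtain ⟨W, h1, h2, h3⟩ := hA.exists_generating_rTr_stable
  have hW : ∀ D : hA.lie, ∀ f ∈ W, D.1 f ∈ W := fun D f hf => hA.lie_apply_mem h3 D hf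
  refine FiniteDimensional.of_injective (hA.lieRep W hW : hA.lie →ₗ[ℂ] End ℂ W)
    ((injective_iff_map_eq_zero _).2 fun D hD => ?_)
  refine hA.lie_eq_zero h2 D fun f hf => ?_
  exact congrArg Subtype.val (LinearMap.congr_fun hD ⟨f, hf⟩)

/-- A point derivation at the identity extends to a derivation commuting with left
translations. -/
theorem exists_lie_of_pointDerivation (hA : IsGroupAlgebra e) (d : B →ₗ[ℂ] ℂ)
    (hd : ∀ a b, d (a * b) = e 1 a * d b + e 1 b * d a) :
    ∃ D : hA.lie, ∀ f x, e x (D.1 f) = d (hA.lTr x f) := by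
  have hmem : ∀ f, ∃ F : B, ∀ x, e x F = d (hA.lTr x f) := by
    intro f
    obtain ⟨k, a, b, hl, -⟩ := hA.exists_translates f
    refine ⟨∑ i, d (b i) • a i, fun x => ?_⟩
    rw [hl, map_sum, map_sum]
    simp [mul_comm]
  choose F hF using hmem
  let D : Derivation ℂ B B := Derivation.mk'
    { toFun := F
      map_add' := fun f g => hA.ext fun x => by simp [hF]
      map_smul' := fun c f => hA.ext fun x => by simp [hF] }
    (fun a b => hA.ext fun x => by
      change e x (F (a * b)) = e x (a * F b + b * F a)
      simp [hF, hd])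
  refine ⟨⟨D, fun g f => hA.ext fun x => ?_⟩, fun f x => hF f x⟩
  rw [lTr_apply]
  change e x (F (hA.lTr g f)) = e (g * x) (F f)
  rw [hF, hF, lTr_lTr]

end IsGroupAlgebra

namespace IsGroupAlgebra

variable {Γ B : Type*} [Group Γ] [CommRing B] [Algebra ℂ B] {e : Γ → B →ₐ[ℂ] ℂ}

/-- An Euler vector field at the identity. -/
theorem exists_euler (hA : IsGroupAlgebra e) :
    ∃ E : Derivation ℂ B B, (∀ y ∈ RingHom.ker (e 1), E y - y ∈ RingHom.ker (e 1) ^ 2) ∧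
      ∃ (n : ℕ) (x : Fin n → B) (D : Fin n → hA.lie), (∀ i, x i ∈ RingHom.ker (e 1)) ∧
        ∀ y, E y = ∑ i, x i * (D i).1 y := by
  have := hA.finiteType
  have : IsNoetherianRing B := Algebra.FiniteType.isNoetherianRing ℂ B
  let m : Ideal B := RingHom.ker (e 1)
  have hmm : ∀ a : B, a ∈ m ↔ e 1 a = 0 := fun a => RingHom.mem_ker
  have hsub : ∀ a : B, a - algebraMap ℂ B (e 1 a) ∈ m := fun a => by simp [hmm]
  let N : Submodule ℂ B := (m ^ 2).restrictScalars ℂ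
  let U : Submodule ℂ (B ⧸ N) := (m.restrictScalars ℂ).map N.mkQ
  have hN : ∀ a, N.mkQ a = 0 ↔ a ∈ m ^ 2 := fun a => by
    rw [Submodule.mkQ_apply, Submodule.Quotient.mk_eq_zero]; rfl
  have hfd : FiniteDimensional ℂ U := by
    obtain ⟨s, hs⟩ := (isNoetherianRing_iff_ideal_fg B).1 this m
    have hle : U ≤ Submodule.span ℂ (N.mkQ '' s) := by
      rintro _ ⟨y, hy, rfl⟩
      have hy' : y ∈ Submodule.span B (s : Set B) := by rw [← Ideal.span, hs]; exact hy
      obtain ⟨f, hf⟩ := Submodule.mem_span_finset'.1 hy'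
      have : N.mkQ y = ∑ a : s, e 1 (f a) • N.mkQ a := by
        rw [← sub_eq_zero, ← hf, map_sum, ← Finset.sum_sub_distrib]
        refine Finset.sum_eq_zero fun a _ => ?_
        rw [← map_smul, ← map_sub, hN, smul_eq_mul, Algebra.smul_def, ← sub_mul, pow_two]
        exact Ideal.mul_mem_mul (hsub _) (hs ▸ Ideal.subset_span a.2)
      rw [this]
      exact Submodule.sum_mem _ fun a _ => Submodule.smul_mem _ _
        (Submodule.subset_span ⟨a, a.2, rfl⟩)
    have : FiniteDimensional ℂ (Submodule.span ℂ (N.mkQ '' (s : Set B))) :=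
      FiniteDimensional.span_of_finite ℂ (s.finite_toSet.image _)
    exact Submodule.finiteDimensional_of_le hle
  let b := Module.finBasis ℂ U
  have hx : ∀ i, ∃ x ∈ m, N.mkQ x = b i := fun i => by
    obtain ⟨x, hx, h⟩ := (b i).2
    exact ⟨x, hx, h⟩
  choose x hxm hxb using hx
  have hc : ∀ i, ∃ c : (B ⧸ N) →ₗ[ℂ] ℂ, c.comp U.subtype = b.coord i := fun i =>
    LinearMap.exists_extend _
  choose c hc using hc
  let d : Fin (finrank ℂ U) → B →ₗ[ℂ] ℂ := fun i =>
    (c i).comp (N.mkQ.comp (LinearMap.id - (Algebra.linearMap ℂ B).comp (e 1).toLinearMap))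
  have hd : ∀ i a, d i a = c i (N.mkQ (a - algebraMap ℂ B (e 1 a))) := fun _ _ => rfl
  have hder : ∀ i a b, d i (a * b) = e 1 a * d i b + e 1 b * d i a := by
    intro i a b
    have h0 : N.mkQ ((a - algebraMap ℂ B (e 1 a)) * (b - algebraMap ℂ B (e 1 b))) = 0 := by
      rw [hN, pow_two]
      exact Ideal.mul_mem_mul (hsub _) (hsub _)
    have h1 : a * b - algebraMap ℂ B (e 1 (a * b)) =
        e 1 a • (b - algebraMap ℂ B (e 1 b)) + e 1 b • (a - algebraMap ℂ B (e 1 a)) +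
        (a - algebraMap ℂ B (e 1 a)) * (b - algebraMap ℂ B (e 1 b)) := by
      simp only [Algebra.smul_def, map_mul]
      ring
    rw [hd, hd, hd, h1, map_add, h0, add_zero, map_add, map_add, map_smul, map_smul, map_smul,
      map_smul, smul_eq_mul, smul_eq_mul]
  choose D hD using fun i => hA.exists_lie_of_pointDerivation (d i) (hder i)
  let E : Derivation ℂ B B := ∑ i, x i • (D i).1
  have hE : ∀ y, E y = ∑ i, x i * (D i).1 y := fun y => by
    rw [show E y = (∑ i, x i • (D i).1 : Derivation ℂ B B) y from rfl,
      ← Derivation.coeFnAddMonoidHom_apply,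
      map_sum, Finset.sum_apply]
    rfl
  refine ⟨E, fun y hy => ?_, _, x, D, hxm, hE⟩
  have hy1 : e 1 y = 0 := hy
  have h1 : E y - ∑ i, algebraMap ℂ B (d i y) * x i ∈ m ^ 2 := by
    rw [hE, ← Finset.sum_sub_distrib]
    refine Ideal.sum_mem _ fun i _ => ?_
    rw [mul_comm, ← sub_mul, pow_two]
    refine Ideal.mul_mem_mul ?_ (hxm i)
    rw [hmm, map_sub, hD, lTr_one]
    simp
  have h2 : ∑ i, algebraMap ℂ B (d i y) * x i - y ∈ m ^ 2 := by
    rw [← hN, map_sub, sub_eq_zero, map_sum]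
    have h3 := b.sum_repr ⟨N.mkQ y, y, hy, rfl⟩
    have h4 := congrArg Subtype.val h3
    rw [AddSubmonoidClass.coe_finsetSum] at h4
    refine Eq.trans ?_ h4
    refine Finset.sum_congr rfl fun i _ => ?_
    rw [← Algebra.smul_def, map_smul, hxb, Submodule.coe_smul]
    congr 1
    rw [hd, hy1, map_zero, sub_zero]
    exact LinearMap.congr_fun (hc i) ⟨N.mkQ y, y, hy, rfl⟩
  have := Ideal.add_mem _ h1 h2
  rwa [sub_add_sub_cancel] at this

theorem euler_pow {m : Ideal B} {E : Derivation ℂ B B} (hE : ∀ y ∈ m, E y - y ∈ m ^ 2)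
    (k : ℕ) : ∀ y ∈ m ^ (k + 1), E y - ((k + 1 : ℕ) : ℂ) • y ∈ m ^ (k + 2) := by
  induction k with
  | zero => simpa using hE
  | succ k ih =>
    intro y hy
    rw [pow_succ] at hy
    induction hy using Submodule.mul_induction_on' with
    | mem_mul_mem a ha b hb =>
      have h1 : E (a * b) - ((k + 1 + 1 : ℕ) : ℂ) • (a * b) =
          a * (E b - b) + (E a - ((k + 1 : ℕ) : ℂ) • a) * b := by
        rw [Derivation.leibniz]
        simp only [smul_eq_mul, Algebra.smul_def]
        push_cast
        ring
      rw [h1]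
      refine Ideal.add_mem _ ?_ ?_
      · rw [show k + 1 + 2 = (k + 1) + 2 by ring, pow_add]
        exact Ideal.mul_mem_mul ha (hE b hb)
      · rw [show k + 1 + 2 = (k + 2) + 1 by ring, pow_succ]
        exact Ideal.mul_mem_mul (ih a ha) hb
    | add x _ y _ hx hy =>
      have := Ideal.add_mem _ hx hy
      rw [map_add, smul_add, add_sub_add_comm]
      exact this

theorem exists_annihilator (hA : IsGroupAlgebra e) {C : Submodule ℂ B}
    (hC : ∀ D : hA.lie, ∀ f ∈ C, D.1 f ∈ C) (h1 : ∀ f ∈ C, e 1 f = 0) :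
    ∃ b, e 1 b ≠ 0 ∧ ∀ f ∈ C, b * f = 0 := by
  have := hA.finiteType
  have : IsNoetherianRing B := Algebra.FiniteType.isNoetherianRing ℂ B
  let m : Ideal B := RingHom.ker (e 1)
  obtain ⟨E, hE, n, x, D, hx, hED⟩ := hA.exists_euler
  have hpow : ∀ k, ∀ f ∈ C, f ∈ m ^ (k + 1) := by
    intro k
    induction k with
    | zero => exact fun f hf => (pow_one m).symm ▸ h1 f hf
    | succ k ih =>
      intro f hf
      have h2 : E f ∈ m ^ (k + 2) := by
        rw [hED]
        refine Ideal.sum_mem _ fun i _ => ?_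
        rw [show k + 2 = (k + 1) + 1 by ring, pow_succ']
        exact Ideal.mul_mem_mul (hx i) (ih _ (hC (D i) f hf))
      have h3 := Ideal.sub_mem _ h2 (euler_pow hE k f (ih f hf))
      rw [sub_sub_cancel] at h3
      have h4 : (((k + 1 : ℕ) : ℂ)⁻¹) • (((k + 1 : ℕ) : ℂ) • f) ∈ m ^ (k + 2) :=
        ((m ^ (k + 2)).restrictScalars ℂ).smul_mem _ h3
      rwa [smul_smul, inv_mul_cancel₀ (Nat.cast_ne_zero.2 k.succ_ne_zero), one_smul] at h4
  have hle : Ideal.span (C : Set B) ≤ m • Ideal.span (C : Set B) := by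
    refine Ideal.span_le.2 fun f hf => ?_
    have h2 : f ∈ (⨅ i : ℕ, m ^ i • ⊤ : Submodule B B) := by
      refine Submodule.mem_iInf _ |>.2 fun k => ?_
      simpa using Ideal.pow_le_pow_right (Nat.le_succ k) (hpow k f hf)
    obtain ⟨⟨r, hr⟩, hrf⟩ := (Ideal.mem_iInf_smul_pow_eq_bot_iff m f).1 h2
    have h5 : r * f = f := hrf
    change f ∈ m * Ideal.span (C : Set B)
    rw [← h5]
    exact Ideal.mul_mem_mul hr (Ideal.subset_span hf)
  obtain ⟨r, hr, hr0⟩ := Submodule.exists_sub_one_mem_and_smul_eq_zero_of_fg_of_le_smul m _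
    ((isNoetherianRing_iff_ideal_fg B).1 this _) hle
  refine ⟨r, ?_, fun f hf => hr0 f (Ideal.subset_span hf)⟩
  have : e 1 (r - 1) = 0 := hr
  rw [map_sub, map_one, sub_eq_zero] at this
  simp [this]

theorem eq_zero_of_lie_stable (hA : IsGroupAlgebra e) (hconn : IsZariskiConnected e Set.univ)
    {C : Submodule ℂ B} (hC : ∀ D : hA.lie, ∀ f ∈ C, D.1 f ∈ C) (h1 : ∀ f ∈ C, e 1 f = 0) :
    ∀ f ∈ C, f = 0 := by
  have key : ∀ g, (∀ f ∈ C, e g f = 0) → ∃ b, e g b ≠ 0 ∧ ∀ f ∈ C, b * f = 0 := by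
    intro g hg
    obtain ⟨b, hb, hb0⟩ := hA.exists_annihilator (C := C.map (hA.lTr g).toLinearMap)
      (by
        rintro D _ ⟨f, hf, rfl⟩
        exact ⟨D.1 f, hC D f hf, (hA.lie_lTr D g f).symm⟩)
      (by
        rintro _ ⟨f, hf, rfl⟩
        simpa using hg f hf)
    refine ⟨hA.lTr g⁻¹ b, by simpa using hb, fun f hf => ?_⟩
    have := congrArg (hA.lTr g⁻¹) (hb0 (hA.lTr g f) ⟨f, hf, rfl⟩)
    rw [map_mul, lTr_lTr, mul_inv_cancel, lTr_one, map_zero] at this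
    exact this
  refine (hconn C {b | ∀ f ∈ C, b * f = 0} ?_ ?_).elim (fun h => ?_) (fun h => ?_)
  · intro g _
    by_cases hg : ∀ f ∈ C, e g f = 0
    · exact Or.inl hg
    · push Not at hg
      obtain ⟨f, hf, hfg⟩ := hg
      refine Or.inr fun b hb => ?_
      have := congrArg (e g) (hb f hf)
      rw [map_mul, map_zero] at this
      exact (mul_eq_zero.1 this).resolve_right hfg
  · refine Set.eq_empty_iff_forall_notMem.2 ?_
    rintro g ⟨-, hg, hg'⟩
    obtain ⟨b, hb, hb0⟩ := key g hg
    exact hb (hg' b hb0)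
  · exact fun f hf => hA.ext fun g => by rw [h (Set.mem_univ g) f hf, map_zero]
  · obtain ⟨b, hb, hb0⟩ := key 1 h1
    exact absurd (h (Set.mem_univ 1) b hb0) hb

/-- Matrix coefficients of the right regular representation. -/
theorem exists_coefficient (hA : IsGroupAlgebra e) (φ : B →ₗ[ℂ] ℂ) :
    ∃ c : B →ₗ[ℂ] B, (∀ f g, e g (c f) = φ (hA.rTr g f)) ∧
      ∀ (D : hA.lie) f, D.1 (c f) = c (D.1 f) := by
  have h : ∀ f, ∃ F : B, ∀ g, e g F = φ (hA.rTr g f) := by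
    intro f
    obtain ⟨k, a, b, -, hr, -⟩ := hA.exists_translates f
    refine ⟨∑ i, φ (a i) • b i, fun x => ?_⟩
    rw [hr, map_sum, map_sum]
    simp [mul_comm]
  choose c hc using h
  refine ⟨⟨⟨c, fun f g => hA.ext fun x => by simp [hc]⟩,
    fun r f => hA.ext fun x => by simp [hc]⟩, hc, fun D f => ?_⟩
  change D.1 (c f) = c (D.1 f)
  obtain ⟨k, a, b, hl, hr, hD⟩ := hA.exists_translates f
  have hcf : c f = ∑ i, φ (a i) • b i := hA.ext fun x => by
    rw [hc, hr, map_sum, map_sum]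
    simp [mul_comm]
  have key : ∀ g, hA.rTr g (D.1 f) = ∑ i, e g (D.1 (b i)) • a i := by
    intro g
    refine hA.ext fun x => ?_
    rw [rTr_apply, lie_apply_apply, ← lTr_lTr, lie_lTr, lTr_apply, hl, map_sum, map_sum, map_sum]
    simp [mul_comm]
  refine hA.ext fun g => ?_
  rw [hc, key, hcf, map_sum, map_sum, map_sum]
  simp [mul_comm]

/-- For a connected group, subspaces stable under the Lie algebra are stable under right
translations. -/
theorem rTr_apply_mem (hA : IsGroupAlgebra e) (hconn : IsZariskiConnected e Set.univ)
    {W : Submodule ℂ B} (hW : ∀ D : hA.lie, ∀ f ∈ W, D.1 f ∈ W) (g : Γ) {f : B} (hf : f ∈ W) :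
    hA.rTr g f ∈ W := by
  by_contra hn
  obtain ⟨φ, hφ, hφW⟩ := Submodule.exists_le_ker_of_notMem hn
  obtain ⟨c, hc, hcD⟩ := hA.exists_coefficient φ
  refine hφ ?_
  rw [← hc, hA.eq_zero_of_lie_stable hconn (C := W.map c) ?_ ?_ (c f) ⟨f, hf, rfl⟩, map_zero]
  · rintro D _ ⟨f, hf, rfl⟩
    exact ⟨D.1 f, hW D f hf, (hcD D f).symm⟩
  · rintro _ ⟨f, hf, rfl⟩
    rw [hc, rTr_one]
    exact hφW hf

end IsGroupAlgebra

/-- A locally finite endomorphism has replicas. -/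
theorem exists_isReplica {E : Type*} [AddCommGroup E] [Module ℂ E] (X : End ℂ E)
    (hX : ⨆ μ, X.maxGenEigenspace μ = ⊤) (f : ℂ →ₗ[ℚ] ℚ) : ∃ Y : End ℂ E, IsReplica f X Y := by
  classical
  have hinternal : DirectSum.IsInternal X.maxGenEigenspace :=
    DirectSum.isInternal_submodule_of_iSupIndep_of_iSup_eq_top X.independent_maxGenEigenspace hX
  let d := LinearEquiv.ofBijective (DirectSum.coeLinearMap X.maxGenEigenspace) hinternal
  refine ⟨(DirectSum.toModule ℂ ℂ E fun μ => (f μ : ℂ) • (X.maxGenEigenspace μ).subtype).comp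
    d.symm.toLinearMap, fun μ e he => ?_⟩
  have : d.symm e = DirectSum.lof ℂ ℂ (fun μ => X.maxGenEigenspace μ) μ ⟨e, he⟩ := by
    rw [LinearEquiv.symm_apply_eq]
    exact (DirectSum.coeLinearMap_lof X.maxGenEigenspace μ ⟨e, he⟩).symm
  simp [this]

theorem IsReplica.map {E F : Type*} [AddCommGroup E] [Module ℂ E] [AddCommGroup F] [Module ℂ F]
    {f : ℂ →ₗ[ℚ] ℚ} {X Y : End ℂ E} (h : IsReplica f X Y) {X' Y' : End ℂ F} {i : F →ₗ[ℂ] E}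
    (hi : Function.Injective i) (hX : ∀ v, i (X' v) = X (i v)) (hY : ∀ v, i (Y' v) = Y (i v)) :
    IsReplica f X' Y' := by
  intro μ v hv
  obtain ⟨k, hk⟩ := (End.mem_maxGenEigenspace _ _ _).1 hv
  refine hi ?_
  rw [hY, map_smul]
  refine h μ _ ((End.mem_maxGenEigenspace _ _ _).2 ⟨k, ?_⟩)
  have : ∀ v, i (((X' - μ • 1) ^ k) v) = ((X - μ • 1) ^ k) (i v) := by
    clear hk
    induction k with
    | zero => simp
    | succ k ih => intro v; rw [pow_succ, pow_succ, Module.End.mul_apply, ih]; simp [hX]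
  rw [← this, hk, map_zero]

theorem map_maxGenEigenspace_le {E F : Type*} [AddCommGroup E] [Module ℂ E] [AddCommGroup F]
    [Module ℂ F] {X : End ℂ E} {X' : End ℂ F} {π : E →ₗ[ℂ] F} (hX : ∀ v, π (X v) = X' (π v))
    (μ : ℂ) : (X.maxGenEigenspace μ).map π ≤ X'.maxGenEigenspace μ := by
  rintro _ ⟨v, hv, rfl⟩
  obtain ⟨k, hk⟩ := (End.mem_maxGenEigenspace _ _ _).1 hv
  refine (End.mem_maxGenEigenspace _ _ _).2 ⟨k, ?_⟩
  have : ∀ v, π (((X - μ • 1) ^ k) v) = ((X' - μ • 1) ^ k) (π v) := by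
    clear hk
    induction k with
    | zero => simp
    | succ k ih => intro v; rw [pow_succ, pow_succ, Module.End.mul_apply, ih]; simp [hX]
  rw [← this, hk, map_zero]

theorem IsReplica.of_surjective {E F : Type*} [AddCommGroup E] [Module ℂ E]
    [FiniteDimensional ℂ E] [AddCommGroup F] [Module ℂ F]
    {f : ℂ →ₗ[ℚ] ℚ} {X Y : End ℂ E} (h : IsReplica f X Y) {X' Y' : End ℂ F} {π : E →ₗ[ℂ] F}
    (hπ : Function.Surjective π) (hX : ∀ v, π (X v) = X' (π v)) (hY : ∀ v, π (Y v) = Y' (π v)) :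
    IsReplica f X' Y' := by
  intro μ v hv
  obtain ⟨w, rfl⟩ := hπ v
  have htop : X.maxGenEigenspace μ ⊔ ⨆ ν, ⨆ _ : ν ≠ μ, X.maxGenEigenspace ν = ⊤ := by
    rw [eq_top_iff, ← End.iSup_maxGenEigenspace_eq_top X]
    refine iSup_le fun ν => ?_
    by_cases hν : ν = μ
    · exact hν ▸ le_sup_left
    · exact le_sup_of_le_right (le_iSup₂_of_le ν hν le_rfl)
  obtain ⟨a, ha, b, hb, hab⟩ := Submodule.mem_sup.1 (htop ▸ Submodule.mem_top (x := w))
  have hb' : π b ∈ ⨆ ν, ⨆ _ : ν ≠ μ, X'.maxGenEigenspace ν := by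
    have := Submodule.mem_map_of_mem (f := π) hb
    simp only [Submodule.map_iSup] at this
    exact iSup₂_mono (fun ν _ => map_maxGenEigenspace_le hX ν) this
  have ha' := map_maxGenEigenspace_le hX μ (Submodule.mem_map_of_mem (f := π) ha)
  have hb0 : π b = 0 := by
    have h1 : π b ∈ X'.maxGenEigenspace μ := by
      rw [show π b = π w - π a by rw [← hab, map_add]; abel]
      exact Submodule.sub_mem _ hv ha'
    exact (Submodule.disjoint_def.1 (X'.independent_maxGenEigenspace μ)) _ h1 hb'
  rw [← hab, map_add, hb0, add_zero, ← hY, h μ a ha, map_smul]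

theorem Derivation.pow_sub_mul_eq_zero {B : Type*} [CommRing B] [Algebra ℂ B]
    (D : Derivation ℂ B B) (μ ν : ℂ) (n : ℕ) : ∀ (p q : ℕ) (a b : B), p + q ≤ n →
    (((D : End ℂ B) - μ • 1) ^ p) a = 0 → (((D : End ℂ B) - ν • 1) ^ q) b = 0 →
    (((D : End ℂ B) - (μ + ν) • 1) ^ n) (a * b) = 0 := by
  induction n with
  | zero =>
    intro p q a b hpq ha _
    obtain rfl : p = 0 := by omega
    have : a = 0 := by simpa using ha
    simp [this]
  | succ n ih =>
    intro p q a b hpq ha hb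
    rcases p with _ | p
    · have : a = 0 := by simpa using ha
      simp [this]
    rcases q with _ | q
    · have : b = 0 := by simpa using hb
      simp [this]
    have h1 : ((D : End ℂ B) - (μ + ν) • 1) (a * b) =
        ((D : End ℂ B) - μ • 1) a * b + a * ((D : End ℂ B) - ν • 1) b := by
      simp [Algebra.smul_def]
      ring
    rw [pow_succ, Module.End.mul_apply, h1, map_add, ih p (q + 1) _ _ (by omega) _ hb,
      ih (p + 1) q _ _ (by omega) ha, add_zero]
    · rwa [pow_succ, Module.End.mul_apply] at hb
    · rwa [pow_succ, Module.End.mul_apply] at ha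

namespace IsGroupAlgebra

variable {Γ B : Type*} [Group Γ] [CommRing B] [Algebra ℂ B] {e : Γ → B →ₐ[ℂ] ℂ}

theorem iSup_maxGenEigenspace_lie (hA : IsGroupAlgebra e) (x : hA.lie) :
    ⨆ μ, End.maxGenEigenspace (x.1 : End ℂ B) μ = ⊤ := by
  refine eq_top_iff.2 fun f _ => ?_
  obtain ⟨W, hfd, hfW, hW⟩ := hA.exists_finiteDimensional_rTr_stable {f}
  let xW := hA.lieRep W (fun D f hf => hA.lie_apply_mem hW D hf) x
  have h1 : (⟨f, hfW (by simp)⟩ : W) ∈ ⨆ μ, xW.maxGenEigenspace μ := by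
    rw [End.iSup_maxGenEigenspace_eq_top]
    trivial
  have h2 := Submodule.mem_map_of_mem (f := W.subtype) h1
  simp only [Submodule.map_iSup] at h2
  exact iSup_mono (fun ν => map_maxGenEigenspace_le (X := xW) (X' := (x.1 : End ℂ B))
    (π := W.subtype) (fun v => rfl) ν) h2

/-- The Lie algebra of an algebraic group is closed under replicas. -/
theorem exists_lie_isReplica (hA : IsGroupAlgebra e) (x : hA.lie) (f : ℂ →ₗ[ℚ] ℚ) :
    ∃ y : hA.lie, IsReplica f (x.1 : End ℂ B) (y.1 : End ℂ B) := by
  have htop := hA.iSup_maxGenEigenspace_lie x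
  obtain ⟨Y, hY⟩ := exists_isReplica (x.1 : End ℂ B) htop f
  have hmul : ∀ a b, Y (a * b) = a * Y b + b * Y a := by
    intro a b
    have ha : a ∈ ⨆ μ, End.maxGenEigenspace (x.1 : End ℂ B) μ := htop ▸ Submodule.mem_top
    have hb : b ∈ ⨆ μ, End.maxGenEigenspace (x.1 : End ℂ B) μ := htop ▸ Submodule.mem_top
    induction ha using Submodule.iSup_induction' with
    | zero => simp
    | add a a' _ _ h h' => rw [add_mul, map_add, h, h', map_add]; ring
    | mem μ a ha =>
      induction hb using Submodule.iSup_induction' with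
      | zero => simp
      | add a a' _ _ h h' => rw [mul_add, map_add, h, h', map_add]; ring
      | mem ν b hb =>
        obtain ⟨p, hp⟩ := (End.mem_maxGenEigenspace _ _ _).1 ha
        obtain ⟨q, hq⟩ := (End.mem_maxGenEigenspace _ _ _).1 hb
        rw [hY μ a ha, hY ν b hb, hY (μ + ν) (a * b) ((End.mem_maxGenEigenspace _ _ _).2
          ⟨p + q, x.1.pow_sub_mul_eq_zero μ ν _ p q a b le_rfl hp hq⟩), map_add]
        rw [Rat.cast_add, add_smul, mul_smul_comm, mul_smul_comm, mul_comm b a, add_comm]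
  refine ⟨⟨Derivation.mk' Y hmul, fun g a => ?_⟩, hY⟩
  change Y (hA.lTr g a) = hA.lTr g (Y a)
  have ha : a ∈ ⨆ μ, End.maxGenEigenspace (x.1 : End ℂ B) μ := htop ▸ Submodule.mem_top
  induction ha using Submodule.iSup_induction' with
  | zero => simp
  | add a a' _ _ h h' => rw [map_add, map_add, h, h', map_add, map_add]
  | mem μ a ha =>
    have := map_maxGenEigenspace_le (π := (hA.lTr g).toLinearMap) (X := (x.1 : End ℂ B))
      (X' := (x.1 : End ℂ B)) (fun v => (hA.lie_lTr x g v).symm) μ (Submodule.mem_map_of_mem ha)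
    rw [hY μ a ha, map_smul]
    exact hY μ _ this

end IsGroupAlgebra

theorem Derivation.iterate_apply_mul {B : Type*} [CommRing B] [Algebra ℂ B]
    (D : Derivation ℂ B B) (n : ℕ) (a b : B) :
    D^[n] (a * b) = ∑ ij ∈ Finset.HasAntidiagonal.antidiagonal n,
      n.choose ij.1 • (D^[ij.1] a * D^[ij.2] b) := by
  induction n with
  | zero => simp
  | succ n ih =>
    rw [Finset.sum_antidiagonal_choose_succ_nsmul (M := B) (fun i j => D^[i] a * D^[j] b) n]
    simp only [Function.iterate_succ_apply', ih, map_sum, map_nsmul, Derivation.leibniz,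
      smul_eq_mul, smul_add, Finset.sum_add_distrib, add_right_inj]
    refine Finset.sum_congr rfl fun ⟨i, j⟩ hij => ?_
    rw [n.choose_symm_of_eq_add (Finset.HasAntidiagonal.mem_antidiagonal.1 hij).symm, mul_comm]

theorem iterate_map_zero_of_le {B : Type*} [AddCommGroup B] (D : B →+ B) {k n : ℕ}
    (hkn : k ≤ n) {a : B} (h : D^[k] a = 0) : D^[n] a = 0 := by
  obtain ⟨j, rfl⟩ := Nat.exists_eq_add_of_le' hkn
  rw [Function.iterate_add_apply, h, iterate_map_zero]

theorem Derivation.exists_iterate_eq_zero {B : Type*} [CommRing B] [Algebra ℂ B]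
    (D : Derivation ℂ B B) {s : Set B} (hs : Algebra.adjoin ℂ s = ⊤)
    (h : ∀ a ∈ s, ∃ k, D^[k] a = 0) (a : B) : ∃ k, D^[k] a = 0 := by
  have hle : ∀ {k n : ℕ} {a : B}, k ≤ n → D^[k] a = 0 → D^[n] a = 0 := fun hkn h =>
    iterate_map_zero_of_le (D : B →ₗ[ℂ] B).toAddMonoidHom hkn h
  have hadd : ∀ (k : ℕ) (a b : B), D^[k] (a + b) = D^[k] a + D^[k] b := fun k a b =>
    iterate_map_add (D : B →ₗ[ℂ] B) k a b
  have ha : a ∈ Algebra.adjoin ℂ s := hs ▸ Algebra.mem_top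
  induction ha using Algebra.adjoin_induction with
  | mem a ha => exact h a ha
  | algebraMap c => exact ⟨1, by simp⟩
  | add a b _ _ ha hb =>
    obtain ⟨k, hk⟩ := ha
    obtain ⟨l, hl⟩ := hb
    exact ⟨k + l, by rw [hadd, hle (Nat.le_add_right k l) hk, hle (Nat.le_add_left l k) hl,
      add_zero]⟩
  | mul a b _ _ ha hb =>
    obtain ⟨k, hk⟩ := ha
    obtain ⟨l, hl⟩ := hb
    refine ⟨k + l, ?_⟩
    rw [Derivation.iterate_apply_mul]
    refine Finset.sum_eq_zero fun ⟨i, j⟩ hij => ?_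
    have hij' := Finset.HasAntidiagonal.mem_antidiagonal.1 hij
    rcases le_or_gt k i with h | h
    · rw [hle h hk, zero_mul, smul_zero]
    · rw [hle (by simp at hij'; omega : l ≤ j) hl, mul_zero, smul_zero]

namespace IsGroupAlgebra

variable {Γ B : Type*} [Group Γ] [CommRing B] [Algebra ℂ B] {e : Γ → B →ₐ[ℂ] ℂ}

/-- The one-parameter group generated by a locally nilpotent derivation. -/
theorem exists_oneParameter (e₁ : B →ₐ[ℂ] ℂ) (D : Derivation ℂ B B)
    (h : ∀ a, ∃ k, D^[k] a = 0) :
    ∃ Φ : B →ₐ[ℂ] Polynomial ℂ, ∀ f n, (Φ f).coeff n = e₁ (D^[n] f) / (n.factorial : ℂ) := by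
  choose N hN using h
  let P : B → Polynomial ℂ := fun f => ∑ k ∈ Finset.range (N f),
    Polynomial.monomial k (e₁ (D^[k] f) / (k.factorial : ℂ))
  have hP : ∀ f n, (P f).coeff n = e₁ (D^[n] f) / (n.factorial : ℂ) := by
    intro f n
    simp only [P, Polynomial.finsetSum_coeff, Polynomial.coeff_monomial, Finset.sum_ite_eq',
      Finset.mem_range]
    split_ifs with hn
    · rfl
    · have h0 : D^[n] f = 0 :=
        iterate_map_zero_of_le (D : B →ₗ[ℂ] B).toAddMonoidHom (not_lt.1 hn) (hN f)
      simp [h0]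
  refine ⟨AlgHom.ofLinearMap ⟨⟨P, fun a b => ?_⟩, fun c a => ?_⟩ ?_ ?_, hP⟩
  · ext n
    rw [Polynomial.coeff_add, hP, hP, hP,
      show D^[n] (a + b) = _ from iterate_map_add (D : B →ₗ[ℂ] B) n a b, map_add, add_div]
    rfl
  · ext n
    have : D^[n] (c • a) = c • D^[n] a := by
      have h1 := ((D : End ℂ B) ^ n).map_smul c a
      rwa [Module.End.pow_apply, Module.End.pow_apply] at h1
    change (P (c • a)).coeff n = (c • P a).coeff n
    rw [hP, this, Polynomial.coeff_smul, hP, map_smul, smul_eq_mul, smul_eq_mul, mul_div_assoc]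
  · ext n
    change (P 1).coeff n = _
    rw [hP, Polynomial.coeff_one]
    rcases n with _ | n
    · simp
    · rw [Function.iterate_succ_apply, Derivation.map_one_eq_zero,
        show D^[n] 0 = 0 from iterate_map_zero (D : B →ₗ[ℂ] B) n]
      simp
  · intro a b
    ext n
    change (P (a * b)).coeff n = (P a * P b).coeff n
    rw [Polynomial.coeff_mul, hP, Derivation.iterate_apply_mul, map_sum, Finset.sum_div]
    refine Finset.sum_congr rfl fun ⟨i, j⟩ hij => ?_
    obtain rfl := Finset.HasAntidiagonal.mem_antidiagonal.1 hij
    rw [hP, hP, map_nsmul, map_mul, nsmul_eq_mul, Nat.cast_add_choose ℂ]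
    have h1 : ((i + j).factorial : ℂ) ≠ 0 := Nat.cast_ne_zero.2 (Nat.factorial_ne_zero _)
    have h2 : (i.factorial : ℂ) ≠ 0 := Nat.cast_ne_zero.2 (Nat.factorial_ne_zero _)
    have h3 : (j.factorial : ℂ) ≠ 0 := Nat.cast_ne_zero.2 (Nat.factorial_ne_zero _)
    field_simp

theorem exists_polynomial_choose (k : ℕ) :
    ∃ P : Polynomial ℂ, ∀ j : ℕ, P.eval (j : ℂ) = (j.choose k : ℂ) := by
  refine ⟨Polynomial.C (k.factorial : ℂ)⁻¹ * descPochhammer ℂ k, fun j => ?_⟩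
  rw [Polynomial.eval_mul, Polynomial.eval_C, descPochhammer_eval_eq_descFactorial,
    Nat.descFactorial_eq_factorial_mul_choose, Nat.cast_mul,
    inv_mul_cancel_left₀ (Nat.cast_ne_zero.2 (Nat.factorial_ne_zero _))]

theorem exists_polynomial_pow (hA : IsGroupAlgebra e) {s : Set B}
    (hs : Algebra.adjoin ℂ s = ⊤) (g : Γ)
    (h : ∀ a ∈ s, ∃ k, (((hA.rTr g).toLinearMap - 1 : End ℂ B) ^ k) a = 0) (f : B) :
    ∃ P : Polynomial ℂ, ∀ j : ℕ, e (g ^ j) f = P.eval (j : ℂ) := by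
  have hf : f ∈ Algebra.adjoin ℂ s := hs ▸ Algebra.mem_top
  induction hf using Algebra.adjoin_induction with
  | algebraMap c => exact ⟨Polynomial.C c, fun j => by simp⟩
  | add a b _ _ ha hb =>
    obtain ⟨P, hP⟩ := ha
    obtain ⟨Q, hQ⟩ := hb
    exact ⟨P + Q, fun j => by simp [hP, hQ]⟩
  | mul a b _ _ ha hb =>
    obtain ⟨P, hP⟩ := ha
    obtain ⟨Q, hQ⟩ := hb
    exact ⟨P * Q, fun j => by simp [hP, hQ]⟩
  | mem f hf =>
    obtain ⟨d, hd⟩ := h f hf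
    choose P hP using exists_polynomial_choose
    let n : End ℂ B := (hA.rTr g).toLinearMap - 1
    refine ⟨∑ k ∈ Finset.range d, Polynomial.C (e 1 ((n ^ k) f)) * P k, fun j => ?_⟩
    have hpow : ∀ j : ℕ, hA.rTr (g ^ j) f = ((n + 1) ^ j) f := by
      intro j
      induction j with
      | zero => simpa using hA.rTr_one f
      | succ j ih =>
        rw [pow_succ', ← rTr_rTr, ih, pow_succ', Module.End.mul_apply]
        simp [n]
    have h1 : e (g ^ j) f = e 1 (hA.rTr (g ^ j) f) := by simp
    rw [h1, hpow, (Commute.one_right n).add_pow]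
    have h2 : ∀ k, d ≤ k → (n ^ k) f = 0 := by
      intro k hk
      obtain ⟨i, rfl⟩ := Nat.exists_eq_add_of_le' hk
      rw [pow_add, Module.End.mul_apply, hd, map_zero]
    simp only [one_pow, mul_one, LinearMap.sum_apply, map_sum, Polynomial.eval_finsetSum,
      Polynomial.eval_mul, Polynomial.eval_C, hP]
    have h3 : ∀ k, e 1 ((n ^ k * (j.choose k : End ℂ B)) f) =
        e 1 ((n ^ k) f) * (j.choose k : ℂ) := by
      intro k
      rw [Module.End.mul_apply, Module.End.natCast_apply, map_nsmul, map_nsmul, nsmul_eq_mul,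
        mul_comm]
    simp only [h3]
    rcases le_total d (j + 1) with hdj | hdj
    · refine (Finset.sum_subset (Finset.range_mono hdj) fun k _ hk => ?_).symm
      rw [h2 k (by simpa using hk), map_zero, zero_mul]
    · refine Finset.sum_subset (Finset.range_mono hdj) fun k _ hk => ?_
      rw [Nat.choose_eq_zero_of_lt (by simpa using hk)]
      simp

end IsGroupAlgebra

/-- A filtration of a finite-dimensional space has an adapted basis. -/
theorem exists_basis_of_filtration {E : Type*} [AddCommGroup E] [Module ℂ E]
    [FiniteDimensional ℂ E] (N : ℕ → Submodule ℂ E) (h0 : N 0 = ⊥) {d : ℕ} (hd : N d = ⊤) :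
    ∃ b : Basis (Fin (finrank ℂ E)) ℂ E, ∀ j, ∃ i, b j ∈ N (i + 1) ∧
      N i ≤ Submodule.span ℂ (b '' {k | k < j}) := by
  have key : ∀ m, m ≤ finrank ℂ E → ∃ b : Fin m → E, LinearIndependent ℂ b ∧
      ∀ j, ∃ i, b j ∈ N (i + 1) ∧ N i ≤ Submodule.span ℂ (b '' {k | k < j}) := by
    intro m
    induction m with
    | zero => exact fun _ => ⟨Fin.elim0, linearIndependent_empty_type, fun j => j.elim0⟩
    | succ m ih =>
      intro hm
      obtain ⟨b, hb, hbN⟩ := ih (by omega)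
      have hex : ∃ i, ¬ N i ≤ Submodule.span ℂ (Set.range b) := by
        refine ⟨d, fun h => ?_⟩
        rw [hd, top_le_iff] at h
        have := finrank_range_le_card (R := ℂ) b
        rw [Set.finrank, h, finrank_top, Fintype.card_fin] at this
        omega
      classical
      have hspec := Nat.find_spec hex
      obtain ⟨i, hi⟩ : ∃ i, Nat.find hex = i + 1 := by
        refine Nat.exists_eq_succ_of_ne_zero fun h => ?_
        rw [h, h0] at hspec
        exact hspec bot_le
      rw [hi] at hspec
      have hi' : N i ≤ Submodule.span ℂ (Set.range b) := by
        by_contra hcon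
        exact Nat.find_min hex (by omega : i < Nat.find hex) hcon
      obtain ⟨v, hv, hvs⟩ := SetLike.not_le_iff_exists.1 hspec
      refine ⟨Fin.snoc b v, linearIndependent_finSnoc.2 ⟨hb, hvs⟩, fun j => ?_⟩
      induction j using Fin.lastCases with
      | last =>
        refine ⟨i, by simpa using hv, hi'.trans (Submodule.span_mono ?_)⟩
        rintro _ ⟨k, rfl⟩
        exact ⟨k.castSucc, Fin.castSucc_lt_last k, by simp⟩
      | cast j =>
        obtain ⟨i, h1, h2⟩ := hbN j
        refine ⟨i, by simpa using h1, h2.trans (Submodule.span_mono ?_)⟩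
        rintro _ ⟨k, hk, rfl⟩
        exact ⟨k.castSucc, Fin.castSucc_lt_castSucc_iff.2 hk, by simp⟩
  obtain ⟨b, hb, hbN⟩ := key _ le_rfl
  rcases Nat.eq_zero_or_pos (finrank ℂ E) with h | h
  · exact ⟨finBasis ℂ E, fun j => absurd j.2 (by omega)⟩
  · have : Nonempty (Fin (finrank ℂ E)) := ⟨⟨0, h⟩⟩
    refine ⟨basisOfLinearIndependentOfCardEqFinrank hb (by simp), ?_⟩
    simpa using hbN

/-- The group has no nontrivial connected unipotent closed normal subgroup. -/
def HasTrivialUnipotentRadical {Γ B : Type*} [Group Γ] [CommRing B] [Algebra ℂ B]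
    (e : Γ → B →ₐ[ℂ] ℂ) : Prop :=
  ∀ K : Subgroup Γ, K.Normal → (∃ S : Set B, (K : Set Γ) = zeroSet e S) →
    IsZariskiConnected e (K : Set Γ) → ∀ (m : ℕ) (M : Fin m → Fin m → B),
    (∀ g h i j, e (g * h) (M i j) = ∑ k, e g (M i k) * e h (M k j)) →
    (∀ g ∈ K, ∀ i, e g (M i i) = 1) → (∀ g ∈ K, ∀ i j, j < i → e g (M i j) = 0) →
    (∀ g ∈ K, ∀ h ∈ K, (∀ i j, e g (M i j) = e h (M i j)) → g = h) → K = ⊥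

namespace IsGroupAlgebra

variable {Γ B : Type*} [Group Γ] [CommRing B] [Algebra ℂ B] {e : Γ → B →ₐ[ℂ] ℂ}

/-- The subgroup acting trivially on the graded pieces of a stable filtration. -/
def filtrationKernel (hA : IsGroupAlgebra e) (N : ℕ → Submodule ℂ B)
    (hN : ∀ i g, ∀ v ∈ N i, hA.rTr g v ∈ N i) : Subgroup Γ where
  carrier := {g | ∀ i, ∀ v ∈ N (i + 1), hA.rTr g v - v ∈ N i}
  one_mem' i v _ := by simp [rTr_one]
  mul_mem' {g h} hg hh i v hv := by
    rw [← rTr_rTr, ← sub_add_sub_cancel _ (hA.rTr g v), ← map_sub]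
    exact (N i).add_mem (hN i g _ (hh i v hv)) (hg i v hv)
  inv_mem' {g} hg i v hv := by
    have h1 := (N i).neg_mem (hN i g⁻¹ _ (hg i v hv))
    rwa [map_sub, rTr_rTr, inv_mul_cancel, rTr_one, neg_sub] at h1

theorem filtrationKernel_normal (hA : IsGroupAlgebra e) {N : ℕ → Submodule ℂ B}
    {hN : ∀ i g, ∀ v ∈ N i, hA.rTr g v ∈ N i} : (hA.filtrationKernel N hN).Normal where
  conj_mem g hg h i v hv := by
    have h1 := hN i h _ (hg i _ (hN _ h⁻¹ v hv))
    rwa [map_sub, rTr_rTr, rTr_rTr, rTr_rTr, mul_inv_cancel, rTr_one] at h1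

theorem mem_filtrationKernel_iff (hA : IsGroupAlgebra e) {N : ℕ → Submodule ℂ B}
    {hN : ∀ i g, ∀ v ∈ N i, hA.rTr g v ∈ N i} {g : Γ} :
    g ∈ hA.filtrationKernel N hN ↔ ∀ i, ∀ v ∈ N (i + 1), ∀ φ : B →ₗ[ℂ] ℂ,
      N i ≤ LinearMap.ker φ → φ (hA.rTr g v) = φ v := by
  refine ⟨fun h i v hv φ hφ => ?_, fun h i v hv => ?_⟩
  · have : φ (hA.rTr g v - v) = 0 := hφ (h i v hv)
    rwa [map_sub, sub_eq_zero] at this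
  · by_contra hn
    obtain ⟨φ, hφ, hφN⟩ := Submodule.exists_le_ker_of_notMem hn
    exact hφ (by rw [map_sub, h i v hv φ hφN, sub_self])

theorem filtrationKernel_closed (hA : IsGroupAlgebra e) {N : ℕ → Submodule ℂ B}
    {hN : ∀ i g, ∀ v ∈ N i, hA.rTr g v ∈ N i} :
    ∃ S : Set B, (hA.filtrationKernel N hN : Set Γ) = zeroSet e S := by
  choose c hc _ using hA.exists_coefficient
  refine ⟨{F | ∃ i, ∃ v ∈ N (i + 1), ∃ φ : B →ₗ[ℂ] ℂ, N i ≤ LinearMap.ker φ ∧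
    F = c φ v - algebraMap ℂ B (φ v)}, Set.ext fun g => ?_⟩
  rw [SetLike.mem_coe, mem_filtrationKernel_iff]
  constructor
  · rintro h _ ⟨i, v, hv, φ, hφ, rfl⟩
    rw [map_sub, hc, h i v hv φ hφ, AlgHom.commutes]
    simp
  · intro h i v hv φ hφ
    have := h _ ⟨i, v, hv, φ, hφ, rfl⟩
    rw [map_sub, hc, AlgHom.commutes, sub_eq_zero] at this
    simpa using this

theorem pow_sub_one_eq_zero (hA : IsGroupAlgebra e) {N : ℕ → Submodule ℂ B} (h0 : N 0 = ⊥)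
    {hN : ∀ i g, ∀ v ∈ N i, hA.rTr g v ∈ N i} {g : Γ} (hg : g ∈ hA.filtrationKernel N hN) (d : ℕ) :
    ∀ v ∈ N d, (((hA.rTr g).toLinearMap - 1 : End ℂ B) ^ d) v = 0 := by
  induction d with
  | zero => intro v hv; simpa [h0] using hv
  | succ d ih =>
    intro v hv
    rw [pow_succ, Module.End.mul_apply]
    exact ih _ (hg d v hv)

theorem filtrationKernel_connected (hA : IsGroupAlgebra e) {N : ℕ → Submodule ℂ B}
    (h0 : N 0 = ⊥) {hN : ∀ i g, ∀ v ∈ N i, hA.rTr g v ∈ N i} {d : ℕ}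
    (hd : Algebra.adjoin ℂ (N d : Set B) = ⊤) :
    IsZariskiConnected e (hA.filtrationKernel N hN : Set Γ) := by
  have key : ∀ S T : Set B, (hA.filtrationKernel N hN : Set Γ) ⊆ zeroSet e S ∪ zeroSet e T →
      (1 : Γ) ∉ zeroSet e T → (hA.filtrationKernel N hN : Set Γ) ⊆ zeroSet e S := by
    intro S T hST h1 g hg s hs
    have hpoly := hA.exists_polynomial_pow hd g
      fun v hv => ⟨d, hA.pow_sub_one_eq_zero h0 hg d v hv⟩
    simp only [zeroSet, Set.mem_ofPred_eq, not_forall] at h1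
    obtain ⟨t, ht, ht1⟩ := h1
    obtain ⟨P, hP⟩ := hpoly s
    obtain ⟨Q, hQ⟩ := hpoly t
    have hPQ : P * Q = 0 := by
      refine Polynomial.eq_zero_of_infinite_isRoot _ (Set.Infinite.mono ?_
        (Set.infinite_range_of_injective (Nat.cast_injective (R := ℂ))))
      rintro _ ⟨j, rfl⟩
      rw [Set.mem_ofPred_eq, Polynomial.IsRoot, Polynomial.eval_mul, ← hP, ← hQ]
      rcases hST (pow_mem hg j) with h | h
      · rw [h s hs, zero_mul]
      · rw [h t ht, mul_zero]
    rcases mul_eq_zero.1 hPQ with h | h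
    · have := hP 1
      rwa [pow_one, h, Polynomial.eval_zero] at this
    · have := hQ 0
      rw [pow_zero, h, Polynomial.eval_zero] at this
      exact absurd this ht1
  intro S T hST hdisj
  by_cases h1 : (1 : Γ) ∈ zeroSet e T
  · refine Or.inr (key T S (by rwa [Set.union_comm]) fun h => ?_)
    have : (1 : Γ) ∈ (∅ : Set Γ) := hdisj ▸ ⟨one_mem _, h, h1⟩
    exact this
  · exact Or.inl (key S T hST h1)

theorem filtrationKernel_eq_bot (hA : IsGroupAlgebra e) (hred : HasTrivialUnipotentRadical e)
    {N : ℕ → Submodule ℂ B} (h0 : N 0 = ⊥) {hN : ∀ i g, ∀ v ∈ N i, hA.rTr g v ∈ N i} {d : ℕ}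
    (hfd : FiniteDimensional ℂ (N d)) (hd : Algebra.adjoin ℂ (N d : Set B) = ⊤) :
    hA.filtrationKernel N hN = ⊥ := by
  let W := N d
  obtain ⟨b, hb⟩ := exists_basis_of_filtration (E := W) (fun i => (N i).comap W.subtype)
    (by simp [h0]) (d := d) (by simp [W])
  have hφ : ∀ i, ∃ φ : B →ₗ[ℂ] ℂ, φ.comp W.subtype = b.coord i := fun i =>
    LinearMap.exists_extend _
  choose φ hφ using hφ
  have hφ' : ∀ i (w : W), φ i w = b.repr w i := fun i w => LinearMap.congr_fun (hφ i) w
  choose c hc _ using hA.exists_coefficient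
  have hM : ∀ g i j, e g (c (φ i) (b j)) = b.repr ⟨hA.rTr g (b j), hN d g _ (b j).2⟩ i :=
    fun g i j => by rw [hc, ← hφ']
  have hexp : ∀ g j, hA.rTr g (b j) = ∑ k, e g (c (φ k) (b j)) • (b k : B) := by
    intro g j
    have := congrArg Subtype.val (b.sum_repr ⟨hA.rTr g (b j), hN d g _ (b j).2⟩)
    rw [AddSubmonoidClass.coe_finsetSum] at this
    rw [← show _ = hA.rTr g (b j) from this]
    exact Finset.sum_congr rfl fun k _ => by rw [hM, Submodule.coe_smul]
  have htri : ∀ g ∈ hA.filtrationKernel N hN, ∀ j,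
      (⟨hA.rTr g (b j), hN d g _ (b j).2⟩ : W) - b j ∈ Submodule.span ℂ (b '' {k | k < j}) := by
    intro g hg j
    obtain ⟨i, h1, h2⟩ := hb j
    exact h2 (hg i _ h1)
  have hspan : ∀ (i j) (w : W), j ≤ i → w ∈ Submodule.span ℂ (b '' {k | k < j}) →
      b.repr w i = 0 := by
    intro i j w hij hw
    rw [Basis.mem_span_image] at hw
    by_contra hne
    exact absurd (hw (Finsupp.mem_support_iff.2 hne)) (not_lt.2 hij)
  refine hred _ hA.filtrationKernel_normal hA.filtrationKernel_closed
    (hA.filtrationKernel_connected h0 hd) _ (fun i j => c (φ i) (b j)) ?_ ?_ ?_ ?_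
  · intro g h i j
    rw [hc, ← rTr_rTr, hexp h j, map_sum, map_sum]
    refine Finset.sum_congr rfl fun k _ => ?_
    rw [map_smul, map_smul, hc (φ i), smul_eq_mul, mul_comm]
  · intro g hg i
    have := hspan i i _ le_rfl (htri g hg i)
    rw [map_sub, Finsupp.sub_apply, sub_eq_zero] at this
    rw [hM, this]
    simp
  · intro g hg i j hij
    have := hspan i j _ hij.le (htri g hg j)
    rw [map_sub, Finsupp.sub_apply, sub_eq_zero] at this
    rw [hM, this, Basis.repr_self, Finsupp.single_eq_of_ne (ne_of_gt hij)]
  · intro g _ h _ hgh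
    refine hA.injective (AlgHom.ext_of_adjoin_eq_top hd fun w hw => ?_)
    have h1 : ∀ w : W, hA.rTr g w = hA.rTr h w := by
      intro w
      have : (hA.rTr g).toLinearMap.comp W.subtype = (hA.rTr h).toLinearMap.comp W.subtype :=
        b.ext fun j => by
          change hA.rTr g (b j) = hA.rTr h (b j)
          rw [hexp, hexp]
          simp only [hgh]
      exact LinearMap.congr_fun this w
    have h2 := congrArg (e 1) (h1 ⟨w, hw⟩)
    simpa using h2

end IsGroupAlgebra

namespace IsGroupAlgebra

variable {Γ B : Type*} [Group Γ] [CommRing B] [Algebra ℂ B] {e : Γ → B →ₐ[ℂ] ℂ}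

/-- The ascending filtration of `W` by the vectors successively killed by `𝔠`. -/
def ascending (hA : IsGroupAlgebra e) (W : Submodule ℂ B) (𝔠 : Submodule ℂ hA.lie) :
    ℕ → Submodule ℂ B
  | 0 => ⊥
  | i + 1 => W ⊓ ⨅ x : 𝔠, (hA.ascending W 𝔠 i).comap (x.1.1 : B →ₗ[ℂ] B)

theorem mem_ascending_succ (hA : IsGroupAlgebra e) {W : Submodule ℂ B} {𝔠 : Submodule ℂ hA.lie}
    {i : ℕ} {v : B} : v ∈ hA.ascending W 𝔠 (i + 1) ↔
      v ∈ W ∧ ∀ x ∈ 𝔠, x.1 v ∈ hA.ascending W 𝔠 i := by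
  simp [ascending, Submodule.mem_iInf]

theorem ascending_mono (hA : IsGroupAlgebra e) (W : Submodule ℂ B) (𝔠 : Submodule ℂ hA.lie) :
    Monotone (hA.ascending W 𝔠) := by
  refine monotone_nat_of_le_succ fun i => ?_
  induction i with
  | zero => exact bot_le
  | succ i ih =>
    intro v hv
    rw [mem_ascending_succ] at hv ⊢
    exact ⟨hv.1, fun x hx => ih (hv.2 x hx)⟩

theorem ascending_le (hA : IsGroupAlgebra e) (W : Submodule ℂ B) (𝔠 : Submodule ℂ hA.lie)
    (i : ℕ) : hA.ascending W 𝔠 i ≤ W := by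
  cases i with
  | zero => exact bot_le
  | succ i => exact fun v hv => (hA.mem_ascending_succ.1 hv).1

theorem lie_apply_mem_ascending (hA : IsGroupAlgebra e) {W : Submodule ℂ B}
    (hW : ∀ D : hA.lie, ∀ f ∈ W, D.1 f ∈ W) {𝔠 : Submodule ℂ hA.lie}
    (h𝔠 : ∀ x : hA.lie, ∀ y ∈ 𝔠, ⁅x, y⁆ ∈ 𝔠) (D : hA.lie) (i : ℕ) :
    ∀ v ∈ hA.ascending W 𝔠 i, D.1 v ∈ hA.ascending W 𝔠 i := by
  induction i with
  | zero => intro v hv; rw [show v = 0 from hv, map_zero]; exact Submodule.zero_mem _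
  | succ i ih =>
    intro v hv
    rw [mem_ascending_succ] at hv ⊢
    refine ⟨hW D v hv.1, fun x hx => ?_⟩
    have h1 : x.1 (D.1 v) = D.1 (x.1 v) - (⁅D, x⁆ : hA.lie).1 v := by
      rw [LieSubalgebra.coe_bracket, Derivation.commutator_apply]
      abel
    rw [h1]
    exact Submodule.sub_mem _ (ih _ (hv.2 x hx)) (hv.2 _ (h𝔠 D x hx))

theorem exists_ascending_eq (hA : IsGroupAlgebra e) {W : Submodule ℂ B} [FiniteDimensional ℂ W]
    (hW : ∀ D : hA.lie, ∀ f ∈ W, D.1 f ∈ W) {𝔠 : Submodule ℂ hA.lie}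
    (h𝔠 : ∀ x : hA.lie, ∀ y ∈ 𝔠, ⁅x, y⁆ ∈ 𝔠)
    (hnil : ∀ x ∈ 𝔠, IsNilpotent (hA.lieRep W hW x)) : ∃ d, hA.ascending W 𝔠 d = W := by
  let N : ℕ →o Submodule ℂ W := ⟨fun i => (hA.ascending W 𝔠 i).comap W.subtype,
    fun i j hij => Submodule.comap_mono (hA.ascending_mono W 𝔠 hij)⟩
  obtain ⟨d, hd⟩ := monotone_stabilizes_iff_noetherian.2 (inferInstance : IsNoetherian ℂ W) N
  refine ⟨d, le_antisymm (hA.ascending_le W 𝔠 d) ?_⟩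
  by_contra hne
  let 𝔰 : LieSubalgebra ℂ hA.lie := { 𝔠 with lie_mem' := fun {x y} _ hy => h𝔠 x y hy }
  obtain ⟨v, hv, hv'⟩ := exists_notMem_forall_apply_mem_of_isNilpotent (𝔤 := 𝔰) (E := W)
    ((hA.lieRep W hW).comp 𝔰.incl) (fun x => hnil x.1 x.2) (N d) (by
      intro h
      refine hne fun w hw => ?_
      have : (⟨w, hw⟩ : W) ∈ N d := h ▸ Submodule.mem_top
      exact this)
  refine hv ?_
  rw [hd (d + 1) (Nat.le_succ d)]
  exact hA.mem_ascending_succ.2 ⟨v.2, fun x hx => hv' ⟨x, hx⟩⟩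

/-- In a reductive group, ideals of the Lie algebra acting nilpotently vanish. -/
theorem eq_bot_of_isNilpotent (hA : IsGroupAlgebra e) (hconn : IsZariskiConnected e Set.univ)
    (hred : HasTrivialUnipotentRadical e) {W : Submodule ℂ B} [FiniteDimensional ℂ W]
    (hgen : Algebra.adjoin ℂ (W : Set B) = ⊤)
    (hW : ∀ D : hA.lie, ∀ f ∈ W, D.1 f ∈ W) {𝔠 : Submodule ℂ hA.lie}
    (h𝔠 : ∀ x : hA.lie, ∀ y ∈ 𝔠, ⁅x, y⁆ ∈ 𝔠)
    (hnil : ∀ x ∈ 𝔠, IsNilpotent (hA.lieRep W hW x)) : 𝔠 = ⊥ := by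
  obtain ⟨d, hd⟩ := hA.exists_ascending_eq hW h𝔠 hnil
  let N := hA.ascending W 𝔠
  have hN : ∀ i g, ∀ v ∈ N i, hA.rTr g v ∈ N i := fun i g v hv =>
    hA.rTr_apply_mem hconn (fun D f hf => hA.lie_apply_mem_ascending hW h𝔠 D i f hf) g hv
  have hdW : N d = W := hd
  have hK : hA.filtrationKernel N hN = ⊥ :=
    hA.filtrationKernel_eq_bot hred rfl (d := d) (by rw [hdW]; infer_instance) (by rwa [hdW])
  refine (Submodule.eq_bot_iff _).2 fun x hx => ?_
  have hpow : ∀ i k, ∀ v ∈ N (i + 1), x.1^[k + 1] v ∈ N i := by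
    intro i k
    induction k with
    | zero => exact fun v hv => (hA.mem_ascending_succ.1 hv).2 x hx
    | succ k ih =>
      intro v hv
      rw [Function.iterate_succ_apply']
      exact hA.lie_apply_mem_ascending hW h𝔠 x i _ (ih v hv)
  have hzero : ∀ i, ∀ v ∈ N i, x.1^[i] v = 0 := by
    intro i
    induction i with
    | zero => exact fun v hv => hv
    | succ i ih =>
      intro v hv
      rw [Function.iterate_succ_apply]
      exact ih _ ((hA.mem_ascending_succ.1 hv).2 x hx)
  have hloc := x.1.exists_iterate_eq_zero hgen fun w hw => ⟨d, hzero d w (hdW ▸ hw)⟩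
  obtain ⟨Φ, hΦ⟩ := exists_oneParameter (e 1) x.1 hloc
  have hu : ∀ t : ℂ, (Polynomial.aeval t).comp Φ = e 1 := by
    intro t
    obtain ⟨u, hu⟩ := hA.exists_eval ((Polynomial.aeval t).comp Φ)
    have huK : u ∈ hA.filtrationKernel N hN := by
      rw [mem_filtrationKernel_iff]
      intro i v hv φ hφ
      obtain ⟨c, hc, hcD⟩ := hA.exists_coefficient φ
      have hck : ∀ (k : ℕ) w, x.1^[k] (c w) = c (x.1^[k] w) := by
        intro k
        induction k with
        | zero => exact fun _ => rfl
        | succ k ih => intro w; rw [Function.iterate_succ_apply, hcD, ih,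
            Function.iterate_succ_apply]
      have hΦc : Φ (c v) = Polynomial.C (φ v) := by
        ext k
        rw [hΦ, hck, hc, rTr_one, Polynomial.coeff_C]
        rcases k with _ | k
        · simp
        · rw [show φ _ = 0 from hφ (hpow i k v hv)]
          simp
      rw [← hc, hu, AlgHom.comp_apply, hΦc]
      simp
    rw [hK, Subgroup.mem_bot] at huK
    rw [← hu, huK]
  have hx0 : ∀ f, e 1 (x.1 f) = 0 := by
    intro f
    have h1 : Φ f = Polynomial.C (e 1 f) := by
      refine Polynomial.funext fun t => ?_
      rw [Polynomial.eval_C, ← hu t]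
      simp [Polynomial.coe_aeval_eq_eval]
    have h2 := hΦ f 1
    rw [h1, Polynomial.coeff_C] at h2
    simpa using h2.symm
  refine Subtype.ext (Derivation.ext fun f => hA.ext fun g => ?_)
  rw [lie_apply_apply, hx0]
  simp

/-- The action of the Lie algebra on a quotient of a stable subspace. -/
def lieRepQuot (hA : IsGroupAlgebra e) (W : Submodule ℂ B)
    (hW : ∀ D : hA.lie, ∀ f ∈ W, D.1 f ∈ W) (S : Submodule ℂ W)
    (hS : ∀ D : hA.lie, S ≤ S.comap (hA.lieRep W hW D)) : hA.lie →ₗ⁅ℂ⁆ End ℂ (W ⧸ S) where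
  toFun D := S.mapQ S (hA.lieRep W hW D) (hS D)
  map_add' _ _ := Submodule.linearMap_qext _ rfl
  map_smul' _ _ := Submodule.linearMap_qext _ rfl
  map_lie' := Submodule.linearMap_qext _ rfl

/-- The constants are not sums of derivatives along the Lie algebra. -/
theorem one_notMem_lie_range (hA : IsGroupAlgebra e) (hconn : IsZariskiConnected e Set.univ)
    (hred : HasTrivialUnipotentRadical e) :
    (1 : B) ∉ Submodule.span ℂ {F | ∃ (D : hA.lie) (f : B), F = D.1 f} := by
  classical
  intro h1
  have := hA.finiteDimensional_lie
  obtain ⟨V, hVfd, hVgen, hVst⟩ := hA.exists_generating_rTr_stable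
  have hV : ∀ D : hA.lie, ∀ f ∈ V, D.1 f ∈ V := fun D f hf => hA.lie_apply_mem hVst D hf
  obtain ⟨t, ht, h1t⟩ := Submodule.mem_span_finite_of_mem_span h1
  have ht' : ∀ F ∈ t, ∃ (D : hA.lie) (f : B), F = D.1 f := ht
  choose! D f hDf using ht'
  obtain ⟨W, hWfd, hsW, hWst⟩ :=
    hA.exists_finiteDimensional_rTr_stable (insert 1 (t.image f))
  have hW : ∀ D : hA.lie, ∀ f ∈ W, D.1 f ∈ W := fun D f hf => hA.lie_apply_mem hWst D hf
  let w : W := ⟨1, hsW (by simp)⟩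
  have hw : w ∈ Submodule.span ℂ {F | ∃ (D : hA.lie) (f : W), F = hA.lieRep W hW D f} := by
    have h2 : (1 : B) ∈ (Submodule.span ℂ
        {F | ∃ (D : hA.lie) (f : W), F = hA.lieRep W hW D f}).map W.subtype := by
      refine Submodule.span_le.2 (fun F hF => ?_) h1t
      have hfF : f F ∈ W := hsW (by simpa using Or.inr ⟨F, hF, rfl⟩)
      exact ⟨hA.lieRep W hW (D F) ⟨f F, hfF⟩, Submodule.subset_span ⟨D F, ⟨f F, hfF⟩, rfl⟩,
        (hDf F hF).symm⟩
    obtain ⟨w', hw', h⟩ := h2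
    rwa [show w = w' from Subtype.ext h.symm]
  obtain ⟨S, hSmax⟩ := (set_has_maximal_iff_noetherian.2 (inferInstance : IsNoetherian ℂ W))
    {S : Submodule ℂ W | (∀ D : hA.lie, S ≤ S.comap (hA.lieRep W hW D)) ∧ w ∉ S}
    ⟨⊥, fun D v hv => by rw [show v = 0 from hv]; exact Submodule.zero_mem _, fun h0 => by
      have h3 : (1 : B) = 0 := congrArg Subtype.val (show w = 0 from h0)
      have h4 := congrArg (e 1) h3
      simp at h4⟩
  obtain ⟨⟨hS, hwS⟩, hmax⟩ := hSmax
  have key := apply_eq_zero_of_essential (hA.lieRep V hV) (hA.lieRepQuot W hW S hS)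
    (fun 𝔠 h𝔠 hnil => hA.eq_bot_of_isNilpotent hconn hred hVgen hV h𝔠 hnil) ?_ (S.mkQ w) ?_ ?_ ?_
  · refine hwS (Submodule.span_le.2 ?_ hw)
    rintro _ ⟨D, f, rfl⟩
    exact (Submodule.Quotient.mk_eq_zero S).1 (key D (S.mkQ f))
  · intro x r
    obtain ⟨y, hy⟩ := hA.exists_lie_isReplica x r
    refine ⟨y, hy.map (i := V.subtype) Subtype.val_injective (fun _ => rfl) (fun _ => rfl), ?_⟩
    have hyW : IsReplica r (hA.lieRep W hW x) (hA.lieRep W hW y) :=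
      hy.map (i := W.subtype) Subtype.val_injective (fun _ => rfl) (fun _ => rfl)
    exact hyW.of_surjective (π := S.mkQ) S.mkQ_surjective (fun _ => rfl) (fun _ => rfl)
  · rwa [Ne, Submodule.mkQ_apply, Submodule.Quotient.mk_eq_zero]
  · intro x
    have h0 : hA.lieRep W hW x w = 0 := Subtype.ext (x.1.map_one_eq_zero)
    change S.mkQ (hA.lieRep W hW x w) = 0
    rw [h0, map_zero]
  · intro N hN hN0
    by_contra hwN
    refine hmax (N.comap S.mkQ) ⟨fun D v hv => hN D _ hv, hwN⟩ ?_
    refine lt_of_le_of_ne (fun v hv => ?_) fun heq => hN0 ?_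
    · change S.mkQ v ∈ N
      rw [show S.mkQ v = 0 from (Submodule.Quotient.mk_eq_zero S).2 hv]
      exact N.zero_mem
    · rw [← Submodule.map_comap_eq_of_surjective S.mkQ_surjective N, ← heq,
        Submodule.mkQ_map_self]

/-- A connected reductive group has an invariant integral. -/
theorem exists_integral (hA : IsGroupAlgebra e) (hconn : IsZariskiConnected e Set.univ)
    (hred : HasTrivialUnipotentRadical e) :
    ∃ I : B →ₗ[ℂ] ℂ, I 1 = 1 ∧ ∀ g f, I (hA.lTr g f) = I f := by
  obtain ⟨φ, hφ, hφ0⟩ := Submodule.exists_le_ker_of_notMem (hA.one_notMem_lie_range hconn hred)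
  obtain ⟨c, hc, hcD⟩ := hA.exists_coefficient φ
  have hinv : ∀ g f, φ (hA.rTr g f) = φ f := by
    intro g f
    have h0 : ∀ (D : hA.lie) f, φ (D.1 f) = 0 := fun D f =>
      hφ0 (Submodule.subset_span ⟨D, f, rfl⟩)
    let E : B →ₗ[ℂ] B := c - (Algebra.linearMap ℂ B).comp φ
    have hE : ∀ f, E f = c f - algebraMap ℂ B (φ f) := fun _ => rfl
    have h1 := hA.eq_zero_of_lie_stable hconn (C := LinearMap.range E) ?_ ?_ (E f) ⟨f, rfl⟩
    · have h2 := congrArg (e g) h1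
      rw [hE, map_sub, hc, AlgHom.commutes, map_zero, sub_eq_zero] at h2
      simpa using h2
    · rintro D _ ⟨f, rfl⟩
      refine ⟨D.1 f, ?_⟩
      rw [hE, hE, h0, map_zero, sub_zero, map_sub, hcD, Derivation.map_algebraMap, sub_zero]
    · rintro _ ⟨f, rfl⟩
      rw [hE, map_sub, hc, rTr_one, AlgHom.commutes]
      simp
  choose s hs using hA.antipode
  let σ : B →ₗ[ℂ] B :=
    { toFun := s
      map_add' := fun a b => hA.ext fun g => by simp [hs]
      map_smul' := fun c a => hA.ext fun g => by simp [hs] }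
  let I : B →ₗ[ℂ] ℂ := φ.comp σ
  have hI : ∀ f, I f = φ (s f) := fun _ => rfl
  have hs1 : s 1 = 1 := hA.ext fun g => by simp [hs]
  have hφ1 : φ 1 ≠ 0 := hφ
  refine ⟨(φ 1)⁻¹ • I, ?_, fun g f => ?_⟩
  · rw [LinearMap.smul_apply, hI, hs1, smul_eq_mul, inv_mul_cancel₀ hφ1]
  · have h2 : s (hA.lTr g f) = hA.rTr g⁻¹ (s f) := hA.ext fun x => by simp [hs]
    rw [LinearMap.smul_apply, LinearMap.smul_apply, hI, hI, h2, hinv]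

end IsGroupAlgebra

end

section

open Module TensorProduct

/-- Weak Nullstellensatz for finitely generated algebras. -/
theorem exists_algHom_ker_eq {B : Type*} [CommRing B] [Algebra ℂ B] [Algebra.FiniteType ℂ B]
    (M : Ideal B) [hM : M.IsMaximal] : ∃ χ : B →ₐ[ℂ] ℂ, RingHom.ker χ = M := by
  let _ : Field (B ⧸ M) := Ideal.Quotient.field M
  have : Module.Finite ℂ (B ⧸ M) := finite_of_finite_type_of_isJacobsonRing ℂ (B ⧸ M)
  have hb : Function.Bijective (algebraMap ℂ (B ⧸ M)) :=
    IsAlgClosed.algebraMap_bijective_of_isIntegral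
  let φ : ℂ ≃ₐ[ℂ] (B ⧸ M) := AlgEquiv.ofBijective (Algebra.ofId ℂ (B ⧸ M)) hb
  refine ⟨φ.symm.toAlgHom.comp (Ideal.Quotient.mkₐ ℂ M), ?_⟩
  ext b
  simp [RingHom.mem_ker, Ideal.Quotient.eq_zero_iff_mem]

/-- Strong Nullstellensatz for finitely generated algebras. -/
theorem isNilpotent_of_forall_algHom {B : Type*} [CommRing B] [Algebra ℂ B]
    [Algebra.FiniteType ℂ B] {b : B} (h : ∀ χ : B →ₐ[ℂ] ℂ, χ b = 0) : IsNilpotent b := by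
  have := isJacobsonRing_of_finiteType (A := ℂ) (B := B)
  rw [← mem_nilradical, nilradical,
    ← (isJacobsonRing_iff.1 this) _ (Ideal.radical_isRadical (0 : Ideal B))]
  refine Ideal.mem_sInf.2 fun {M} hM => ?_
  have := hM.2
  obtain ⟨χ, hχ⟩ := exists_algHom_ker_eq M
  rw [← hχ]
  exact h χ

namespace IsGroupAlgebra

variable {Γ B : Type*} [Group Γ] [CommRing B] [Algebra ℂ B] {e : Γ → B →ₐ[ℂ] ℂ}

theorem isReduced (hA : IsGroupAlgebra e) : IsReduced B where
  eq_zero b hb := hA.ext fun g => by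
    rw [map_zero]
    exact (hb.map (e g)).eq_zero

/-- The coordinate algebra of a connected group is a domain. -/
theorem isDomain (hA : IsGroupAlgebra e) (hconn : IsZariskiConnected e Set.univ) :
    IsDomain B := by
  have := hA.finiteType
  have := hA.isReduced
  have : IsNoetherianRing B := Algebra.FiniteType.isNoetherianRing ℂ B
  have hnt : Nontrivial B := (e 1).toRingHom.domain_nontrivial
  obtain ⟨P, hP⟩ := Ideal.nonempty_minimalPrimes (I := (⊥ : Ideal B)) bot_ne_top
  have hfin : (minimalPrimes B).Finite := minimalPrimes.finite_of_isNoetherianRing B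
  have hPp : P.IsPrime := hP.1.1
  let s := hfin.toFinset.erase P
  have hs : ∀ Q, Q ∈ s ↔ Q ≠ P ∧ Q ∈ minimalPrimes B := by simp [s]
  obtain ⟨f, hf, hfP⟩ : ∃ f ∈ s.inf id, f ∉ P := by
    by_contra! hcon
    obtain ⟨Q, hQ, hQP⟩ := (Ideal.IsPrime.inf_le' hPp).1 (show s.inf id ≤ P from hcon)
    exact ((hs Q).1 hQ).1 (le_antisymm hQP (hP.2 ((hs Q).1 hQ).2.1 hQP))
  have hfQ : ∀ Q ∈ minimalPrimes B, Q ≠ P → f ∈ Q := fun Q hQ hQP =>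
    (Finset.inf_le (f := id) ((hs Q).2 ⟨hQP, hQ⟩) : s.inf id ≤ Q) hf
  obtain ⟨g₀, hg₀, hfg⟩ : ∃ g₀, (∀ a ∈ P, e g₀ a = 0) ∧ e g₀ f ≠ 0 := by
    by_contra! hcon
    have : IsNilpotent (Ideal.Quotient.mk P f) := by
      refine isNilpotent_of_forall_algHom fun χ => ?_
      obtain ⟨g, hg⟩ := hA.exists_eval (χ.comp (Ideal.Quotient.mkₐ ℂ P))
      have h1 : ∀ a, e g a = χ (Ideal.Quotient.mk P a) := fun a => by rw [hg]; rfl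
      rw [← h1]
      exact hcon g fun a ha => by rw [h1, Ideal.Quotient.eq_zero_iff_mem.2 ha, map_zero]
    exact hfP (Ideal.Quotient.eq_zero_iff_mem.1 this.eq_zero)
  have huniq : ∀ g, ∀ Q ∈ minimalPrimes B, ∀ Q' ∈ minimalPrimes B,
      Q ≤ RingHom.ker (e g) → Q' ≤ RingHom.ker (e g) → Q = Q' := by
    intro g Q hQ Q' hQ' h h'
    have hinj : Function.Injective (hA.lTr (g₀ * g⁻¹)) :=
      Function.LeftInverse.injective (g := hA.lTr (g * g₀⁻¹)) fun f => hA.ext fun x => by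
        simp [mul_assoc]
    have hsurj : Function.Surjective (hA.lTr (g₀ * g⁻¹)) :=
      Function.RightInverse.surjective (g := hA.lTr (g * g₀⁻¹)) fun f => hA.ext fun x => by
        simp [mul_assoc]
    have key : ∀ Q ∈ minimalPrimes B, Q ≤ RingHom.ker (e g) →
        Q.comap (hA.lTr (g₀ * g⁻¹)) = P := by
      intro Q hQ hQg
      by_contra hne
      have hmem : Q.comap (hA.lTr (g₀ * g⁻¹)) ∈ minimalPrimes B := by
        have := Ideal.minimalPrimes_comap_of_surjective (f := (hA.lTr (g₀ * g⁻¹)).toRingHom)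
          hsurj hQ
        rwa [← RingHom.ker_eq_comap_bot,
          (RingHom.injective_iff_ker_eq_bot (hA.lTr (g₀ * g⁻¹)).toRingHom).1 hinj] at this
      refine hfg ?_
      have h1 : e g (hA.lTr (g₀ * g⁻¹) f) = 0 := hQg (hfQ _ hmem hne)
      simpa using h1
    exact Ideal.comap_injective_of_surjective _ hsurj ((key Q hQ h).trans (key Q' hQ' h').symm)
  have hker : ∀ g, (RingHom.ker (e g)).IsPrime := fun g => RingHom.ker_isPrime _
  have hcover : ∀ g, (∀ a ∈ P, e g a = 0) ∨ ∀ a ∈ s.inf id, e g a = 0 := by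
    intro g
    obtain ⟨Q, hQ, hQg⟩ := Ideal.exists_minimalPrimes_le (bot_le : ⊥ ≤ RingHom.ker (e g))
    by_cases h : Q = P
    · exact Or.inl fun a ha => hQg (h ▸ ha)
    · exact Or.inr fun a ha =>
        hQg ((Finset.inf_le (f := id) ((hs Q).2 ⟨h, hQ⟩) : s.inf id ≤ Q) ha)
  have hdisj : Set.univ ∩ (zeroSet e (P : Set B) ∩ zeroSet e (s.inf id : Ideal B)) = ∅ := by
    refine Set.eq_empty_iff_forall_notMem.2 ?_
    rintro g ⟨-, hg, hg'⟩
    obtain ⟨Q, hQ, hQg⟩ := (Ideal.IsPrime.inf_le' (hker g)).1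
      (show s.inf id ≤ RingHom.ker (e g) from hg')
    exact ((hs Q).1 hQ).1 (huniq g Q ((hs Q).1 hQ).2 P hP hQg hg)
  rcases hconn P (s.inf id : Ideal B) (fun g _ => hcover g) hdisj with h | h
  · have hP0 : P = ⊥ := (Submodule.eq_bot_iff P).2 fun a ha => hA.ext fun g => by
      rw [h (Set.mem_univ g) a ha, map_zero]
    subst hP0
    have : NoZeroDivisors B := ⟨fun h => by simpa using hPp.mem_or_mem (by simpa using h)⟩
    exact NoZeroDivisors.to_isDomain B
  · exact absurd (h (Set.mem_univ g₀) f hf) hfg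

end IsGroupAlgebra

theorem LinearIndependent.eq_zero_of_sum_tmul_eq_zero {K M N ι : Type*} [Field K]
    [AddCommGroup M] [Module K M] [AddCommGroup N] [Module K N] {v : ι → N}
    (hv : LinearIndependent K v) {s : Finset ι} {q : ι → M}
    (h : ∑ i ∈ s, q i ⊗ₜ[K] v i = 0) : ∀ i ∈ s, q i = 0 := by
  classical
  intro i hi
  obtain ⟨l, hl⟩ := LinearMap.exists_leftInverse_of_injective (Finsupp.linearCombination K v)
    (LinearMap.ker_eq_bot.2 hv)
  have hlv : ∀ j, l (v j) = Finsupp.single j 1 := fun j => by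
    have := LinearMap.congr_fun hl (Finsupp.single j 1)
    simpa using this
  have := congrArg (TensorProduct.rid K M ∘ (Finsupp.lapply i ∘ₗ l).lTensor M) h
  simpa [hlv, Finsupp.single_apply, hi] using this

theorem sum_coeff_tmul_pow {K E : Type*} [Field K] [Field E] [Algebra K E] (F : E)
    (q : Polynomial E) : Polynomial.aeval (1 ⊗ₜ[K] F : E ⊗[K] E) q =
      ∑ i ∈ Finset.range (q.natDegree + 1), q.coeff i ⊗ₜ[K] (F ^ i) := by
  rw [Polynomial.aeval_eq_sum_range]
  simp [Algebra.TensorProduct.tmul_pow, TensorProduct.smul_tmul']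

/-- In characteristic zero an element `F` of a field extension `E / K` lies in `K` as soon as its
two images in `E ⊗ E` differ by a nilpotent. -/
theorem mem_range_algebraMap_of_isNilpotent_tmul {K E : Type*} [Field K] [Field E] [Algebra K E]
    [CharZero K] {F : E} (h : IsNilpotent (F ⊗ₜ[K] (1 : E) - (1 : E) ⊗ₜ[K] F)) :
    F ∈ Set.range (algebraMap K E) := by
  obtain ⟨k, hk⟩ := h
  have hp : Polynomial.aeval (1 ⊗ₜ[K] F : E ⊗[K] E)
      ((Polynomial.C F - Polynomial.X) ^ k : Polynomial E) = 0 := by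
    rw [← hk]
    simp
  by_cases hF : IsAlgebraic K F
  · have hintegral := hF.isIntegral
    let μ := (minpoly K F).map (algebraMap K E)
    have hμ : μ.Monic := (minpoly.monic hintegral).map _
    have hd : μ.natDegree = (minpoly K F).natDegree := Polynomial.natDegree_map _
    have hdvd : μ ∣ (Polynomial.C F - Polynomial.X) ^ k := by
      rw [← Polynomial.modByMonic_eq_zero_iff_dvd hμ]
      set q := ((Polynomial.C F - Polynomial.X) ^ k) %ₘ μ with hq
      by_contra hq0
      have hdeg : q.natDegree < (minpoly K F).natDegree := by
        rw [← hd]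
        exact Polynomial.natDegree_modByMonic_lt _ hμ fun h1 => by
          have := minpoly.natDegree_pos hintegral
          rw [← hd, h1, Polynomial.natDegree_one] at this
          exact this.false
      have hq1 : Polynomial.aeval (1 ⊗ₜ[K] F : E ⊗[K] E) q = 0 := by
        have h1 := congrArg (Polynomial.aeval (1 ⊗ₜ[K] F : E ⊗[K] E))
          (Polynomial.modByMonic_add_div ((Polynomial.C F - Polynomial.X) ^ k) μ)
        have h2 : Polynomial.aeval (1 ⊗ₜ[K] F : E ⊗[K] E) μ = 0 := by
          rw [Polynomial.aeval_map_algebraMap]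
          have := Polynomial.aeval_algHom_apply
            (Algebra.TensorProduct.includeRight : E →ₐ[K] E ⊗[K] E) F (minpoly K F)
          simpa using this
        rwa [map_add, map_mul, h2, zero_mul, add_zero, hp] at h1
      rw [sum_coeff_tmul_pow, Finset.sum_range] at hq1
      have hli := (linearIndependent_pow (K := K) F).comp
        (Fin.castLE (Nat.succ_le_of_lt hdeg)) (Fin.castLE_injective _)
      have := LinearIndependent.eq_zero_of_sum_tmul_eq_zero hli hq1 (Fin.last _)
        (Finset.mem_univ _)
      exact hq0 (Polynomial.leadingCoeff_eq_zero.1 this)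
    have hk0 : k ≠ 0 := by
      rintro rfl
      have h1 := (minpoly.natDegree_pos hintegral).trans_eq hd.symm
      rw [pow_zero] at hdvd
      exact h1.ne' (Polynomial.natDegree_eq_zero_of_isUnit (isUnit_of_dvd_one hdvd))
    have hsf : Squarefree μ := ((minpoly.irreducible hintegral).separable.map).squarefree
    have h1 := (hsf.dvd_pow_iff_dvd hk0).1 hdvd
    have h2 := Polynomial.natDegree_le_of_dvd h1 (fun h0 => by
      simpa using congrArg (fun p => Polynomial.coeff p 1) h0)
    have h3 : (Polynomial.C F - Polynomial.X).natDegree ≤ 1 := by compute_degree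
    refine minpoly.natDegree_eq_one_iff.1 (le_antisymm ?_ (minpoly.natDegree_pos hintegral))
    rw [← hd]
    exact h2.trans h3
  · have hli : LinearIndependent K fun i : ℕ => F ^ i := by
      have := (Polynomial.basisMonomials K).linearIndependent.map'
        (Polynomial.aeval F : Polynomial K →ₐ[K] E).toLinearMap
        (LinearMap.ker_eq_bot.2 (transcendental_iff_injective.1 hF))
      have h2 : (Polynomial.aeval F).toLinearMap ∘ Polynomial.basisMonomials K =
          fun i : ℕ => F ^ i := by
        funext i
        simp
      rwa [h2] at this
    rw [sum_coeff_tmul_pow] at hp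
    have := hli.eq_zero_of_sum_tmul_eq_zero hp _ (Finset.self_mem_range_succ _)
    have h2 := Polynomial.leadingCoeff_eq_zero.1 this
    have h3 := eq_zero_of_pow_eq_zero h2
    simpa using congrArg (fun p => Polynomial.coeff p 1) h3

theorem IsNilpotent.tmul_one_sub_one_tmul {A B K E : Type*} [CommRing A] [CommRing B] [Field K]
    [Field E] [Algebra A B] [Algebra A K] [Algebra K E] [Algebra A E] [IsScalarTower A K E]
    [Algebra B E] [IsScalarTower A B E] {F : B}
    (h : IsNilpotent (F ⊗ₜ[A] (1 : B) - (1 : B) ⊗ₜ[A] F)) :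
    IsNilpotent (algebraMap B E F ⊗ₜ[K] (1 : E) - (1 : E) ⊗ₜ[K] algebraMap B E F) := by
  let ι : B →ₐ[A] E := Algebra.algHom A B E
  let φ : B ⊗[A] B →ₐ[A] E ⊗[K] E := Algebra.TensorProduct.productMap
    (((Algebra.TensorProduct.includeLeft : E →ₐ[K] E ⊗[K] E).restrictScalars A).comp ι)
    (((Algebra.TensorProduct.includeRight : E →ₐ[K] E ⊗[K] E).restrictScalars A).comp ι)
  have h1 : φ (F ⊗ₜ[A] (1 : B) - (1 : B) ⊗ₜ[A] F) =
      algebraMap B E F ⊗ₜ[K] (1 : E) - (1 : E) ⊗ₜ[K] algebraMap B E F := by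
    rw [map_sub, Algebra.TensorProduct.productMap_apply_tmul,
      Algebra.TensorProduct.productMap_apply_tmul, map_one, map_one, mul_one, one_mul]
    rfl
  rw [← h1]
  exact h.map φ

/-- If the two images of `F` in `B ⊗ B` over a subalgebra `A` of a domain `B` differ by a
nilpotent, then `F` is a fraction of elements of `A`. -/
theorem Subalgebra.exists_mul_mem_of_isNilpotent_tmul {B : Type*} [CommRing B] [Algebra ℂ B]
    [IsDomain B] (A : Subalgebra ℂ B) {F : B}
    (h : IsNilpotent (F ⊗ₜ[A] (1 : B) - (1 : B) ⊗ₜ[A] F)) : ∃ a ∈ A, a ≠ 0 ∧ a * F ∈ A := by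
  let K := FractionRing A
  let E := FractionRing B
  let _ : Algebra K E := FractionRing.liftAlgebra A E
  have : IsScalarTower A K E := FractionRing.isScalarTower_liftAlgebra A E
  have : CharZero K := charZero_of_injective_algebraMap (algebraMap ℂ K).injective
  have hn := h.tmul_one_sub_one_tmul (K := K) (E := E)
  obtain ⟨x, hx⟩ := mem_range_algebraMap_of_isNilpotent_tmul hn
  obtain ⟨b, a, ha, rfl⟩ := IsFractionRing.div_surjective (A := A) x
  have ha0 : (a : B) ≠ 0 := fun h0 => nonZeroDivisors.ne_zero ha (Subtype.ext h0)
  refine ⟨a, a.2, ha0, ?_⟩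
  have : (a : B) * F = b := by
    apply IsFractionRing.injective B E
    rw [map_mul, ← hx, map_div₀]
    have h1 : ∀ c : A, algebraMap K E (algebraMap A K c) = algebraMap B E c := fun c => by
      rw [← IsScalarTower.algebraMap_apply A K E, IsScalarTower.algebraMap_apply A B E]
      rfl
    rw [h1, h1]
    exact mul_div_cancel₀ _ fun h0 => ha0 ((IsFractionRing.injective B E) (by simpa using h0))
  rw [this]
  exact b.2

namespace IsGroupAlgebra

variable {Γ B : Type*} [Group Γ] [CommRing B] [Algebra ℂ B] {e : Γ → B →ₐ[ℂ] ℂ}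

/-- Functions constant on the fibres of the map defined by a subalgebra `A` are fractions of
elements of `A`. -/
theorem exists_mul_mem_of_constant_on_fibres (hA : IsGroupAlgebra e)
    (hconn : IsZariskiConnected e Set.univ) (A : Subalgebra ℂ B) {F : B}
    (hF : ∀ g h, (∀ a ∈ A, e g a = e h a) → e g F = e h F) : ∃ a ∈ A, a ≠ 0 ∧ a * F ∈ A := by
  have := hA.finiteType
  have := hA.isDomain hconn
  have : Algebra.FiniteType A B := Algebra.FiniteType.of_restrictScalars_finiteType ℂ A B
  have : Algebra.FiniteType ℂ (B ⊗[A] B) :=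
    Algebra.FiniteType.trans (S := B) inferInstance inferInstance
  refine A.exists_mul_mem_of_isNilpotent_tmul (isNilpotent_of_forall_algHom fun χ => ?_)
  let i₁ : B →ₐ[ℂ] B ⊗[A] B := (Algebra.TensorProduct.includeLeft (S := A)).restrictScalars ℂ
  let i₂ : B →ₐ[ℂ] B ⊗[A] B := (Algebra.TensorProduct.includeRight (R := A)).restrictScalars ℂ
  obtain ⟨g, hg⟩ := hA.exists_eval (χ.comp i₁)
  obtain ⟨h, hh⟩ := hA.exists_eval (χ.comp i₂)
  rw [map_sub, sub_eq_zero]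
  change χ.comp i₁ F = χ.comp i₂ F
  rw [← hg, ← hh]
  refine hF g h fun a ha => ?_
  rw [hg, hh]
  exact congrArg χ (Algebra.TensorProduct.tmul_one_eq_one_tmul (⟨a, ha⟩ : A))

/-- On a homogeneous space, a function on the group which is constant on the fibres of the orbit
map descends to a regular function. -/
theorem mem_of_constant_on_fibres (hA : IsGroupAlgebra e)
    (hconn : IsZariskiConnected e Set.univ) (A : Subalgebra ℂ B) (hfg : A.FG)
    (htr : ∀ g, ∀ a ∈ A, hA.lTr g a ∈ A)
    (htrans : ∀ χ : A →ₐ[ℂ] ℂ, ∃ g, ∀ a : A, χ a = e g a) {F : B}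
    (hF : ∀ g h, (∀ a ∈ A, e g a = e h a) → e g F = e h F) : F ∈ A := by
  have := hA.isDomain hconn
  have : Algebra.FiniteType ℂ A := A.fg_iff_finiteType.1 hfg
  have hFg : ∀ k, ∃ a ∈ A, a ≠ 0 ∧ a * hA.lTr k F ∈ A := fun k => by
    refine hA.exists_mul_mem_of_constant_on_fibres hconn A fun g h hgh => ?_
    rw [lTr_apply, lTr_apply]
    exact hF _ _ fun a ha => by simpa using hgh _ (htr k a ha)
  let J : Ideal A :=
    { carrier := {a | ∀ g, (a : B) * hA.lTr g F ∈ A}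
      add_mem' := fun {a b} ha hb g => by
        simpa [add_mul] using add_mem (ha g) (hb g)
      zero_mem' := fun g => by simp
      smul_mem' := fun c a ha g => by
        simpa [mul_assoc] using mul_mem c.2 (ha g) }
  have hJ : ∀ a : A, a ∈ J ↔ ∀ g, (a : B) * hA.lTr g F ∈ A := fun _ => Iff.rfl
  have hJstable : ∀ a ∈ J, ∀ g, (⟨hA.lTr g a, htr g a a.2⟩ : A) ∈ J := by
    intro a ha g k
    have := htr g _ (ha (k * g⁻¹))
    rw [map_mul, lTr_lTr] at this
    simpa using this
  obtain ⟨a₀, ha₀, hne⟩ : ∃ a₀ ∈ J, a₀ ≠ 0 := by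
    classical
    obtain ⟨k, a, b, hl, -, -⟩ := hA.exists_translates F
    let V : Submodule ℂ B := Submodule.span ℂ (Set.range fun g => hA.lTr g F)
    have hV : V ≤ Submodule.span ℂ (Set.range b) := by
      refine Submodule.span_le.2 ?_
      rintro _ ⟨g, rfl⟩
      simp only [hl]
      exact Submodule.sum_mem _ fun i _ =>
        Submodule.smul_mem _ _ (Submodule.subset_span ⟨i, rfl⟩)
    have : FiniteDimensional ℂ (Submodule.span ℂ (Set.range b)) :=
      FiniteDimensional.span_of_finite ℂ (Set.finite_range b)
    have hVfin : FiniteDimensional ℂ V := Submodule.finiteDimensional_of_le hV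
    obtain ⟨s, hs⟩ := (Submodule.fg_iff_finiteDimensional V).2 hVfin
    have hfrac : ∀ f ∈ V, ∃ a ∈ A, a ≠ 0 ∧ a * f ∈ A := by
      intro f hf
      induction hf using Submodule.span_induction with
      | mem f hf =>
        obtain ⟨g, rfl⟩ := hf
        exact hFg g
      | zero => exact ⟨1, A.one_mem, one_ne_zero, by simp⟩
      | add f f' _ _ h h' =>
        obtain ⟨a, ha, ha0, haf⟩ := h
        obtain ⟨a', ha', ha0', haf'⟩ := h'
        refine ⟨a * a', mul_mem ha ha', mul_ne_zero ha0 ha0', ?_⟩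
        rw [show a * a' * (f + f') = a' * (a * f) + a * (a' * f') by ring]
        exact add_mem (mul_mem ha' haf) (mul_mem ha haf')
      | smul c f _ h =>
        obtain ⟨a, ha, ha0, haf⟩ := h
        exact ⟨a, ha, ha0, by rw [mul_smul_comm]; exact A.smul_mem haf c⟩
    have hsV : ∀ f ∈ s, f ∈ V := fun f hf => hs ▸ Submodule.subset_span hf
    have hcommon : ∀ t ⊆ s, ∃ a ∈ A, a ≠ 0 ∧ ∀ f ∈ t, a * f ∈ A := by
      intro t
      induction t using Finset.induction_on with
      | empty => exact fun _ => ⟨1, A.one_mem, one_ne_zero, by simp⟩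
      | insert f t _ ih =>
        intro ht
        obtain ⟨a, ha, ha0, hat⟩ := ih ((Finset.subset_insert f t).trans ht)
        obtain ⟨a', ha', ha0', haf⟩ := hfrac f (hsV f (ht (Finset.mem_insert_self f t)))
        refine ⟨a * a', mul_mem ha ha', mul_ne_zero ha0 ha0', fun f' hf' => ?_⟩
        rcases Finset.mem_insert.1 hf' with rfl | hf'
        · rw [mul_assoc]
          exact mul_mem ha haf
        · rw [mul_comm a, mul_assoc]
          exact mul_mem ha' (hat f' hf')
    obtain ⟨a, ha, ha0, has⟩ := hcommon s subset_rfl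
    refine ⟨⟨a, ha⟩, fun g => ?_, fun h => ha0 (congrArg Subtype.val h)⟩
    have hle : V ≤ A.toSubmodule.comap (LinearMap.mulLeft ℂ a) := by
      rw [← hs]
      exact Submodule.span_le.2 has
    exact hle (Submodule.subset_span ⟨g, rfl⟩)
  have htop : J = ⊤ := by
    by_contra hJt
    obtain ⟨M, hM, hJM⟩ := J.exists_le_maximal hJt
    obtain ⟨χ, hχ⟩ := exists_algHom_ker_eq M
    obtain ⟨g, hg⟩ := htrans χ
    refine hne (Subtype.ext (hA.ext fun h => ?_))
    have h1 : χ ⟨hA.lTr (h * g⁻¹) a₀, htr _ _ a₀.2⟩ = 0 := by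
      have := hJM (hJstable a₀ ha₀ (h * g⁻¹))
      rwa [← hχ] at this
    rw [hg] at h1
    simpa using h1
  have h1 := (Ideal.eq_top_iff_one J).1 htop 1
  rw [lTr_one] at h1
  simpa using h1

end IsGroupAlgebra

end

section

open AffAlgGroup

/-- Evaluation of a polynomial in two groups of variables as a finite sum of products. -/
theorem exists_eval_sumElim_eq_sum_mul {σ τ : Type*} (R : MvPolynomial (σ ⊕ τ) ℂ) :
    ∃ (k : ℕ) (a : Fin k → MvPolynomial σ ℂ) (b : Fin k → MvPolynomial τ ℂ),
      ∀ x y, eval (Sum.elim x y) R = ∑ i, eval x (a i) * eval y (b i) := by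
  induction R using MvPolynomial.induction_on with
  | C c => exact ⟨1, fun _ => C c, fun _ => 1, fun x y => by simp⟩
  | add P Q hP hQ =>
    obtain ⟨k, a, b, h⟩ := hP
    obtain ⟨k', a', b', h'⟩ := hQ
    exact ⟨k + k', Fin.append a a', Fin.append b b', fun x y => by
      simp [h, h', Fin.sum_univ_add]⟩
  | mul_X P s hP =>
    obtain ⟨k, a, b, h⟩ := hP
    rcases s with s | s
    · exact ⟨k, fun i => a i * X s, b, fun x y => by
        simp only [map_mul, h, eval_X, Sum.elim_inl, Finset.sum_mul]
        exact Finset.sum_congr rfl fun i _ => by ring⟩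
    · exact ⟨k, a, fun i => b i * X s, fun x y => by
        simp only [map_mul, h, eval_X, Sum.elim_inr, Finset.sum_mul]
        exact Finset.sum_congr rfl fun i _ => by ring⟩

/-- The algebra of polynomial functions on a type mapped to affine space. -/
def regFun {Y σ : Type*} (ι : Y → σ → ℂ) : Subalgebra ℂ (Y → ℂ) where
  carrier := {f | ∃ P : MvPolynomial σ ℂ, ∀ y, f y = eval (ι y) P}
  mul_mem' := fun ⟨P, hP⟩ ⟨Q, hQ⟩ => ⟨P * Q, fun y => by simp [hP, hQ]⟩
  add_mem' := fun ⟨P, hP⟩ ⟨Q, hQ⟩ => ⟨P + Q, fun y => by simp [hP, hQ]⟩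
  algebraMap_mem' := fun c => ⟨C c, fun y => by simp⟩

theorem mem_regFun {Y σ : Type*} {ι : Y → σ → ℂ} {f : Y → ℂ} :
    f ∈ regFun ι ↔ ∃ P : MvPolynomial σ ℂ, ∀ y, f y = eval (ι y) P := Iff.rfl

/-- The polynomial function defined by a polynomial. -/
def polyFun {Y σ : Type*} (ι : Y → σ → ℂ) : MvPolynomial σ ℂ →ₐ[ℂ] regFun ι where
  toFun P := ⟨fun y => eval (ι y) P, P, fun _ => rfl⟩
  map_one' := Subtype.ext (_root_.funext fun _ => map_one _)
  map_zero' := Subtype.ext (_root_.funext fun _ => map_zero _)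
  map_mul' P Q := Subtype.ext (_root_.funext fun _ => map_mul _ P Q)
  map_add' P Q := Subtype.ext (_root_.funext fun _ => map_add _ P Q)
  commutes' c := Subtype.ext (_root_.funext fun _ => eval_C c)

@[simp] theorem polyFun_apply {Y σ : Type*} (ι : Y → σ → ℂ) (P : MvPolynomial σ ℂ)
    (y : Y) : (polyFun ι P).1 y = eval (ι y) P := rfl

theorem polyFun_surjective {Y σ : Type*} (ι : Y → σ → ℂ) :
    Function.Surjective (polyFun ι) := fun ⟨_, P, hP⟩ =>
  ⟨P, Subtype.ext (_root_.funext fun y => (hP y).symm)⟩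

theorem regFun_fg {Y σ : Type*} [Finite σ] (ι : Y → σ → ℂ) : (regFun ι).FG :=
  (regFun ι).fg_iff_finiteType.2 (Algebra.FiniteType.of_surjective _ (polyFun_surjective ι))

/-- An algebra homomorphism from the polynomial functions to `ℂ` is given by a point. -/
theorem exists_algHom_regFun_eq_eval {Y σ : Type*} (ι : Y → σ → ℂ)
    (χ : regFun ι →ₐ[ℂ] ℂ) : ∃ z : σ → ℂ, ∀ P, χ (polyFun ι P) = eval z P := by
  refine ⟨fun i => χ (polyFun ι (X i)), fun P => ?_⟩
  have h : χ.comp (polyFun ι) = aeval fun i => χ (polyFun ι (X i)) :=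
    algHom_ext fun i => by simp
  exact DFunLike.congr_fun h P

theorem eval_bind₁ {σ τ : Type*} (Q : σ → MvPolynomial τ ℂ) (P : MvPolynomial σ ℂ) (x : τ → ℂ) :
    eval x (bind₁ Q P) = eval (fun i => eval x (Q i)) P := eval₂Hom_bind₁ _ _ _ _

theorem IsAlgebraicSet.mem_of_forall_eval {n : ℕ} {V : Set (Pt n)} (hV : IsAlgebraicSet V)
    {z : Pt n} (hz : ∀ P : MvPolynomial (Fin n) ℂ, (∀ x ∈ V, eval x P = 0) → eval z P = 0) :
    z ∈ V := by
  obtain ⟨S, rfl⟩ := hV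
  exact fun P hP => hz P fun x hx => hx P hP

namespace AffAlgGroup

/-- The coordinates of a point of the group. -/
def Gp.toPt {G : AffAlgGroup} (g : G.Gp) : Pt G.n := g.1

/-- A point of the group with given coordinates. -/
def Gp.ofPt {G : AffAlgGroup} (x : Pt G.n) (hx : x ∈ G.carrier) : G.Gp := ⟨x, hx⟩

section

variable {G : AffAlgGroup}

@[simp] theorem Gp.toPt_ofPt (x : Pt G.n) (hx : x ∈ G.carrier) : (Gp.ofPt x hx).toPt = x := rfl

theorem Gp.toPt_mem (g : G.Gp) : g.toPt ∈ G.carrier := g.2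

theorem Gp.ext_toPt {g h : G.Gp} (H : g.toPt = h.toPt) : g = h := Subtype.ext H

@[simp] theorem Gp.toPt_mul (g h : G.Gp) : (g * h).toPt = G.mul g.toPt h.toPt := rfl

@[simp] theorem Gp.toPt_inv (g : G.Gp) : (g⁻¹).toPt = G.inv g.toPt := rfl

@[simp] theorem Gp.toPt_one : (1 : G.Gp).toPt = G.one := rfl

end

/-- The coordinate algebra of an affine algebraic group. -/
abbrev coordAlg (G : AffAlgGroup) : Subalgebra ℂ (G.Gp → ℂ) := regFun Gp.toPt

/-- Evaluation at a point. -/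
def ev (G : AffAlgGroup) (g : G.Gp) : G.coordAlg →ₐ[ℂ] ℂ :=
  (Pi.evalAlgHom ℂ (fun _ : G.Gp => ℂ) g).comp G.coordAlg.val

@[simp] theorem ev_apply (G : AffAlgGroup) (g : G.Gp) (f : G.coordAlg) : G.ev g f = f.1 g := rfl

/-- The value at a point of a polynomial in coordinates of a product, split into products. -/
theorem exists_eval_append_eq_sum_mul {n k : ℕ} (R : MvPolynomial (Fin (n + k)) ℂ) :
    ∃ (l : ℕ) (a : Fin l → MvPolynomial (Fin n) ℂ) (b : Fin l → MvPolynomial (Fin k) ℂ),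
      ∀ x y, eval (Fin.append x y) R = ∑ i, eval x (a i) * eval y (b i) := by
  obtain ⟨l, a, b, h⟩ := exists_eval_sumElim_eq_sum_mul (rename finSumFinEquiv.symm R)
  refine ⟨l, a, b, fun x y => ?_⟩
  rw [← h, eval_rename]
  congr 1
  congr 1
  funext i
  refine Fin.addCases (fun i => ?_) (fun i => ?_) i <;> simp

theorem left_append {n k : ℕ} (x : Pt n) (y : Pt k) : Pt.left (Fin.append x y) = x := by
  funext i; simp [Pt.left]

theorem right_append {n k : ℕ} (x : Pt n) (y : Pt k) : Pt.right (Fin.append x y) = y := by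
  funext i; simp [Pt.right]

theorem isGroupAlgebra (G : AffAlgGroup) : IsGroupAlgebra G.ev where
  finiteType := (G.coordAlg.fg_iff_finiteType).1 (regFun_fg _)
  ext h := Subtype.ext (_root_.funext h)
  exists_eval χ := by
    obtain ⟨z, hz⟩ := exists_algHom_regFun_eq_eval _ χ
    have hzG : z ∈ G.carrier := G.isAlgebraic.mem_of_forall_eval fun P hP => by
      rw [← hz P, ← map_zero χ]
      exact congrArg χ (Subtype.ext (_root_.funext fun y => hP _ y.toPt_mem))
    refine ⟨Gp.ofPt z hzG, AlgHom.ext fun f => ?_⟩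
    obtain ⟨P, rfl⟩ := polyFun_surjective _ f
    rw [hz, ev_apply, polyFun_apply, Gp.toPt_ofPt]
  comul f := by
    obtain ⟨P, rfl⟩ := polyFun_surjective _ f
    obtain ⟨M, hM⟩ := G.mul_regular
    obtain ⟨l, a, b, h⟩ := exists_eval_append_eq_sum_mul (bind₁ M P)
    refine ⟨l, fun i => polyFun _ (a i), fun i => polyFun _ (b i), fun g k => ?_⟩
    simp only [ev_apply, polyFun_apply]
    rw [← h, eval_bind₁]
    congr 1
    congr 1
    funext i
    have h1 := hM (Fin.append g.toPt k.toPt) ⟨by rw [left_append]; exact g.toPt_mem,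
      by rw [right_append]; exact k.toPt_mem⟩ i
    simp only [left_append, right_append] at h1
    exact h1
  antipode f := by
    obtain ⟨P, rfl⟩ := polyFun_surjective _ f
    obtain ⟨M, hM⟩ := G.inv_regular
    refine ⟨polyFun _ (bind₁ M P), fun g => ?_⟩
    simp only [ev_apply, polyFun_apply, eval_bind₁]
    congr 1
    congr 1
    funext i
    exact (hM _ g.toPt_mem i).symm
  injective g h hgh := Gp.ext_toPt <| _root_.funext fun i => by
    simpa using DFunLike.congr_fun hgh (polyFun Gp.toPt (X i))

/-- The closed subset of affine space cut out by functions on the group. -/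
theorem zeroSet_ev_eq (G : AffAlgGroup) (S : Set G.coordAlg) : ∃ V : Set (Pt G.n),
    IsAlgebraicSet V ∧ ∀ g : G.Gp, g ∈ zeroSet G.ev S ↔ g.toPt ∈ V := by
  refine ⟨_, ⟨{P | polyFun _ P ∈ S}, rfl⟩, fun g => ⟨fun hg P hP => hg _ hP, fun hg s hs => ?_⟩⟩
  obtain ⟨P, rfl⟩ := polyFun_surjective _ s
  exact hg P hs

theorem IsConnected.isZariskiConnected {G : AffAlgGroup} (hG : G.IsConnected) :
    IsZariskiConnected G.ev Set.univ := by
  intro S T hST h0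
  obtain ⟨V, hV, hSV⟩ := G.zeroSet_ev_eq S
  obtain ⟨W, hW, hTW⟩ := G.zeroSet_ev_eq T
  refine (hG V W hV hW (fun x hx => ?_) ?_).imp (fun h g _ => (hSV g).2 (h g.toPt_mem))
    fun h g _ => (hTW g).2 (h g.toPt_mem)
  · exact (hST (Set.mem_univ (Gp.ofPt x hx))).imp (hSV _).1 (hTW _).1
  · refine Set.eq_empty_iff_forall_notMem.2 fun x ⟨hx, hxV, hxW⟩ => ?_
    exact Set.eq_empty_iff_forall_notMem.1 h0 (Gp.ofPt x hx)
      ⟨Set.mem_univ _, (hSV _).2 hxV, (hTW _).2 hxW⟩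

theorem IsReductive.hasTrivialUnipotentRadical {G : AffAlgGroup} (hG : G.IsReductive) :
    HasTrivialUnipotentRadical G.ev := by
  rintro K hK ⟨S, hS⟩ hconn m M hmul hdiag hlow hinj
  obtain ⟨V, ⟨S', hV⟩, hSV⟩ := G.zeroSet_ev_eq S
  have hKV : ∀ g : G.Gp, g ∈ K ↔ g.toPt ∈ V := fun g => by
    rw [← hSV, ← hS, SetLike.mem_coe]
  obtain ⟨S₀, hS₀⟩ := G.isAlgebraic
  let H : AlgSubgroup G :=
    { carrier := G.carrier ∩ V
      subset := Set.inter_subset_left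
      isAlgebraic := ⟨S₀ ∪ S', by
        ext x
        rw [hS₀, hV]
        simp only [Set.mem_inter_iff, Set.mem_ofPred_eq, Set.mem_union]
        exact ⟨fun h p hp => hp.elim (h.1 p) (h.2 p),
          fun h => ⟨fun p hp => h p (Or.inl hp), fun p hp => h p (Or.inr hp)⟩⟩⟩
      one_mem := ⟨G.one_mem, (hKV 1).1 K.one_mem⟩
      mul_mem := fun {x y} hx hy => ⟨G.mul_mem hx.1 hy.1, (hKV (Gp.ofPt x hx.1 * Gp.ofPt y hy.1)).1
        (K.mul_mem ((hKV _).2 hx.2) ((hKV _).2 hy.2))⟩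
      inv_mem := fun {x} hx => ⟨G.inv_mem hx.1, (hKV (Gp.ofPt x hx.1)⁻¹).1
        (K.inv_mem ((hKV _).2 hx.2))⟩ }
  have hHK : ∀ x (hx : x ∈ H.carrier), Gp.ofPt x hx.1 ∈ K := fun x hx => (hKV _).2 hx.2
  have hnormal : H.IsNormal := fun g hg x hx => by
    have h := hK.conj_mem _ (hHK x hx) (Gp.ofPt g hg)
    rw [mul_assoc] at h
    exact ⟨G.mul_mem hg (G.mul_mem hx.1 (G.inv_mem hg)), (hKV _).1 h⟩
  have hconnected : H.toGrp.IsConnected := by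
    rintro V' W' ⟨P, rfl⟩ ⟨Q, rfl⟩ hcov hdisj
    have hz : ∀ (P : Set (MvPolynomial (Fin G.n) ℂ)) (g : G.Gp),
        g ∈ zeroSet G.ev (polyFun _ '' P) ↔ ∀ p ∈ P, eval g.toPt p = 0 := fun P g =>
      ⟨fun h p hp => h _ ⟨p, hp, rfl⟩, fun h s ⟨p, hp, hs⟩ => by rw [← hs]; exact h p hp⟩
    refine (hconn (polyFun _ '' P) (polyFun _ '' Q) (fun g hg => ?_) ?_).imp (fun h x hx => ?_)
      fun h x hx => ?_
    · exact (hcov ⟨g.toPt_mem, (hKV g).1 hg⟩).imp (hz P g).2 (hz Q g).2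
    · refine Set.eq_empty_iff_forall_notMem.2 fun g ⟨hg, hgP, hgQ⟩ => ?_
      exact Set.eq_empty_iff_forall_notMem.1 hdisj g.toPt
        ⟨⟨g.toPt_mem, (hKV g).1 hg⟩, (hz P g).1 hgP, (hz Q g).1 hgQ⟩
    · exact (hz P (Gp.ofPt x hx.1)).1 (h (hHK x hx))
    · exact (hz Q (Gp.ofPt x hx.1)).1 (h (hHK x hx))
  have hunip : H.toGrp.IsUnipotent := by
    choose R hR using fun i j => mem_regFun.1 (M i j).2
    let φ : Pt G.n → Pt (m * m) := fun x idx =>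
      eval x (R (finProdFinEquiv.symm idx).1 (finProdFinEquiv.symm idx).2)
    have hφ : ∀ x (hx : x ∈ G.carrier) i j,
        matEntry (φ x) i j = G.ev (Gp.ofPt x hx) (M i j) := fun x hx i j => by
      simp only [matEntry, φ, Equiv.symm_apply_apply]
      exact (hR i j (Gp.ofPt x hx)).symm
    have hφinj : Set.InjOn φ H.carrier := fun x hx y hy hxy => by
      refine congrArg Gp.toPt (hinj _ (hHK x hx) _ (hHK y hy) fun i j => ?_)
      rw [← hφ, ← hφ, hxy]
    have hφmul : ∀ x ∈ H.carrier, ∀ y ∈ H.carrier,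
        φ (G.mul x y) = matMulPt m (φ x) (φ y) := fun x hx y hy => by
      funext idx
      have h := hmul (Gp.ofPt x hx.1) (Gp.ofPt y hy.1)
        (finProdFinEquiv.symm idx).1 (finProdFinEquiv.symm idx).2
      simp only [matMulPt, hφ x hx.1, hφ y hy.1, ← h]
      exact (hR _ _ (Gp.ofPt (G.mul x y) (G.mul_mem hx.1 hy.1))).symm
    refine ⟨m, φ, ⟨_, fun x _ i => rfl⟩, hφinj,
      fun x hx => ⟨fun i => ?_, fun i j hij => ?_⟩, hφmul⟩
    · rw [hφ x hx.1]
      exact hdiag _ (hHK x hx) i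
    · rw [hφ x hx.1]
      exact hlow _ (hHK x hx) i j hij
  have h1 := hG H hnormal hconnected hunip
  refine (Subgroup.eq_bot_iff_forall K).2 fun g hg => Gp.ext_toPt ?_
  have : g.toPt ∈ H.carrier := ⟨g.toPt_mem, (hKV g).1 hg⟩
  rw [h1] at this
  exact this

end AffAlgGroup

/-- The regular map `x ↦ φ (y, x)` is given by specialising the variables of `y`. -/
def specializeLeft {σ τ : Type*} (y : σ → ℂ) : MvPolynomial (σ ⊕ τ) ℂ →ₐ[ℂ] MvPolynomial τ ℂ :=
  bind₁ (Sum.elim (fun s => C (y s)) X)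

@[simp] theorem eval_specializeLeft {σ τ : Type*} (y : σ → ℂ) (x : τ → ℂ)
    (P : MvPolynomial (σ ⊕ τ) ℂ) : eval x (specializeLeft y P) = eval (Sum.elim y x) P := by
  rw [specializeLeft, eval_bind₁]
  congr 1
  congr 1
  funext s
  cases s <;> simp

/-- The regular map `y ↦ φ (y, x)` is given by specialising the variables of `x`. -/
def specializeRight {σ τ : Type*} (x : τ → ℂ) : MvPolynomial (σ ⊕ τ) ℂ →ₐ[ℂ] MvPolynomial σ ℂ :=
  bind₁ (Sum.elim X (fun s => C (x s)))

@[simp] theorem eval_specializeRight {σ τ : Type*} (y : σ → ℂ) (x : τ → ℂ)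
    (P : MvPolynomial (σ ⊕ τ) ℂ) : eval y (specializeRight x P) = eval (Sum.elim y x) P := by
  rw [specializeRight, eval_bind₁]
  congr 1
  congr 1
  funext s
  cases s <;> simp

namespace AlgGVariety

variable {G : AffAlgGroup} (X : AlgGVariety G)

theorem exists_act_eq_eval : ∃ P : Fin X.N → MvPolynomial (Fin G.n ⊕ Fin X.N) ℂ,
    ∀ g ∈ G.carrier, ∀ x ∈ X.carrier, ∀ i, X.act g x i = eval (Sum.elim g x) (P i) := by
  obtain ⟨M, hM⟩ := X.regular
  refine ⟨fun i => rename finSumFinEquiv.symm (M i), fun g hg x hx i => ?_⟩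
  have h1 := hM (Fin.append g x) ⟨by rw [left_append]; exact hg,
    by rw [right_append]; exact hx⟩ i
  simp only [left_append, right_append] at h1
  rw [h1, eval_rename]
  congr 1
  congr 1
  funext j
  refine Fin.addCases (fun j => ?_) (fun j => ?_) j <;> simp

/-- The points of a variety. -/
def Pts : Type := {x : Pt X.N // x ∈ X.carrier}

variable {X}

/-- The coordinates of a point. -/
def Pts.toPt (x : X.Pts) : Pt X.N := x.1

/-- The point with given coordinates. -/
def Pts.ofPt (x : Pt X.N) (hx : x ∈ X.carrier) : X.Pts := ⟨x, hx⟩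

@[simp] theorem Pts.toPt_ofPt (x : Pt X.N) (hx : x ∈ X.carrier) : (Pts.ofPt x hx).toPt = x := rfl

theorem Pts.toPt_mem (x : X.Pts) : x.toPt ∈ X.carrier := x.2

theorem Pts.ext_toPt {x y : X.Pts} (h : x.toPt = y.toPt) : x = y := Subtype.ext h

instance : MulAction G.Gp X.Pts where
  smul g x := Pts.ofPt (X.act g.toPt x.toPt) (X.maps_to g.toPt_mem x.toPt_mem)
  one_smul x := Pts.ext_toPt (X.act_one x.toPt_mem)
  mul_smul g h x := Pts.ext_toPt (X.act_mul g.toPt_mem h.toPt_mem x.toPt_mem)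

@[simp] theorem Pts.toPt_smul (g : G.Gp) (x : X.Pts) :
    (g • x).toPt = X.act g.toPt x.toPt := rfl

/-- Translation of regular functions on a variety. -/
theorem comp_smul_mem_regFun (g : G.Gp) (f : regFun (Pts.toPt (X := X))) :
    (fun x => f.1 (g • x)) ∈ regFun (Pts.toPt (X := X)) := by
  obtain ⟨P, rfl⟩ := polyFun_surjective _ f
  obtain ⟨M, hM⟩ := X.exists_act_eq_eval
  refine ⟨bind₁ (fun i => specializeLeft g.toPt (M i)) P, fun x => ?_⟩
  simp only [eval_bind₁, polyFun_apply, Pts.toPt_smul]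
  congr 2
  funext i
  rw [eval_specializeLeft, hM _ g.toPt_mem _ x.toPt_mem]

theorem comp_orbit_mem_regFun (x : X.Pts) (f : regFun (Pts.toPt (X := X))) :
    (fun g => f.1 (g • x)) ∈ G.coordAlg := by
  obtain ⟨P, rfl⟩ := polyFun_surjective _ f
  obtain ⟨M, hM⟩ := X.exists_act_eq_eval
  refine ⟨bind₁ (fun i => specializeRight x.toPt (M i)) P, fun g => ?_⟩
  simp only [eval_bind₁, polyFun_apply, Pts.toPt_smul]
  congr 2
  funext i
  rw [eval_specializeRight, hM _ g.toPt_mem _ x.toPt_mem]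

/-- Pullback of regular functions along an orbit map. -/
def orbitPullback (x : X.Pts) : regFun (Pts.toPt (X := X)) →ₐ[ℂ] G.coordAlg where
  toFun f := ⟨fun g => f.1 (g • x), comp_orbit_mem_regFun x f⟩
  map_one' := rfl
  map_zero' := rfl
  map_mul' _ _ := rfl
  map_add' _ _ := rfl
  commutes' _ := rfl

@[simp] theorem orbitPullback_apply (x : X.Pts) (f : regFun (Pts.toPt (X := X))) (g : G.Gp) :
    (orbitPullback x f).1 g = f.1 (g • x) := rfl

theorem exists_algHom_eq_eval_pts (χ : regFun (Pts.toPt (X := X)) →ₐ[ℂ] ℂ) :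
    ∃ x : X.Pts, ∀ f, χ f = f.1 x := by
  obtain ⟨z, hz⟩ := exists_algHom_regFun_eq_eval _ χ
  have hzX : z ∈ X.carrier := X.isAlgebraic.mem_of_forall_eval fun P hP => by
    rw [← hz P, ← map_zero χ]
    exact congrArg χ (Subtype.ext (_root_.funext fun y => hP _ y.toPt_mem))
  refine ⟨Pts.ofPt z hzX, fun f => ?_⟩
  obtain ⟨P, rfl⟩ := polyFun_surjective _ f
  rw [hz, polyFun_apply, Pts.toPt_ofPt]

/-- Restriction of regular functions to an algebraic subgroup. -/
def _root_.AlgSubgroup.restrict (H : AlgSubgroup G) : G.coordAlg →ₐ[ℂ] H.toGrp.coordAlg where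
  toFun f := ⟨fun h => f.1 (H.incl h), let ⟨P, hP⟩ := f.2; ⟨P, fun h => hP (H.incl h)⟩⟩
  map_one' := rfl
  map_zero' := rfl
  map_mul' _ _ := rfl
  map_add' _ _ := rfl
  commutes' _ := rfl

@[simp] theorem _root_.AlgSubgroup.restrict_apply (H : AlgSubgroup G) (f : G.coordAlg)
    (h : H.toGrp.Gp) : (H.restrict f).1 h = f.1 (H.incl h) := rfl

@[simp] theorem _root_.AffAlgGroup.lTr_val (f : G.coordAlg) (g h : G.Gp) :
    (G.isGroupAlgebra.lTr g f).1 h = f.1 (g * h) := G.isGroupAlgebra.lTr_apply g h f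

/-- Averaging over a connected reductive subgroup `L` gives an equivariant projection from the
regular functions on `G` to those on `G / L`. -/
theorem exists_average (hG : G.IsConnected) {L : AlgSubgroup G} (hL : L.toGrp.IsConnected)
    (hred : L.toGrp.IsReductive) {x₀ : Pt X.N} (hX : X.IsQuotientBy L x₀) :
    ∃ R : G.coordAlg →ₗ[ℂ] regFun (Pts.toPt (X := X)), R 1 = 1 ∧
      ∀ g F x, (R (G.isGroupAlgebra.lTr g F)).1 x = (R F).1 (g • x) := by
  have hA := G.isGroupAlgebra
  obtain ⟨hx₀, htrans, hstab⟩ := hX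
  obtain ⟨I, hI1, hI⟩ := L.toGrp.isGroupAlgebra.exists_integral hL.isZariskiConnected
    hred.hasTrivialUnipotentRadical
  let z : X.Pts := Pts.ofPt x₀ hx₀
  have horb : ∀ x : X.Pts, ∃ g : G.Gp, g • z = x := fun x => by
    obtain ⟨g, hg, h⟩ := htrans x.toPt x.toPt_mem
    exact ⟨Gp.ofPt g hg, Pts.ext_toPt h⟩
  let J : G.coordAlg →ₗ[ℂ] ℂ := I ∘ₗ L.restrict.toLinearMap
  have hJ : ∀ l F, J (hA.lTr (L.incl l) F) = J F := fun l F => by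
    have : L.restrict (hA.lTr (L.incl l) F) = L.toGrp.isGroupAlgebra.lTr l (L.restrict F) :=
      Subtype.ext (_root_.funext fun h => by simp)
    change I (L.restrict _) = I (L.restrict F)
    rw [this, hI]
  have hmem : ∀ F, (fun s => J (hA.lTr s F)) ∈ G.coordAlg := fun F => by
    obtain ⟨k, a, b, h, -⟩ := hA.exists_translates F
    have : (fun s => J (hA.lTr s F)) = (∑ i, J (b i) • a i : G.coordAlg).1 := by
      funext s
      simp [h, mul_comm]
    rw [this]
    exact Subtype.prop _
  let R₀ : G.coordAlg →ₗ[ℂ] G.coordAlg :=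
    { toFun := fun F => ⟨fun s => J (hA.lTr s F), hmem F⟩
      map_add' := fun F F' => Subtype.ext (_root_.funext fun s => by simp)
      map_smul' := fun c F => Subtype.ext (_root_.funext fun s => by simp) }
  have hR₀ : ∀ F s, (R₀ F).1 s = J (hA.lTr s F) := fun F s => rfl
  let φ := orbitPullback z
  have hφinj : Function.Injective φ := fun f f' h => Subtype.ext <| _root_.funext fun x => by
    obtain ⟨g, rfl⟩ := horb x
    exact congrFun (congrArg Subtype.val h) g
  have hrange : ∀ F, R₀ F ∈ φ.range := fun F => by
    refine hA.mem_of_constant_on_fibres hG.isZariskiConnected φ.range ?_ ?_ ?_ fun g h hgh => ?_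
    · rw [← Algebra.map_top]
      exact Subalgebra.FG.map _ ((Subalgebra.fg_top _).2 (regFun_fg _))
    · rintro g _ ⟨f, rfl⟩
      refine ⟨⟨_, comp_smul_mem_regFun g f⟩, Subtype.ext (_root_.funext fun h => ?_)⟩
      simp [φ, mul_smul]
    · intro χ
      obtain ⟨x, hx⟩ := exists_algHom_eq_eval_pts (χ.comp φ.rangeRestrict)
      obtain ⟨g, rfl⟩ := horb x
      refine ⟨g, ?_⟩
      rintro ⟨_, f, rfl⟩
      exact hx f
    · have hz : g • z = h • z := Pts.ext_toPt <| _root_.funext fun i => by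
        simpa [φ] using hgh _ ⟨polyFun _ (MvPolynomial.X i), rfl⟩
      have hgl : (g⁻¹ * h).toPt ∈ L.carrier := by
        refine (hstab _ (g⁻¹ * h).toPt_mem).1 ?_
        have : (g⁻¹ * h) • z = z := by rw [mul_smul, ← hz, inv_smul_smul]
        exact congrArg Pts.toPt this
      have hh : h = g * L.incl (Gp.ofPt (G := L.toGrp) _ hgl) := by
        have : L.incl (Gp.ofPt (G := L.toGrp) _ hgl) = g⁻¹ * h := rfl
        rw [this, mul_inv_cancel_left]
      rw [ev_apply, ev_apply, hR₀, hR₀, hh, ← hA.lTr_lTr, hJ]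
  let E := AlgEquiv.ofInjective φ hφinj
  let R : G.coordAlg →ₗ[ℂ] regFun (Pts.toPt (X := X)) :=
    E.symm.toLinearMap ∘ₗ R₀.codRestrict φ.range.toSubmodule hrange
  have hR : ∀ F s, (R F).1 (s • z) = J (hA.lTr s F) := fun F s => by
    have h : φ (R F) = R₀ F := congrArg Subtype.val (E.apply_symm_apply ⟨R₀ F, hrange F⟩)
    rw [← hR₀, ← h]
    rfl
  refine ⟨R, Subtype.ext (_root_.funext fun x => ?_), fun g F x => ?_⟩
  · obtain ⟨s, rfl⟩ := horb x
    rw [hR, map_one]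
    change I (L.restrict 1) = _
    rw [map_one, hI1]
    rfl
  · obtain ⟨s, rfl⟩ := horb x
    rw [hR, ← mul_smul, hR, hA.lTr_lTr]

end AlgGVariety

/-- The derivative of a polynomial at `x` in the direction `v`. -/
def dirDeriv {n : ℕ} (x v : Pt n) (P : MvPolynomial (Fin n) ℂ) : ℂ :=
  ∑ j, v j * eval x (pderiv j P)

section dirDeriv

variable {n : ℕ} (x v : Pt n)

@[simp] theorem dirDeriv_C (c : ℂ) : dirDeriv x v (C c) = 0 := by simp [dirDeriv]

@[simp] theorem dirDeriv_X (i : Fin n) : dirDeriv x v (X i) = v i := by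
  simp [dirDeriv, pderiv_X, Pi.single_apply, apply_ite]

theorem dirDeriv_add (P Q : MvPolynomial (Fin n) ℂ) :
    dirDeriv x v (P + Q) = dirDeriv x v P + dirDeriv x v Q := by
  simp [dirDeriv, mul_add, Finset.sum_add_distrib]

theorem dirDeriv_sub (P Q : MvPolynomial (Fin n) ℂ) :
    dirDeriv x v (P - Q) = dirDeriv x v P - dirDeriv x v Q := by
  simp [dirDeriv, mul_sub, Finset.sum_sub_distrib]

theorem dirDeriv_mul (P Q : MvPolynomial (Fin n) ℂ) :
    dirDeriv x v (P * Q) = dirDeriv x v P * eval x Q + eval x P * dirDeriv x v Q := by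
  simp only [dirDeriv, pderiv_mul, map_add, map_mul, Finset.sum_mul, Finset.mul_sum,
    ← Finset.sum_add_distrib]
  exact Finset.sum_congr rfl fun j _ => by ring

/-- The chain rule. -/
theorem dirDeriv_bind₁ {k : ℕ} (Q : Fin k → MvPolynomial (Fin n) ℂ)
    (P : MvPolynomial (Fin k) ℂ) : dirDeriv x v (bind₁ Q P) =
      dirDeriv (fun i => eval x (Q i)) (fun i => dirDeriv x v (Q i)) P := by
  induction P using MvPolynomial.induction_on with
  | C c => simp
  | add P P' h h' => rw [map_add, dirDeriv_add, h, h', dirDeriv_add]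
  | mul_X P i h => rw [map_mul, dirDeriv_mul, h, dirDeriv_mul, bind₁_X_right, eval_bind₁]; simp

variable {x v}

theorem mem_tangentAt {V : Set (Pt n)} : v ∈ tangentAt V x ↔
    ∀ P : MvPolynomial (Fin n) ℂ, (∀ y ∈ V, eval y P = 0) → dirDeriv x v P = 0 := Iff.rfl

theorem dirDeriv_congr {V : Set (Pt n)} (hv : v ∈ tangentAt V x) {P Q : MvPolynomial (Fin n) ℂ}
    (h : ∀ y ∈ V, eval y P = eval y Q) : dirDeriv x v P = dirDeriv x v Q := by
  rw [← sub_eq_zero, ← dirDeriv_sub]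
  exact mem_tangentAt.1 hv _ fun y hy => by rw [map_sub, h y hy, sub_self]

end dirDeriv

namespace AlgGVariety

variable {G : AffAlgGroup} (X : AlgGVariety G)

/-- Polynomials defining the action. -/
def actPoly : Fin X.N → MvPolynomial (Fin G.n ⊕ Fin X.N) ℂ := X.exists_act_eq_eval.choose

/-- Polynomials defining the action of a group element. -/
def actPolyAt (g : Pt G.n) (i : Fin X.N) : MvPolynomial (Fin X.N) ℂ :=
  specializeLeft g (X.actPoly i)

variable {X}

theorem eval_actPoly {g : Pt G.n} (hg : g ∈ G.carrier) {x : Pt X.N} (hx : x ∈ X.carrier)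
    (i : Fin X.N) : eval (Sum.elim g x) (X.actPoly i) = X.act g x i :=
  (X.exists_act_eq_eval.choose_spec g hg x hx i).symm

theorem eval_actPolyAt {g : Pt G.n} (hg : g ∈ G.carrier) {x : Pt X.N} (hx : x ∈ X.carrier)
    (i : Fin X.N) : eval x (X.actPolyAt g i) = X.act g x i := by
  rw [actPolyAt, eval_specializeLeft, eval_actPoly hg hx]

theorem eval_actPolyAt_eq {g : Pt G.n} (hg : g ∈ G.carrier) {x : Pt X.N} (hx : x ∈ X.carrier) :
    (fun i => eval x (X.actPolyAt g i)) = X.act g x := _root_.funext (eval_actPolyAt hg hx)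

variable (X)

/-- Points of `X` together with `p` tangent vectors. -/
def Frame (p : ℕ) : Type :=
  {z : Pt X.N × (Fin p → Pt X.N) // z.1 ∈ X.carrier ∧ ∀ k, z.2 k ∈ tangentAt X.carrier z.1}

variable {X} {p m : ℕ}

/-- The base point of a frame. -/
def Frame.pt (t : X.Frame p) : X.Pts := Pts.ofPt t.1.1 t.2.1

/-- The vectors of a frame. -/
def Frame.vec (t : X.Frame p) : Fin p → Pt X.N := t.1.2

theorem Frame.vec_mem (t : X.Frame p) (k : Fin p) :
    t.vec k ∈ tangentAt X.carrier t.pt.toPt := t.2.2 k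

/-- The frame given by a point and tangent vectors. -/
def Frame.mk (x : Pt X.N) (hx : x ∈ X.carrier) (v : Fin p → Pt X.N)
    (hv : ∀ k, v k ∈ tangentAt X.carrier x) : X.Frame p := ⟨(x, v), hx, hv⟩

@[ext] theorem Frame.ext {s t : X.Frame p} (h : s.pt = t.pt) (h' : s.vec = t.vec) : s = t :=
  Subtype.ext (Prod.ext (congrArg Pts.toPt h) h')

theorem dirDeriv_actPolyAt_mem {g : Pt G.n} (hg : g ∈ G.carrier) {x : Pt X.N}
    (hx : x ∈ X.carrier) {v : Pt X.N} (hv : v ∈ tangentAt X.carrier x) :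
    (fun i => dirDeriv x v (X.actPolyAt g i)) ∈ tangentAt X.carrier (X.act g x) := by
  refine mem_tangentAt.2 fun P hP => ?_
  rw [← eval_actPolyAt_eq hg hx, ← dirDeriv_bind₁]
  refine mem_tangentAt.1 hv _ fun y hy => ?_
  rw [eval_bind₁, eval_actPolyAt_eq hg hy]
  exact hP _ (X.maps_to hg hy)

instance : MulAction G.Gp (X.Frame p) where
  smul g t := Frame.mk _ (X.maps_to g.toPt_mem t.pt.toPt_mem)
    (fun k i => dirDeriv t.pt.toPt (t.vec k) (X.actPolyAt g.toPt i))
    fun k => dirDeriv_actPolyAt_mem g.toPt_mem t.pt.toPt_mem (t.vec_mem k)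
  one_smul t := by
    refine Frame.ext (one_smul G.Gp t.pt) (_root_.funext fun k => _root_.funext fun i => ?_)
    refine (dirDeriv_congr (t.vec_mem k) (Q := MvPolynomial.X i) fun y hy => ?_).trans
      (dirDeriv_X _ _ i)
    rw [eval_X, Gp.toPt_one, eval_actPolyAt G.one_mem hy, X.act_one hy]
  mul_smul g h t := by
    refine Frame.ext (mul_smul g h t.pt) (_root_.funext fun k => _root_.funext fun i => ?_)
    refine (dirDeriv_congr (t.vec_mem k)
      (Q := bind₁ (X.actPolyAt h.toPt) (X.actPolyAt g.toPt i)) fun y hy => ?_).trans ?_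
    · rw [Gp.toPt_mul, eval_actPolyAt (G.mul_mem g.toPt_mem h.toPt_mem) hy,
        X.act_mul g.toPt_mem h.toPt_mem hy, eval_bind₁, eval_actPolyAt_eq h.toPt_mem hy,
        eval_actPolyAt g.toPt_mem (X.maps_to h.toPt_mem hy)]
    · rw [dirDeriv_bind₁, eval_actPolyAt_eq h.toPt_mem t.pt.toPt_mem]
      rfl

@[simp] theorem Frame.pt_smul (g : G.Gp) (t : X.Frame p) : (g • t).pt = g • t.pt := rfl

/-- Forms seen as functions on frames. -/
def restrictForm (ω : FormFun X p m) : X.Frame p → Pt m := fun t => ω t.pt.toPt t.vec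

open Classical in
/-- Extension of a function on frames by zero. -/
def extendForm (η : X.Frame p → Pt m) : FormFun X p m := fun x v =>
  if h : x ∈ X.carrier ∧ ∀ k, v k ∈ tangentAt X.carrier x then η (Frame.mk x h.1 v h.2) else 0

@[simp] theorem restrictForm_extendForm (η : X.Frame p → Pt m) :
    restrictForm (extendForm η) = η := by
  funext t
  exact dif_pos (c := _ ∧ _) ⟨t.pt.toPt_mem, t.vec_mem⟩

theorem restrictForm_eq_iff {ω ω' : FormFun X p m} : restrictForm ω = restrictForm ω' ↔
    ∀ x ∈ X.carrier, ∀ v : Fin p → Pt X.N, (∀ k, v k ∈ tangentAt X.carrier x) →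
      ω x v = ω' x v :=
  ⟨fun h x hx v hv => congrFun h (Frame.mk x hx v hv),
    fun h => _root_.funext fun t => h _ t.pt.toPt_mem _ t.vec_mem⟩

end AlgGVariety

section matVec

variable {m : ℕ}

theorem matVec_idMatPt (w : Pt m) : matVec m (idMatPt m) w = w := by
  funext i
  simp [matVec, matEntry, idMatPt]

theorem matVec_matMulPt (a b : Pt (m * m)) (w : Pt m) :
    matVec m (matMulPt m a b) w = matVec m a (matVec m b w) := by
  funext i
  simp only [matVec, matEntry, matMulPt, Equiv.symm_apply_apply, Finset.sum_mul, Finset.mul_sum]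
  rw [Finset.sum_comm]
  exact Finset.sum_congr rfl fun j _ => Finset.sum_congr rfl fun k _ => by ring

theorem matVec_smul (a : Pt (m * m)) (c : ℂ) (w : Pt m) :
    matVec m a (c • w) = c • matVec m a w := by
  funext i
  simp only [matVec, Pi.smul_apply, smul_eq_mul, Finset.mul_sum]
  exact Finset.sum_congr rfl fun k _ => by ring

end matVec

namespace AlgGVariety

variable {G : AffAlgGroup} {X : AlgGVariety G} {p m : ℕ}

/-- Translation of functions on frames, twisted by a representation. -/
def translate (r : AlgRep G m) (g : G.Gp) : (X.Frame p → Pt m) →ₗ[ℂ] (X.Frame p → Pt m) where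
  toFun η t := matVec m (r.ρ g.toPt) (η (g⁻¹ • t))
  map_add' _ _ := _root_.funext fun _ => matVec_add _ _ _
  map_smul' _ _ := _root_.funext fun _ => matVec_smul _ _ _

theorem translate_apply (r : AlgRep G m) (g : G.Gp) (η : X.Frame p → Pt m) (t : X.Frame p) :
    translate r g η t = matVec m (r.ρ g.toPt) (η (g⁻¹ • t)) := rfl

theorem translate_mul (r : AlgRep G m) (g h : G.Gp) (η : X.Frame p → Pt m) :
    translate r (g * h) η = translate r g (translate r h η) := by
  funext t
  simp only [translate_apply, Gp.toPt_mul, r.map_mul g.toPt_mem h.toPt_mem, matVec_matMulPt,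
    mul_inv_rev, mul_smul]

@[simp] theorem translate_one (r : AlgRep G m) (η : X.Frame p → Pt m) :
    translate r 1 η = η := by
  funext t
  simp only [translate_apply, Gp.toPt_one, r.map_one, matVec_idMatPt, inv_one, one_smul]

theorem isFormTranslate_iff (r : AlgRep G m) (g : G.Gp) (ω T : FormFun X p m) :
    IsFormTranslate X r g.toPt ω T ↔ restrictForm T = translate r g (restrictForm ω) := by
  constructor
  · intro h
    funext t
    exact h _ t.pt.toPt_mem _ t.vec_mem (X.actPolyAt (G.inv g.toPt)) fun y hy i =>
      (eval_actPolyAt (G.inv_mem g.toPt_mem) hy i).symm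
  · intro h x hx v hv Q hQ
    have h1 := congrFun h (Frame.mk x hx v hv)
    refine h1.trans ?_
    have h2 : (fun k i => ∑ j, v k j * eval x (pderiv j (Q i))) =
        (g⁻¹ • Frame.mk x hx v hv).vec := by
      funext k i
      refine dirDeriv_congr (hv k) fun y hy => ?_
      rw [← hQ y hy, Gp.toPt_inv, eval_actPolyAt (G.inv_mem g.toPt_mem) hy]
    rw [h2]
    rfl

end AlgGVariety

theorem eval_mem_of_forall_mem {Y σ : Type*} (A : Subalgebra ℂ (Y → ℂ)) {F : Y → σ → ℂ}
    (hF : ∀ s, (fun y => F y s) ∈ A) (P : MvPolynomial σ ℂ) : (fun y => eval (F y) P) ∈ A := by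
  induction P using MvPolynomial.induction_on with
  | C c => simp only [eval_C]; exact A.algebraMap_mem c
  | add P Q hP hQ => simp only [map_add]; exact A.add_mem hP hQ
  | mul_X P s hP => simp only [map_mul, eval_X]; exact A.mul_mem hP (hF s)

theorem pderiv_specializeLeft {σ τ : Type*} (y : σ → ℂ) (j : τ) (P : MvPolynomial (σ ⊕ τ) ℂ) :
    pderiv j (specializeLeft y P) = specializeLeft y (pderiv (Sum.inr j) P) := by
  classical
  induction P using MvPolynomial.induction_on with
  | C c => simp [specializeLeft]
  | add P Q hP hQ => simp [hP, hQ]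
  | mul_X P s hP =>
    rw [map_mul, pderiv_mul, hP, pderiv_mul, map_add, map_mul, map_mul]
    congr 2
    rcases s with s | s
    · simp [specializeLeft, pderiv_X]
    · by_cases h : s = j <;> simp [specializeLeft, pderiv_X, h]

theorem AffAlgGroup.comp_inv_mem_coordAlg {G : AffAlgGroup} {f : G.Gp → ℂ}
    (hf : f ∈ G.coordAlg) : (fun g => f g⁻¹) ∈ G.coordAlg := by
  obtain ⟨f', h⟩ := G.isGroupAlgebra.antipode ⟨f, hf⟩
  rw [show (fun g => f g⁻¹) = f'.1 from _root_.funext fun g => (h g).symm]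
  exact f'.2

namespace AlgGVariety

variable {G : AffAlgGroup} {X : AlgGVariety G} {p m : ℕ}

theorem isAlgForm_congr {ω ω' : FormFun X p m} (h : restrictForm ω = restrictForm ω')
    (hω : IsAlgForm X p m ω) : IsAlgForm X p m ω' := by
  rw [restrictForm_eq_iff] at h
  obtain ⟨⟨P, hP⟩, hml⟩ := hω
  have hup : ∀ {x : Pt X.N} {v : Fin p → Pt X.N} (k : Fin p) {a : Pt X.N},
      (∀ l, v l ∈ tangentAt X.carrier x) → a ∈ tangentAt X.carrier x →
      ∀ l, Function.update v k a l ∈ tangentAt X.carrier x := fun k a hv ha l => by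
    by_cases hl : l = k
    · subst hl; simpa using ha
    · simpa [Function.update_of_ne hl] using hv l
  refine ⟨⟨P, fun x hx v hv i => by rw [← h x hx v hv]; exact hP x hx v hv i⟩,
    fun x hx => ⟨fun v k a b hv ha hb => ?_, fun v k t a hv ha => ?_, fun v k l hv hkl hvv => ?_⟩⟩
  · rw [← h x hx _ (hup k hv ha), ← h x hx _ (hup k hv hb),
      ← h x hx _ (hup k hv (add_mem ha hb)), (hml x hx).1 v k a b hv ha hb]
  · rw [← h x hx _ (hup k hv ha), ← h x hx _ (hup k hv (Submodule.smul_mem _ t ha)),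
      (hml x hx).2.1 v k t a hv ha]
  · rw [← h x hx v hv, (hml x hx).2.2 v k l hv hkl hvv]

theorem isAlgForm_smul {ω : FormFun X p m} (hω : IsAlgForm X p m ω)
    (Q : MvPolynomial (Fin X.N) ℂ) : IsAlgForm X p m (fun x v => eval x Q • ω x v) := by
  obtain ⟨⟨P, hP⟩, hml⟩ := hω
  refine ⟨⟨fun i => rename Sum.inl Q * P i, fun x hx v hv i => ?_⟩,
    fun x hx => ⟨fun v k a b hv ha hb => ?_, fun v k t a hv ha => ?_, fun v k l hv hkl hvv => ?_⟩⟩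
  · rw [map_mul, eval_rename, Sum.elim_comp_inl, ← hP x hx v hv i]
    rfl
  · simp only [(hml x hx).1 v k a b hv ha hb, smul_add]
  · simp only [(hml x hx).2.1 v k t a hv ha, smul_comm t]
  · simp only [(hml x hx).2.2 v k l hv hkl hvv, smul_zero]

/-- Multiplication of a form by a function on the variety. -/
def mulForm : (X.Pts → ℂ) →ₗ[ℂ] (X.Frame p → Pt m) →ₗ[ℂ] (X.Frame p → Pt m) :=
  LinearMap.mk₂ ℂ (fun f η t => f t.pt • η t)
    (fun _ _ _ => _root_.funext fun _ => add_smul _ _ _)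
    (fun _ _ _ => _root_.funext fun _ => mul_smul _ _ _)
    (fun _ _ _ => _root_.funext fun _ => smul_add _ _ _)
    (fun c f η => _root_.funext fun t => smul_comm (f t.pt) c (η t))

theorem mulForm_apply (f : X.Pts → ℂ) (η : X.Frame p → Pt m) (t : X.Frame p) :
    mulForm f η t = f t.pt • η t := rfl

variable (X p m) in
/-- Algebraic forms, as functions on frames. -/
def algForms : Submodule ℂ (X.Frame p → Pt m) where
  carrier := {η | IsAlgForm X p m (extendForm η)}
  zero_mem' := isAlgForm_congr (by rw [restrictForm_extendForm]; rfl) (isAlgForm_zero X p)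
  add_mem' h h' := isAlgForm_congr
    (by rw [restrictForm_extendForm]; exact congrArg₂ (· + ·) (restrictForm_extendForm _)
          (restrictForm_extendForm _)) (isAlgForm_add X h h')
  smul_mem' c η h := isAlgForm_congr
    (by
      rw [restrictForm_extendForm]
      funext t
      simp only [restrictForm, eval_C, Pi.smul_apply]
      exact congrArg (c • ·) (congrFun (restrictForm_extendForm η) t))
    (isAlgForm_smul h (C c))

theorem mem_algForms {η : X.Frame p → Pt m} :
    η ∈ algForms X p m ↔ IsAlgForm X p m (extendForm η) := Iff.rfl

theorem restrictForm_mem_algForms {ω : FormFun X p m} (h : IsAlgForm X p m ω) :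
    restrictForm ω ∈ algForms X p m :=
  isAlgForm_congr (restrictForm_extendForm _).symm h

theorem mulForm_mem_algForms {f : X.Pts → ℂ} (hf : f ∈ regFun (Pts.toPt (X := X)))
    {η : X.Frame p → Pt m} (hη : η ∈ algForms X p m) : mulForm f η ∈ algForms X p m := by
  obtain ⟨Q, hQ⟩ := hf
  refine isAlgForm_congr ?_ (isAlgForm_smul hη Q)
  rw [restrictForm_extendForm]
  funext t
  rw [mulForm_apply, hQ]
  exact congrArg (_ • ·) (congrFun (restrictForm_extendForm η) t)

theorem dirDeriv_actPolyAt_mem_coordAlg (x v : Pt X.N) (i : Fin X.N) :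
    (fun y : G.Gp => dirDeriv x v (X.actPolyAt y.toPt i)) ∈ G.coordAlg :=
  ⟨∑ j, C (v j) * specializeRight x (pderiv (Sum.inr j) (X.actPoly i)), fun y => by
    simp [dirDeriv, actPolyAt, pderiv_specializeLeft]⟩

theorem apply_smul_mem_coordAlg {η : X.Frame p → Pt m} (hη : η ∈ algForms X p m)
    (t : X.Frame p) (i : Fin m) : (fun y : G.Gp => η (y • t) i) ∈ G.coordAlg := by
  obtain ⟨⟨P, hP⟩, -⟩ := hη
  have h : ∀ y : G.Gp, η (y • t) i = eval (Sum.elim (y • t).pt.toPt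
      fun s : Fin p × Fin X.N => (y • t).vec s.1 s.2) (P i) := fun y => by
    rw [← hP _ (y • t).pt.toPt_mem _ (y • t).vec_mem i]
    exact congrFun (congrFun (restrictForm_extendForm η) (y • t)).symm i
  rw [_root_.funext h]
  refine eval_mem_of_forall_mem _ ?_ _
  rintro (s | s)
  · have h := comp_orbit_mem_regFun t.pt (polyFun _ (MvPolynomial.X s))
    simp only [polyFun_apply, eval_X] at h
    exact h
  · exact dirDeriv_actPolyAt_mem_coordAlg _ _ _

theorem translate_apply_mem_coordAlg (r : AlgRep G m) {η : X.Frame p → Pt m}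
    (hη : η ∈ algForms X p m) (t : X.Frame p) (i : Fin m) :
    (fun y : G.Gp => translate r y η t i) ∈ G.coordAlg := by
  obtain ⟨P, hP⟩ := r.regular
  have : (fun y : G.Gp => translate r y η t i) =
      ∑ k, (fun y : G.Gp => matEntry (r.ρ y.toPt) i k) * fun y => η (y⁻¹ • t) k := by
    funext y
    simp [translate_apply, matVec]
  rw [this]
  refine Subalgebra.sum_mem _ fun k _ => Subalgebra.mul_mem _ ?_ ?_
  · exact ⟨_, fun y => hP _ y.toPt_mem _⟩
  · exact comp_inv_mem_coordAlg (apply_smul_mem_coordAlg hη t k)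

theorem translate_mulForm (r : AlgRep G m) (g : G.Gp) (f : X.Pts → ℂ) (η : X.Frame p → Pt m) :
    translate r g (mulForm f η) = mulForm (fun x => f (g⁻¹ • x)) (translate r g η) := by
  funext t
  simp only [translate_apply, mulForm_apply, matVec_smul, Frame.pt_smul]

end AlgGVariety

namespace AlgGVariety

variable {G : AffAlgGroup} {X : AlgGVariety G} {p m : ℕ}

/-- A finite-dimensional space of algebraic forms that is stable under translation. -/
structure IsStableFormSpace (r : AlgRep G m) (V : Submodule ℂ (X.Frame p → Pt m)) : Prop where
  finite : FiniteDimensional ℂ V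
  le : V ≤ algForms X p m
  stable : ∀ g, V ≤ V.comap (translate r g)

namespace IsStableFormSpace

variable {r : AlgRep G m} {V W : Submodule ℂ (X.Frame p → Pt m)}

theorem bot : IsStableFormSpace r (⊥ : Submodule ℂ (X.Frame p → Pt m)) :=
  ⟨inferInstance, bot_le, fun _ => bot_le⟩

theorem sup (hV : IsStableFormSpace r V) (hW : IsStableFormSpace r W) :
    IsStableFormSpace r (V ⊔ W) :=
  have := hV.finite
  have := hW.finite
  ⟨inferInstance, sup_le hV.le hW.le, fun g => sup_le
    ((hV.stable g).trans (Submodule.comap_mono le_sup_left))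
    ((hW.stable g).trans (Submodule.comap_mono le_sup_right))⟩

end IsStableFormSpace

/-- The translates of a regular function on a variety span a finite-dimensional space. -/
theorem exists_finite_stable_mem {f : X.Pts → ℂ} (hf : f ∈ regFun (Pts.toPt (X := X))) :
    ∃ N : Submodule ℂ (X.Pts → ℂ), N.FG ∧ f ∈ N ∧ N ≤ (regFun Pts.toPt).toSubmodule ∧
      ∀ (g : G.Gp), ∀ φ ∈ N, (fun x => φ (g • x)) ∈ N := by
  refine ⟨Submodule.span ℂ (Set.range fun (g : G.Gp) x => f (g • x)), ?_,
    Submodule.subset_span ⟨1, by simp⟩, ?_, fun g φ hφ => ?_⟩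
  · obtain ⟨P, hP⟩ := hf
    obtain ⟨k, a, b, h⟩ := exists_eval_sumElim_eq_sum_mul (bind₁ X.actPoly P)
    have : FiniteDimensional ℂ
        (Submodule.span ℂ (Set.range fun i (x : X.Pts) => eval x.toPt (b i))) :=
      FiniteDimensional.span_of_finite ℂ (Set.finite_range _)
    rw [← Module.Finite.iff_fg]
    refine Submodule.finiteDimensional_of_le (Submodule.span_le.2 ?_ : _ ≤
      Submodule.span ℂ (Set.range fun i (x : X.Pts) => eval x.toPt (b i)))
    rintro _ ⟨g, rfl⟩
    have hg : (fun x => f (g • x)) = ∑ i, eval g.toPt (a i) • fun x => eval x.toPt (b i) := by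
      funext x
      have := h g.toPt x.toPt
      rw [eval_bind₁, _root_.funext (eval_actPoly g.toPt_mem x.toPt_mem)] at this
      simpa [hP] using this
    simp only [hg]
    exact Submodule.sum_mem _ fun i _ => Submodule.smul_mem _ _ (Submodule.subset_span ⟨i, rfl⟩)
  · rw [Submodule.span_le]
    rintro _ ⟨g, rfl⟩
    exact comp_smul_mem_regFun g ⟨f, hf⟩
  · induction hφ using Submodule.span_induction with
    | mem _ h =>
      obtain ⟨h, rfl⟩ := h
      exact Submodule.subset_span ⟨h * g, by simp only [mul_smul]⟩
    | zero => exact Submodule.zero_mem _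
    | add _ _ _ _ h h' => exact Submodule.add_mem _ h h'
    | smul c _ _ h => exact Submodule.smul_mem _ c h

namespace IsStableFormSpace

variable {r : AlgRep G m} {V W : Submodule ℂ (X.Frame p → Pt m)}

theorem exists_mulForm_mem (hV : IsStableFormSpace r V) {η : X.Frame p → Pt m} (hη : η ∈ V)
    {f : X.Pts → ℂ} (hf : f ∈ regFun (Pts.toPt (X := X))) :
    ∃ W : Submodule ℂ (X.Frame p → Pt m), IsStableFormSpace r W ∧ mulForm f η ∈ W := by
  obtain ⟨N, hfg, hfN, hN, hst⟩ := exists_finite_stable_mem hf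
  have := hV.finite
  refine ⟨Submodule.map₂ mulForm N V, ⟨?_, ?_, fun g => ?_⟩,
    Submodule.apply_mem_map₂ _ hfN hη⟩
  · exact Module.Finite.iff_fg.2 (hfg.map₂ _ (Module.Finite.iff_fg.1 hV.finite))
  · exact Submodule.map₂_le.2 fun φ hφ ω hω => mulForm_mem_algForms (hN hφ) (hV.le hω)
  · refine Submodule.map₂_le.2 fun φ hφ ω hω => ?_
    rw [Submodule.mem_comap, translate_mulForm]
    exact Submodule.apply_mem_map₂ _ (hst g⁻¹ φ hφ) (hV.stable g hω)

/-- The coordinates of the translates of a form are regular functions on the group. -/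
theorem exists_translate_eq_sum (hV : IsStableFormSpace r V) {η : X.Frame p → Pt m}
    (hη : η ∈ V) : ∃ (d : ℕ) (a : Fin d → G.coordAlg) (b : Fin d → X.Frame p → Pt m),
      (∀ l, b l ∈ V) ∧ ∀ y, translate r y η = ∑ l, (a l).1 y • b l := by
  have := hV.finite
  let D : Submodule ℂ (Module.Dual ℂ V) :=
    { carrier := {φ | (fun y => φ ⟨translate r y η, hV.stable y hη⟩) ∈ G.coordAlg}
      zero_mem' := G.coordAlg.zero_mem
      add_mem' := fun h h' => G.coordAlg.add_mem h h'
      smul_mem' := fun c _ h => G.coordAlg.smul_mem h c }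
  have hD : D = ⊤ := by
    have hbot : D.dualCoannihilator = ⊥ := by
      rw [eq_bot_iff]
      intro v hv
      rw [Submodule.mem_dualCoannihilator] at hv
      refine (Submodule.mem_bot ℂ).2
        (Subtype.ext (_root_.funext fun t => _root_.funext fun i => ?_))
      let φ : Module.Dual ℂ V :=
        { toFun := fun v => v.1 t i, map_add' := fun _ _ => rfl, map_smul' := fun _ _ => rfl }
      exact hv φ (translate_apply_mem_coordAlg r (hV.le hη) t i)
    rw [← Subspace.dualCoannihilator_dualAnnihilator_eq (W := D), hbot,
      Submodule.dualAnnihilator_bot]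
  let B := Module.finBasis ℂ V
  have hB : ∀ l, B.coord l ∈ D := fun l => hD ▸ Submodule.mem_top
  refine ⟨_, fun l => ⟨_, hB l⟩, fun l => B l, fun l => (B l).2, fun y => ?_⟩
  have := congrArg V.subtype (B.sum_repr ⟨translate r y η, hV.stable y hη⟩)
  rw [map_sum] at this
  exact this.symm

end IsStableFormSpace

end AlgGVariety

namespace AlgGVariety

variable {G : AffAlgGroup} {X : AlgGVariety G} {p m q : ℕ}

variable (G q) in
/-- The coordinates of a tuple of group elements. -/
def tupleCoord (g : Fin q → G.Gp) : Fin q × Fin G.n → ℂ := fun s => (g s.1).toPt s.2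

variable (X p q) in
/-- Cochains with values in a finite-dimensional stable space of algebraic forms whose
coordinates are regular. -/
def locFinCochain (r : AlgRep G m) : Submodule ℂ ((Fin q → G.Gp) → X.Frame p → Pt m) where
  carrier := {F | (∃ V, IsStableFormSpace r V ∧ ∀ g, F g ∈ V) ∧
    ∀ φ : Module.Dual ℂ (X.Frame p → Pt m), (fun g => φ (F g)) ∈ regFun (tupleCoord G q)}
  zero_mem' := ⟨⟨⊥, .bot, fun _ => Submodule.zero_mem _⟩, fun φ => by
    simp only [Pi.zero_apply, map_zero]
    exact Subalgebra.zero_mem _⟩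
  add_mem' := by
    rintro F F' ⟨⟨V, hV, hF⟩, h⟩ ⟨⟨V', hV', hF'⟩, h'⟩
    refine ⟨⟨V ⊔ V', hV.sup hV', fun g => Submodule.add_mem_sup (hF g) (hF' g)⟩, fun φ => ?_⟩
    simp only [Pi.add_apply F F', map_add]
    exact Subalgebra.add_mem _ (h φ) (h' φ)
  smul_mem' := by
    rintro c F ⟨⟨V, hV, hF⟩, h⟩
    refine ⟨⟨V, hV, fun g => Submodule.smul_mem _ _ (hF g)⟩, fun φ => ?_⟩
    simp only [Pi.smul_apply c F, map_smul]
    exact Subalgebra.smul_mem _ (h φ) c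

variable {r : AlgRep G m}

theorem smul_mem_locFinCochain {V : Submodule ℂ (X.Frame p → Pt m)} (hV : IsStableFormSpace r V)
    {η : X.Frame p → Pt m} (hη : η ∈ V) {c : (Fin q → G.Gp) → ℂ}
    (hc : c ∈ regFun (tupleCoord G q)) : (fun g => c g • η) ∈ locFinCochain X p q r := by
  refine ⟨⟨V, hV, fun g => Submodule.smul_mem _ _ hη⟩, fun φ => ?_⟩
  have : (fun g => φ (c g • η)) = φ η • c := by
    funext g
    simp [mul_comm]
  rw [this]
  exact Subalgebra.smul_mem _ hc _

theorem exists_eq_sum_of_mem_locFinCochain {F : (Fin q → G.Gp) → X.Frame p → Pt m}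
    (hF : F ∈ locFinCochain X p q r) :
    ∃ (V : Submodule ℂ (X.Frame p → Pt m)) (d : ℕ) (b : Fin d → X.Frame p → Pt m)
      (c : Fin d → regFun (tupleCoord G q)), IsStableFormSpace r V ∧
        Submodule.span ℂ (Set.range b) = V ∧ ∀ g, F g = ∑ j, (c j).1 g • b j := by
  obtain ⟨⟨V, hV, hFV⟩, h⟩ := hF
  have := hV.finite
  let B := Module.finBasis ℂ V
  choose φ hφ using fun j => LinearMap.exists_extend (B.coord j)
  refine ⟨V, _, fun j => B j, fun j => ⟨_, h (φ j)⟩, hV, ?_, fun g => ?_⟩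
  · have := congrArg (Submodule.map V.subtype) B.span_eq
    rw [Submodule.map_span, Submodule.map_subtype_top, ← Set.range_comp] at this
    exact this
  · have h1 := congrArg V.subtype (B.sum_repr ⟨F g, hFV g⟩)
    rw [map_sum] at h1
    refine h1.symm.trans (Finset.sum_congr rfl fun j _ => ?_)
    rw [map_smul]
    exact congrArg (· • _) (LinearMap.congr_fun (hφ j) ⟨F g, hFV g⟩).symm

theorem restrictForm_mem_locFinCochain {f : (Fin q → Pt G.n) → FormFun X p m}
    (hf : IsLocFinAlgFormCochain X r p q f) :
    (fun g : Fin q → G.Gp => restrictForm (f fun a => (g a).toPt)) ∈ locFinCochain X p q r := by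
  obtain ⟨-, d, bas, coef, hbas, hst, hcoef, hsum⟩ := hf
  let V := Submodule.span ℂ (Set.range fun j => restrictForm (bas j))
  have hmem : ∀ j, restrictForm (bas j) ∈ V := fun j => Submodule.subset_span ⟨j, rfl⟩
  have hV : IsStableFormSpace r V := by
    refine ⟨FiniteDimensional.span_of_finite ℂ (Set.finite_range _), ?_, fun g => ?_⟩
    · rw [Submodule.span_le]
      rintro _ ⟨j, rfl⟩
      exact restrictForm_mem_algForms (hbas j)
    · rw [Submodule.span_le]
      rintro _ ⟨j, rfl⟩
      obtain ⟨a, ha⟩ := hst g.toPt g.toPt_mem j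
      have h := ha (extendForm (translate r g (restrictForm (bas j))))
        ((isFormTranslate_iff r g _ _).2 (restrictForm_extendForm _))
      have h' : translate r g (restrictForm (bas j)) = ∑ l, a l • restrictForm (bas l) := by
        rw [← restrictForm_extendForm (translate r g (restrictForm (bas j)))]
        funext t
        rw [Finset.sum_apply]
        exact h _ t.pt.toPt_mem _ t.vec_mem
      change translate r g (restrictForm (bas j)) ∈ V
      rw [h']
      exact Submodule.sum_mem _ fun l _ => Submodule.smul_mem _ _ (hmem l)
  have hF : (fun g : Fin q → G.Gp => restrictForm (f fun a => (g a).toPt)) =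
      ∑ j, fun g => coef j (fun a => (g a).toPt) • restrictForm (bas j) := by
    funext g t
    rw [Finset.sum_apply, Finset.sum_apply]
    exact hsum _ (fun a => (g a).toPt_mem) _ t.pt.toPt_mem _ t.vec_mem
  rw [hF]
  refine Submodule.sum_mem _ fun j _ => smul_mem_locFinCochain hV (hmem j) ?_
  obtain ⟨R, hR⟩ := hcoef j
  exact ⟨R, fun g => hR _ fun a => (g a).toPt_mem⟩

theorem exists_toPt_eq {g : Fin q → Pt G.n} (hg : ∀ a, g a ∈ G.carrier) :
    ∃ g' : Fin q → G.Gp, g = fun a => (g' a).toPt := ⟨fun a => Gp.ofPt (g a) (hg a), rfl⟩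

theorem extendForm_apply (η : X.Frame p → Pt m) {x : Pt X.N} (hx : x ∈ X.carrier)
    {v : Fin p → Pt X.N} (hv : ∀ k, v k ∈ tangentAt X.carrier x) :
    extendForm η x v = η (Frame.mk x hx v hv) :=
  congrFun (restrictForm_extendForm η) (Frame.mk x hx v hv)

open Classical in
/-- Extension by zero of a cochain on the points of the group. -/
def extendCochain (F : (Fin q → G.Gp) → X.Frame p → Pt m) (g : Fin q → Pt G.n) :
    FormFun X p m :=
  if hg : ∀ a, g a ∈ G.carrier then extendForm (F fun a => Gp.ofPt (g a) (hg a)) else 0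

theorem extendCochain_toPt (F : (Fin q → G.Gp) → X.Frame p → Pt m) (g : Fin q → G.Gp) :
    extendCochain F (fun a => (g a).toPt) = extendForm (F g) :=
  dif_pos fun a => (g a).toPt_mem

theorem isLocFinAlgFormCochain_extendCochain {F : (Fin q → G.Gp) → X.Frame p → Pt m}
    (hF : F ∈ locFinCochain X p q r) : IsLocFinAlgFormCochain X r p q (extendCochain F) := by
  obtain ⟨V, d, b, c, hV, hb, hsum⟩ := exists_eq_sum_of_mem_locFinCochain hF
  have hbV : ∀ j, b j ∈ V := fun j => by
    rw [← hb]
    exact Submodule.subset_span ⟨j, rfl⟩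
  have hc : ∀ j, ∃ P, ∀ g, (c j).1 g = eval (tupleCoord G q g) P := fun j => (c j).2
  choose P hP using hc
  refine ⟨?_, d, fun j => extendForm (b j), fun j g => eval (fun s => g s.1 s.2) (P j),
    ?_, ?_, ?_, ?_⟩
  · intro g hg
    obtain ⟨g, rfl⟩ := exists_toPt_eq hg
    rw [extendCochain_toPt, ← mem_algForms, hsum]
    exact hV.le (Submodule.sum_mem _ fun l _ => Submodule.smul_mem _ _ (hbV l))
  · exact fun j => mem_algForms.1 (hV.le (hbV j))
  · intro g hg j
    have h : translate r (Gp.ofPt g hg) (b j) ∈ Submodule.span ℂ (Set.range b) := by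
      rw [hb]
      exact hV.stable _ (hbV j)
    obtain ⟨a, ha⟩ := (Submodule.mem_span_range_iff_exists_fun ℂ).1 h
    refine ⟨a, fun T hT x hx v hv => ?_⟩
    have h1 := (isFormTranslate_iff r (Gp.ofPt g hg) _ _).1 hT
    rw [restrictForm_extendForm, ← ha] at h1
    simp only [extendForm_apply _ hx hv]
    refine (congrFun h1 (Frame.mk x hx v hv)).trans ?_
    rw [Finset.sum_apply]
    rfl
  · exact fun j => ⟨P j, fun _ _ => rfl⟩
  · intro g hg x hx v hv
    obtain ⟨g, rfl⟩ := exists_toPt_eq hg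
    simp only [extendCochain_toPt, extendForm_apply _ hx hv, hsum, hP, Finset.sum_apply]
    rfl

end AlgGVariety

namespace AlgGVariety

variable {G : AffAlgGroup} {X : AlgGVariety G} {p m q : ℕ}

/-- An equivariant average from functions on the group to functions on a variety. -/
structure IsAverage (R : (G.Gp → ℂ) →ₗ[ℂ] X.Pts → ℂ) : Prop where
  map_one : R 1 = 1
  mem : ∀ F ∈ G.coordAlg, R F ∈ regFun (Pts.toPt (X := X))
  equivariant : ∀ g, ∀ F ∈ G.coordAlg, ∀ x, R (fun h => F (g * h)) x = R F (g • x)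

theorem exists_isAverage (hG : G.IsConnected) {L : AlgSubgroup G} (hL : L.toGrp.IsConnected)
    (hred : L.toGrp.IsReductive) {x₀ : Pt X.N} (hX : X.IsQuotientBy L x₀) :
    ∃ R : (G.Gp → ℂ) →ₗ[ℂ] X.Pts → ℂ, IsAverage R := by
  obtain ⟨R, h1, hR⟩ := exists_average hG hL hred hX
  obtain ⟨R', hR'⟩ := LinearMap.exists_extend (p := G.coordAlg.toSubmodule)
    ((regFun (Pts.toPt (X := X))).toSubmodule.subtype ∘ₗ R)
  have h : ∀ F : G.coordAlg, R' F.1 = (R F).1 := fun F => LinearMap.congr_fun hR' F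
  refine ⟨R', ?_, fun F hF => ?_, fun g F hF x => ?_⟩
  · exact (h 1).trans (congrArg Subtype.val h1)
  · rw [h ⟨F, hF⟩]
    exact Subtype.prop _
  · rw [h ⟨F, hF⟩, ← hR, ← h]
    refine congrFun (congrArg R' (_root_.funext fun y => ?_)) x
    rw [lTr_val]

/-- The average of a family of forms. -/
def avgForm (R : (G.Gp → ℂ) →ₗ[ℂ] X.Pts → ℂ) :
    (G.Gp → X.Frame p → Pt m) →ₗ[ℂ] (X.Frame p → Pt m) where
  toFun φ t i := R (fun y => φ y t i) t.pt
  map_add' φ ψ := _root_.funext fun t => _root_.funext fun i => congrFun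
    (R.map_add (fun y => φ y t i) fun y => ψ y t i) t.pt
  map_smul' c φ := _root_.funext fun t => _root_.funext fun i => congrFun
    (R.map_smul c fun y => φ y t i) t.pt

theorem avgForm_apply (R : (G.Gp → ℂ) →ₗ[ℂ] X.Pts → ℂ) (φ : G.Gp → X.Frame p → Pt m)
    (t : X.Frame p) (i : Fin m) : avgForm R φ t i = R (fun y => φ y t i) t.pt := rfl

theorem avgForm_smul (R : (G.Gp → ℂ) →ₗ[ℂ] X.Pts → ℂ) (a : G.Gp → ℂ) (η : X.Frame p → Pt m) :
    avgForm R (fun y => a y • η) = mulForm (R a) η := by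
  funext t i
  have : (fun y => (a y • η) t i) = η t i • a := by
    funext y
    exact mul_comm _ _
  rw [avgForm_apply, this, map_smul]
  exact mul_comm _ _

theorem IsAverage.avgForm_const {R : (G.Gp → ℂ) →ₗ[ℂ] X.Pts → ℂ} (hR : IsAverage R)
    (η : X.Frame p → Pt m) : avgForm R (fun _ => η) = η := by
  have h := avgForm_smul R 1 η
  simp only [Pi.one_apply, one_smul, hR.map_one] at h
  rw [h]
  funext t
  rw [mulForm_apply, Pi.one_apply, one_smul]

theorem IsAverage.translate_avgForm {R : (G.Gp → ℂ) →ₗ[ℂ] X.Pts → ℂ} (hR : IsAverage R)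
    (r : AlgRep G m) (g : G.Gp) {φ : G.Gp → X.Frame p → Pt m}
    (hφ : ∀ t i, (fun y => φ y t i) ∈ G.coordAlg) :
    translate r g (avgForm R φ) = avgForm R fun y => translate r g (φ (g⁻¹ * y)) := by
  funext t i
  have h : (fun y => translate r g (φ (g⁻¹ * y)) t i) =
      ∑ k, matEntry (r.ρ g.toPt) i k • fun y => φ (g⁻¹ * y) (g⁻¹ • t) k := by
    funext y
    simp [translate_apply, matVec]
  rw [avgForm_apply, h, map_sum, Finset.sum_apply, translate_apply, matVec]
  refine Finset.sum_congr rfl fun k _ => ?_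
  rw [map_smul, Pi.smul_apply, hR.equivariant g⁻¹ (fun y => φ y (g⁻¹ • t) k) (hφ _ _)]
  rfl

/-- Multiplication of two consecutive entries of a tuple. -/
def mulConsecutive (g : Fin (q + 1) → G.Gp) (a : Fin q) : Fin q → G.Gp := fun k =>
  if (k : ℕ) < a then g k.castSucc else if (k : ℕ) = a then g k.castSucc * g k.succ else g k.succ

theorem mulInsert_toPt (g : Fin (q + 1) → G.Gp) (a : Fin q) :
    mulInsert G (fun k => (g k).toPt) a = fun k => (mulConsecutive g a k).toPt := by
  funext k
  unfold mulInsert mulConsecutive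
  split_ifs <;> rfl

theorem mulConsecutive_cons_zero (z : G.Gp) (g : Fin (q + 1) → G.Gp) :
    mulConsecutive (Fin.cons z g : Fin (q + 2) → G.Gp) 0 =
      Fin.cons (z * g 0) fun a => g a.succ := by
  funext k
  refine Fin.cases ?_ (fun k => ?_) k <;> simp [mulConsecutive]

theorem mulConsecutive_cons_succ (z : G.Gp) (g : Fin (q + 1) → G.Gp) (a : Fin q) :
    mulConsecutive (Fin.cons z g : Fin (q + 2) → G.Gp) a.succ =
      Fin.cons z (mulConsecutive g a) := by
  funext k
  refine Fin.cases ?_ (fun k => ?_) k <;> simp [mulConsecutive]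

theorem castSucc_cons (z : G.Gp) (g : Fin (q + 1) → G.Gp) :
    (fun a : Fin (q + 1) => (Fin.cons z g : Fin (q + 2) → G.Gp) a.castSucc) =
      Fin.cons z fun a : Fin q => g a.castSucc := by
  funext k
  refine Fin.cases ?_ (fun k => ?_) k <;> simp

/-- Regular functions on a product split into products of regular functions. -/
theorem exists_cons_inv_eq_sum_mul {c : (Fin (q + 1) → G.Gp) → ℂ}
    (hc : c ∈ regFun (tupleCoord G (q + 1))) :
    ∃ (k : ℕ) (α : Fin k → G.coordAlg) (β : Fin k → regFun (tupleCoord G q)),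
      ∀ y g, c (Fin.cons y⁻¹ g) = ∑ i, (α i).1 y * (β i).1 g := by
  obtain ⟨P, hP⟩ := hc
  let e : Fin (q + 1) × Fin G.n → Fin G.n ⊕ Fin q × Fin G.n := fun s =>
    Fin.cases (Sum.inl s.2) (fun a => Sum.inr (a, s.2)) s.1
  obtain ⟨k, a, b, h⟩ := exists_eval_sumElim_eq_sum_mul (rename e P)
  refine ⟨k, fun i => ⟨_, comp_inv_mem_coordAlg (polyFun _ (a i)).2⟩, fun i => polyFun _ (b i),
    fun y g => ?_⟩
  have h' := h y⁻¹.toPt (tupleCoord G q g)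
  rw [eval_rename] at h'
  rw [hP]
  refine Eq.trans ?_ h'
  congr 2
  funext ⟨s, j⟩
  refine Fin.cases ?_ (fun s => ?_) s <;> simp [tupleCoord, e]

variable {r : AlgRep G m}

/-- The contracting homotopy. -/
def homotopy (R : (G.Gp → ℂ) →ₗ[ℂ] X.Pts → ℂ) (r : AlgRep G m)
    (F : (Fin (q + 1) → G.Gp) → X.Frame p → Pt m) (g : Fin q → G.Gp) : X.Frame p → Pt m :=
  avgForm R fun y => translate r y (F (Fin.cons y⁻¹ g))

theorem exists_translate_cons_eq_sum {F : (Fin (q + 1) → G.Gp) → X.Frame p → Pt m}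
    (hF : F ∈ locFinCochain X p (q + 1) r) :
    ∃ V : Submodule ℂ (X.Frame p → Pt m), IsStableFormSpace r V ∧
      ∃ (ι : Type) (_ : Fintype ι) (α : ι → G.coordAlg) (β : ι → regFun (tupleCoord G q))
        (b : ι → X.Frame p → Pt m), (∀ i, b i ∈ V) ∧
        ∀ y g, translate r y (F (Fin.cons y⁻¹ g)) = ∑ i, ((α i).1 y * (β i).1 g) • b i := by
  obtain ⟨V, d, b, c, hV, hb, hsum⟩ := exists_eq_sum_of_mem_locFinCochain hF
  have hbV : ∀ j, b j ∈ V := fun j => by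
    rw [← hb]
    exact Submodule.subset_span ⟨j, rfl⟩
  choose k α β h using fun j => exists_cons_inv_eq_sum_mul (c j).2
  choose d' a b' hb' ha using fun j => hV.exists_translate_eq_sum (hbV j)
  refine ⟨V, hV, (Σ j, Fin (k j) × Fin (d' j)), inferInstance,
    fun s => α s.1 s.2.1 * a s.1 s.2.2, fun s => β s.1 s.2.1, fun s => b' s.1 s.2.2,
    fun s => hb' _ _, fun y g => ?_⟩
  rw [hsum, map_sum, Fintype.sum_sigma]
  refine Finset.sum_congr rfl fun j _ => ?_
  rw [map_smul, ha, h, Finset.sum_smul_sum, Fintype.sum_prod_type]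
  refine Finset.sum_congr rfl fun s _ => Finset.sum_congr rfl fun l _ => ?_
  rw [smul_smul]
  exact congrArg (· • b' j l) (mul_right_comm _ _ _)

theorem IsAverage.homotopy_mem {R : (G.Gp → ℂ) →ₗ[ℂ] X.Pts → ℂ} (hR : IsAverage R)
    {F : (Fin (q + 1) → G.Gp) → X.Frame p → Pt m} (hF : F ∈ locFinCochain X p (q + 1) r) :
    homotopy R r F ∈ locFinCochain X p q r := by
  obtain ⟨V, hV, ι, _, α, β, b, hb, h⟩ := exists_translate_cons_eq_sum hF
  have hsum : homotopy R r F = ∑ i, fun g => (β i).1 g • mulForm (R (α i).1) (b i) := by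
    funext g
    have : (fun y => translate r y (F (Fin.cons y⁻¹ g))) =
        ∑ i, (β i).1 g • fun y => (α i).1 y • b i := by
      funext y
      rw [h, Finset.sum_apply]
      refine Finset.sum_congr rfl fun i _ => ?_
      rw [Pi.smul_apply, smul_smul, mul_comm]
    rw [homotopy, this, map_sum, Finset.sum_apply]
    refine Finset.sum_congr rfl fun i _ => ?_
    rw [map_smul, avgForm_smul]
  rw [hsum]
  refine Submodule.sum_mem _ fun i _ => ?_
  obtain ⟨W, hW, hmem⟩ := hV.exists_mulForm_mem (hb i) (hR.mem _ (α i).2)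
  exact smul_mem_locFinCochain hW hmem (β i).2

theorem translate_cons_mem_coordAlg {F : (Fin (q + 1) → G.Gp) → X.Frame p → Pt m}
    (hF : F ∈ locFinCochain X p (q + 1) r) (g : Fin q → G.Gp) (t : X.Frame p) (i : Fin m) :
    (fun y => translate r y (F (Fin.cons y⁻¹ g)) t i) ∈ G.coordAlg := by
  obtain ⟨V, hV, ι, _, α, β, b, hb, h⟩ := exists_translate_cons_eq_sum hF
  have : (fun y => translate r y (F (Fin.cons y⁻¹ g)) t i) =
      ∑ s, ((β s).1 g * b s t i) • (α s).1 := by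
    funext y
    rw [h, Finset.sum_apply, Finset.sum_apply, Finset.sum_apply]
    refine Finset.sum_congr rfl fun s _ => ?_
    simp only [Pi.smul_apply, smul_eq_mul]
    ring
  rw [this]
  exact Subalgebra.sum_mem _ fun s _ => Subalgebra.smul_mem _ (α s).2 _

theorem IsAverage.eq_coboundary {R : (G.Gp → ℂ) →ₗ[ℂ] X.Pts → ℂ} (hR : IsAverage R)
    {F : (Fin (q + 1) → G.Gp) → X.Frame p → Pt m} (hF : F ∈ locFinCochain X p (q + 1) r)
    (hcoc : ∀ g : Fin (q + 2) → G.Gp, translate r (g 0) (F fun a => g a.succ) +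
      ((-1 : ℤ) ^ (q + 2)) • F (fun a => g a.castSucc) +
      ∑ a : Fin (q + 1), ((-1 : ℤ) ^ ((a : ℕ) + 1)) • F (mulConsecutive g a) = 0)
    (g : Fin (q + 1) → G.Gp) :
    F g = translate r (g 0) (homotopy R r F fun a => g a.succ) +
      ((-1 : ℤ) ^ (q + 1)) • homotopy R r F (fun a => g a.castSucc) +
      ∑ a : Fin q, ((-1 : ℤ) ^ ((a : ℕ) + 1)) • homotopy R r F (mulConsecutive g a) := by
  let Φ : (Fin q → G.Gp) → G.Gp → X.Frame p → Pt m := fun g y =>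
    translate r y (F (Fin.cons y⁻¹ g))
  have hΦ : ∀ g, homotopy R r F g = avgForm R (Φ g) := fun g => rfl
  have h0 : translate r (g 0) (homotopy R r F fun a => g a.succ) =
      avgForm R fun y => translate r y (F (Fin.cons (y⁻¹ * g 0) fun a => g a.succ)) := by
    rw [hΦ, hR.translate_avgForm r (g 0) (translate_cons_mem_coordAlg hF _)]
    congr 1
    funext y
    rw [← translate_mul, mul_inv_cancel_left, mul_inv_rev, inv_inv]
  have key : (fun _ : G.Gp => F g) =
      (fun y => translate r y (F (Fin.cons (y⁻¹ * g 0) fun a => g a.succ))) +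
      ((-1 : ℤ) ^ (q + 1)) • Φ (fun a => g a.castSucc) +
      ∑ a : Fin q, ((-1 : ℤ) ^ ((a : ℕ) + 1)) • Φ (mulConsecutive g a) := by
    funext y
    have h := congrArg (translate r y) (hcoc (Fin.cons y⁻¹ g))
    simp only [Fin.cons_zero, Fin.cons_succ, castSucc_cons, Fin.sum_univ_succ,
      mulConsecutive_cons_zero, mulConsecutive_cons_succ, map_add, map_sum, map_zsmul, map_zero,
      ← translate_mul, mul_inv_cancel, translate_one, Fin.val_zero, Fin.val_succ] at h
    simp only [Pi.add_apply, Pi.smul_apply, Finset.sum_apply, Φ]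
    rw [← sub_eq_zero, ← h]
    simp only [pow_succ, pow_zero, mul_neg, mul_one, neg_neg, neg_smul, one_smul,
      Finset.sum_neg_distrib]
    abel
  rw [h0]
  simp only [hΦ]
  rw [← map_zsmul, ← map_add]
  simp only [← map_zsmul]
  rw [← map_sum, ← map_add, ← key, hR.avgForm_const]

end AlgGVariety

namespace AlgGVariety

variable {G : AffAlgGroup} {X : AlgGVariety G} {p m : ℕ}

theorem isInvariantForm_iff (r : AlgRep G m) (ω : FormFun X p m) :
    (∀ g ∈ G.carrier, ∀ T, IsFormTranslate X r g ω T →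
      ∀ x ∈ X.carrier, ∀ v : Fin p → Pt X.N, (∀ k, v k ∈ tangentAt X.carrier x) →
        T x v - ω x v = 0) ↔ IsInvariantForm X r ω := by
  refine ⟨fun h g hg => ?_, fun h g hg T hT x hx v hv => ?_⟩
  · refine (isFormTranslate_iff r (Gp.ofPt g hg) ω ω).2 ?_
    rw [← restrictForm_extendForm (translate r (Gp.ofPt g hg) (restrictForm ω)),
      restrictForm_eq_iff]
    exact fun x hx v hv => (sub_eq_zero.1 (h g hg _ ((isFormTranslate_iff r
      (Gp.ofPt g hg) _ _).2 (restrictForm_extendForm _)) x hx v hv)).symm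
  · have h1 := (isFormTranslate_iff r (Gp.ofPt g hg) ω ω).1 (h g hg)
    have h2 := (isFormTranslate_iff r (Gp.ofPt g hg) ω T).1 hT
    rw [sub_eq_zero]
    exact restrictForm_eq_iff.1 (h2.trans h1.symm) x hx v hv

/-- In positive degree, an average makes every cocycle a coboundary. -/
theorem IsAverage.exists_eq_coboundary {R : (G.Gp → ℂ) →ₗ[ℂ] X.Pts → ℂ} (hR : IsAverage R)
    (r : AlgRep G m) (q : ℕ) (f : (Fin (q + 1) → Pt G.n) → FormFun X p m)
    (hf : IsLocFinAlgFormCochain X r p (q + 1) f)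
    (hcoc : ∀ g : Fin (q + 2) → Pt G.n, (∀ a, g a ∈ G.carrier) →
      ∀ T, IsFormTranslate X r (g 0) (f (fun a => g a.succ)) T →
        ∀ x ∈ X.carrier, ∀ v : Fin p → Pt X.N, (∀ k, v k ∈ tangentAt X.carrier x) →
          T x v + ((-1 : ℤ) ^ (q + 2)) • f (fun a => g a.castSucc) x v
            + ∑ a : Fin (q + 1), ((-1 : ℤ) ^ ((a : ℕ) + 1)) • f (mulInsert G g a) x v = 0) :
    ∃ h : (Fin q → Pt G.n) → FormFun X p m, IsLocFinAlgFormCochain X r p q h ∧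
      ∀ g : Fin (q + 1) → Pt G.n, (∀ a, g a ∈ G.carrier) →
        ∀ T, IsFormTranslate X r (g 0) (h (fun a => g a.succ)) T →
          ∀ x ∈ X.carrier, ∀ v : Fin p → Pt X.N, (∀ k, v k ∈ tangentAt X.carrier x) →
            f g x v = T x v + ((-1 : ℤ) ^ (q + 1)) • h (fun a => g a.castSucc) x v
              + ∑ a : Fin q, ((-1 : ℤ) ^ ((a : ℕ) + 1)) • h (mulInsert G g a) x v := by
  let F : (Fin (q + 1) → G.Gp) → X.Frame p → Pt m := fun g =>
    restrictForm (f fun a => (g a).toPt)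
  have hF : F ∈ locFinCochain X p (q + 1) r := restrictForm_mem_locFinCochain hf
  refine ⟨extendCochain (homotopy R r F),
    isLocFinAlgFormCochain_extendCochain (hR.homotopy_mem hF), fun g hg T hT x hx v hv => ?_⟩
  obtain ⟨g, rfl⟩ := exists_toPt_eq hg
  have h1 := hR.eq_coboundary hF (fun g => ?_) g
  · have h2 := (isFormTranslate_iff r (g 0) _ T).1 hT
    rw [extendCochain_toPt _ fun a => g a.succ, restrictForm_extendForm] at h2
    rw [← h2] at h1
    rw [extendCochain_toPt _ fun a => g a.castSucc]
    simp only [mulInsert_toPt, extendCochain_toPt, extendForm_apply _ hx hv]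
    refine (congrFun h1 (Frame.mk x hx v hv)).trans ?_
    simp only [Pi.add_apply, Finset.sum_apply]
    rfl
  · funext t
    have h3 := hcoc (fun a => (g a).toPt) (fun a => (g a).toPt_mem)
      (extendForm (translate r (g 0) (F fun a => g a.succ)))
      ((isFormTranslate_iff r (g 0) _ _).2 (restrictForm_extendForm _))
      _ t.pt.toPt_mem _ t.vec_mem
    rw [extendForm_apply _ t.pt.toPt_mem t.vec_mem] at h3
    simp only [mulInsert_toPt] at h3
    refine Eq.trans ?_ h3
    simp only [Pi.add_apply, Finset.sum_apply]
    rfl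

end AlgGVariety

end

/-- For `X = G/G_red` and a finite-dimensional algebraic
`G`-module `𝔞`, the locally finite algebraic group cohomology of `G` with
coefficients in the module `Ω^p(X, 𝔞)` of algebraic de Rham forms satisfies
`H^0_alg(G, Ω^p(X, 𝔞)) = Ω^p(X, 𝔞)^G` and `H^q_alg(G, Ω^p(X, 𝔞)) = 0` for
`q > 0`. -/
theorem cohomology_with_form_coefficients
    (G : AffAlgGroup) (hG : G.IsConnected) (LD : LeviDecomposition G)
    (X : AlgGVariety G) (x₀ : Pt X.N) (hX : X.IsQuotientBy LD.L x₀)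
    (m : ℕ) (r : AlgRep G m) (p : ℕ) :
    -- `H⁰`: the 0-cocycles are exactly the `G`-invariant forms
    (∀ ω : FormFun X p m, IsAlgForm X p m ω →
      ((∀ g ∈ G.carrier, ∀ T, IsFormTranslate X r g ω T →
          ∀ x ∈ X.carrier, ∀ v : Fin p → Pt X.N,
            (∀ k, v k ∈ tangentAt X.carrier x) → T x v - ω x v = 0) ↔
        IsInvariantForm X r ω)) ∧
    -- `H^q = 0` for `q > 0`: every locally finite algebraic `(q+1)`-cocycle
    -- with values in `Ω^p(X, 𝔞)` is the coboundary of a locally finite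
    -- algebraic `q`-cochain
    (∀ (q : ℕ) (f : (Fin (q + 1) → Pt G.n) → FormFun X p m),
      IsLocFinAlgFormCochain X r p (q + 1) f →
      -- cocycle condition `δf = 0`
      (∀ g : Fin (q + 2) → Pt G.n, (∀ a, g a ∈ G.carrier) →
        ∀ T, IsFormTranslate X r (g 0) (f (fun a => g a.succ)) T →
          ∀ x ∈ X.carrier, ∀ v : Fin p → Pt X.N,
            (∀ k, v k ∈ tangentAt X.carrier x) →
            T x v + ((-1 : ℤ) ^ (q + 2)) • f (fun a => g a.castSucc) x v
              + ∑ a : Fin (q + 1), ((-1 : ℤ) ^ ((a : ℕ) + 1)) •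
                  f (mulInsert G g a) x v = 0) →
      -- conclusion: `f = δh`
      ∃ h : (Fin q → Pt G.n) → FormFun X p m,
        IsLocFinAlgFormCochain X r p q h ∧
        ∀ g : Fin (q + 1) → Pt G.n, (∀ a, g a ∈ G.carrier) →
          ∀ T, IsFormTranslate X r (g 0) (h (fun a => g a.succ)) T →
            ∀ x ∈ X.carrier, ∀ v : Fin p → Pt X.N,
              (∀ k, v k ∈ tangentAt X.carrier x) →
              f g x v = T x v + ((-1 : ℤ) ^ (q + 1)) • h (fun a => g a.castSucc) x v
                + ∑ a : Fin q, ((-1 : ℤ) ^ ((a : ℕ) + 1)) •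
                    h (mulInsert G g a) x v) := by
  obtain ⟨R, hR⟩ := AlgGVariety.exists_isAverage hG LD.L_connected LD.L_reductive hX
  exact ⟨fun ω _ => AlgGVariety.isInvariantForm_iff r ω, hR.exists_eq_coboundary r⟩
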